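/- arXiv:1708.00471 — 4 statements merged into one kernel-verified Lean document; each statement's English description precedes it below -/
import Mathlib

section
/- Let n, r ∈ ℕ with 1 ≤ r ≤ n−1, and let X_1, …, X_{r+1} be independent random points in ℝ^n, each distributed according to the standard Gaussian measure γ_n. Let 𝒟_{n,r} denote the Euclidean distance from the origin to the affine subspace spanned by X_1, …, X_{r+1}. Then the distribution of 𝒟_{n,r}² coincides with the distribution of Z/(r+1), where Z has the χ²-distribution with n−r degrees of freedom. -/
open MeasureTheory Real Filter Finset

/-- The standard Gaussian measure on `ℝ^n`. -/
noncomputable def stdGaussian (n : ℕ) : Measure (EuclideanSpace ℝ (Fin n)) :=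
  volume.withDensity fun x =>
    ENNReal.ofReal ((2 * π) ^ (-(n : ℝ) / 2) * Real.exp (-‖x‖ ^ 2 / 2))

/-- The χ²-distribution with `d` degrees of freedom. -/
noncomputable def chiSq (d : ℕ) : Measure ℝ :=
  volume.withDensity fun x =>
    if 0 < x then
      ENNReal.ofReal (x ^ ((d : ℝ) / 2 - 1) * Real.exp (-x / 2)
        / ((2 : ℝ) ^ ((d : ℝ) / 2) * Real.Gamma ((d : ℝ) / 2)))
    else 0

/-- The distance from the origin to the affine span of the points `X 0, …, X r` in `ℝ^n`. -/
noncomputable def distToAffSpan {n r : ℕ} (X : Fin (r + 1) → EuclideanSpace ℝ (Fin n)) : ℝ :=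
  Metric.infDist (0 : EuclideanSpace ℝ (Fin n))
    (affineSpan ℝ (Set.range X) : Set (EuclideanSpace ℝ (Fin n)))

lemma lintegral_polar {E : Type*} [NormedAddCommGroup E] [NormedSpace ℝ E] [MeasurableSpace E]
    [Nontrivial E] (μ : Measure E) [FiniteDimensional ℝ E] [BorelSpace E] [μ.IsAddHaarMeasure]
    (f : ℝ → ENNReal) (hf : Measurable f) :
    ∫⁻ x, f ‖x‖ ∂μ = (Module.finrank ℝ E : ENNReal) * μ (Metric.ball 0 1) *
      ∫⁻ y in Set.Ioi (0 : ℝ), ENNReal.ofReal (y ^ (Module.finrank ℝ E - 1)) * f y :=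
  calc
    ∫⁻ x, f ‖x‖ ∂μ = ∫⁻ x : ({(0)}ᶜ : Set E), f (‖x.1‖) ∂(μ.comap (↑)) := by
      rw [lintegral_subtype_comap (measurableSet_singleton _).compl fun x ↦ f (‖x‖),
        restrict_compl_singleton]
    _ = ∫⁻ x, f x.2 ∂μ.toSphere.prod (.volumeIoiPow (Module.finrank ℝ E - 1)) := by
      have := μ.measurePreserving_homeomorphUnitSphereProd.lintegral_comp
        (f := f ∘ Subtype.val ∘ Prod.snd) (by fun_prop)
      simpa using this
    _ = μ.toSphere Set.univ * ∫⁻ x : Set.Ioi (0 : ℝ), f x ∂.volumeIoiPow (Module.finrank ℝ E - 1) := by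
      rw [lintegral_prod _ (by fun_prop)]
      simp [mul_comm]
    _ = _ := by
      rw [μ.toSphere_apply_univ]
      congr 1
      simp only [Measure.volumeIoiPow]
      rw [lintegral_withDensity_eq_lintegral_mul _ (by fun_prop) (by fun_prop)]
      simp only [Pi.mul_apply]
      rw [lintegral_subtype_comap measurableSet_Ioi
        fun a : ℝ ↦ ENNReal.ofReal (a ^ (Module.finrank ℝ E - 1)) * f a]

lemma stdGaussian_sq (d : ℕ) (hd : 1 ≤ d) :
    (stdGaussian d).map (fun x => ‖x‖ ^ 2) = chiSq d := by
  ext S hS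
  have : Nonempty (Fin d) := ⟨⟨0, hd⟩⟩
  rw [Measure.map_apply (by fun_prop) hS, stdGaussian, chiSq,
    withDensity_apply _ (measurableSet_preimage (by fun_prop) hS), withDensity_apply _ hS,
    ← lintegral_indicator (measurableSet_preimage (by fun_prop) hS), ← lintegral_indicator hS]
  set dens : ℝ → ENNReal := fun x => ENNReal.ofReal (x ^ ((d : ℝ) / 2 - 1) * Real.exp (-x / 2)
        / ((2 : ℝ) ^ ((d : ℝ) / 2) * Real.Gamma ((d : ℝ) / 2))) with hdens
  have h1 : (∫⁻ x, S.indicator (fun x : ℝ => if 0 < x then dens x else 0) x)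
      = ∫⁻ x in Set.Ioi 0, S.indicator dens x := by
    rw [← lintegral_indicator measurableSet_Ioi]
    congr 1; ext x
    by_cases h : 0 < x <;> by_cases h' : x ∈ S <;> simp [h, h']
  have him : (fun y : ℝ => y ^ 2) '' Set.Ioi 0 = Set.Ioi 0 := by
    ext x; constructor
    · rintro ⟨y, hy, rfl⟩
      have : (0:ℝ) < y := hy
      show 0 < y ^ 2
      positivity
    · intro hx
      exact ⟨√x, Real.sqrt_pos.2 hx, Real.sq_sqrt (le_of_lt hx)⟩
  have h2 : ∫⁻ x in Set.Ioi 0, S.indicator dens x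
      = ∫⁻ y in Set.Ioi (0:ℝ), ENNReal.ofReal |2 * y| * S.indicator dens (y ^ 2) := by
    conv_lhs => rw [← him]
    rw [lintegral_image_eq_lintegral_abs_deriv_mul measurableSet_Ioi (f' := fun y => 2 * y)]
    · intro x hx
      simpa using (hasDerivAt_pow 2 x).hasDerivWithinAt
    · intro x hx y hy hxy
      exact (pow_left_inj₀ (le_of_lt hx) (le_of_lt hy) two_ne_zero).1 hxy
  rw [h1, h2]
  set F : ℝ → ENNReal := fun y => Set.indicator {y : ℝ | y ^ 2 ∈ S}
    (fun y => ENNReal.ofReal ((2 * π) ^ (-(d : ℝ) / 2) * Real.exp (-y ^ 2 / 2))) y with hF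
  have hFm : Measurable F := by
    apply Measurable.indicator
    · fun_prop
    · exact measurableSet_preimage (f := fun y : ℝ => y ^ 2) (by fun_prop) hS
  have h3 := lintegral_polar (volume : Measure (EuclideanSpace ℝ (Fin d))) F hFm
  have h4 : ∀ x : EuclideanSpace ℝ (Fin d),
      ((fun x : EuclideanSpace ℝ (Fin d) => ‖x‖ ^ 2) ⁻¹' S).indicator (fun x =>
        ENNReal.ofReal ((2 * π) ^ (-(d : ℝ) / 2) * Real.exp (-‖x‖ ^ 2 / 2))) x = F ‖x‖ := by
    intro x
    by_cases h : ‖x‖ ^ 2 ∈ S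
    · have hz : F ‖x‖ = ENNReal.ofReal ((2 * π) ^ (-(d : ℝ) / 2) * Real.exp (-‖x‖ ^ 2 / 2)) :=
        Set.indicator_of_mem (by exact h) _
      rw [hz]
      exact Set.indicator_of_mem (by exact h) _
    · have hz : F ‖x‖ = 0 := Set.indicator_of_notMem (by exact h) _
      rw [hz]
      exact Set.indicator_of_notMem (by exact h) _
  simp_rw [h4]
  rw [h3, ← lintegral_const_mul _ (by fun_prop)]
  apply setLIntegral_congr_fun measurableSet_Ioi
  intro y hy
  have hy : 0 < y := hy
  by_cases h : y ^ 2 ∈ S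
  swap
  · have hz : F y = 0 := Set.indicator_of_notMem (by exact h) _
    simp only [hz, Set.indicator_of_notMem h, mul_zero]
  have hz : F y = ENNReal.ofReal ((2 * π) ^ (-(d : ℝ) / 2) * Real.exp (-y ^ 2 / 2)) :=
    Set.indicator_of_mem (by exact h) _
  simp only [hz, Set.indicator_of_mem h]
  rw [EuclideanSpace.volume_ball, hdens]
  simp only [finrank_euclideanSpace, Fintype.card_fin, ENNReal.ofReal_one, one_pow, one_mul]
  rw [← ENNReal.ofReal_natCast, ← ENNReal.ofReal_mul (by positivity), ← ENNReal.ofReal_mul (by positivity),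
     ← ENNReal.ofReal_mul (by positivity), ← ENNReal.ofReal_mul (by positivity)]
  congr 1
  have hd' : (0:ℝ) < d := by exact_mod_cast hd
  rw [abs_of_pos (by positivity), Real.Gamma_add_one (by positivity)]
  have e1 : (y ^ 2) ^ ((d:ℝ) / 2 - 1) = y ^ (d - 1) / y := by
    rw [← Real.rpow_natCast y 2, ← Real.rpow_mul hy.le, ← Real.rpow_natCast y (d-1), ← Real.rpow_sub_one hy.ne']
    congr 1
    push_cast [hd]
    ring
  have e2 : (2 * π) ^ (-(d:ℝ) / 2) = ((2:ℝ) ^ ((d:ℝ)/2))⁻¹ * (√π ^ d)⁻¹ := by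
    rw [neg_div, Real.rpow_neg (by positivity), Real.mul_rpow (by positivity) (by positivity), mul_inv]
    congr 2
    rw [Real.sqrt_eq_rpow, ← Real.rpow_natCast, ← Real.rpow_mul (by positivity)]
    congr 1; ring
  rw [e1, e2]
  have := Real.Gamma_pos_of_pos (show (0:ℝ) < d/2 by positivity)
  field_simp

lemma stdGaussian_eq (n : ℕ) :
    stdGaussian n = ProbabilityTheory.stdGaussian (EuclideanSpace ℝ (Fin n)) := by
  have hint := GaussianFourier.integrable_cexp_neg_mul_sq_norm_add_of_euclideanSpace
    (ι := Fin n) (b := 1/2) (by norm_num) 0 0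
  have hfin : IsFiniteMeasure (stdGaussian n) := by
    apply isFiniteMeasure_withDensity_ofReal
    have h := (hint.norm.const_mul ((2 * π) ^ (-(n : ℝ) / 2))).2
    have e : (fun x : EuclideanSpace ℝ (Fin n) => (2 * π) ^ (-(n : ℝ) / 2) *
        ‖Complex.exp (-(1 / 2) * (‖x‖ : ℂ) ^ 2 + 0 * ((inner ℝ 0 x : ℝ) : ℂ))‖) =
        fun x => (2 * π) ^ (-(n : ℝ) / 2) * Real.exp (-‖x‖ ^ 2 / 2) := by
      ext x
      rw [Complex.norm_exp]
      congr 2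
      simp [← Complex.ofReal_pow]
      ring
    rw [e] at h
    exact h
  apply Measure.ext_of_charFun
  ext t
  rw [ProbabilityTheory.charFun_stdGaussian, charFun_apply, stdGaussian,
    integral_withDensity_eq_integral_toReal_smul (by fun_prop) (by simp)]
  have := GaussianFourier.integral_cexp_neg_mul_sq_norm_add_of_euclideanSpace (ι := Fin n)
    (b := 1/2) (by norm_num) Complex.I t
  have h2 : ∀ x : EuclideanSpace ℝ (Fin n),
      (ENNReal.ofReal ((2 * π) ^ (-(n : ℝ) / 2) * Real.exp (-‖x‖ ^ 2 / 2))).toReal •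
        Complex.exp ((inner ℝ x t : ℝ) * Complex.I)
      = (((2 * π) ^ (-(n : ℝ) / 2) : ℝ) : ℂ) *
        Complex.exp (-(1/2) * ‖x‖ ^ 2 + Complex.I * (inner ℝ t x : ℝ)) := by
    intro x
    rw [ENNReal.toReal_ofReal (by positivity), Complex.real_smul, Complex.ofReal_mul, mul_assoc,
      Complex.ofReal_exp, ← Complex.exp_add, real_inner_comm]
    congr 2
    push_cast
    ring
  simp_rw [h2]
  rw [integral_const_mul, this, ← mul_assoc]
  have h3 : (((2 * π) ^ (-(n : ℝ) / 2) : ℝ) : ℂ) * ((π:ℂ) / (1/2)) ^ ((Fintype.card (Fin n) : ℂ) / 2) = 1 := by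
    have : ((π:ℂ) / (1/2)) ^ ((Fintype.card (Fin n) : ℂ) / 2)
        = (((2 * π) ^ ((n : ℝ) / 2) : ℝ) : ℂ) := by
      rw [Complex.ofReal_cpow (by positivity)]
      simp
      congr 1
      ring
    rw [this, ← Complex.ofReal_mul, ← Real.rpow_add (by positivity)]
    simp [neg_div]
  rw [h3, one_mul]
  congr 1
  simp
  ring
lemma gauss_proj {E : Type*} [NormedAddCommGroup E] [InnerProductSpace ℝ E] [FiniteDimensional ℝ E]
    [MeasurableSpace E] [BorelSpace E] (K : Submodule ℝ E) :
    (ProbabilityTheory.stdGaussian E).map K.orthogonalProjectionOnto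
      = ProbabilityTheory.stdGaussian K := by
  apply Measure.ext_of_charFun
  ext t
  rw [ProbabilityTheory.charFun_stdGaussian, charFun_apply,
    integral_map (by fun_prop) (by fun_prop)]
  have : ∀ x : E, (inner ℝ (K.orthogonalProjectionOnto x) t : ℝ) = inner ℝ x (t : E) := fun x =>
    Submodule.inner_orthogonalProjectionOnto_eq_of_mem_right t x
  simp_rw [this]
  rw [← charFun_apply, ProbabilityTheory.charFun_stdGaussian]
  simp

lemma infDist_sub {E : Type*} [NormedAddCommGroup E] [InnerProductSpace ℝ E]
    [FiniteDimensional ℝ E] (W : Submodule ℝ E) (y : E) :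
    Metric.infDist y (W : Set E) = ‖Wᗮ.orthogonalProjectionOnto y‖ := by
  rw [Metric.infDist_eq_iInf, ← Submodule.norm_coe, ← Submodule.starProjection_apply,
    Submodule.starProjection_orthogonal_val, Submodule.starProjection_minimal]
  simp_rw [dist_eq_norm]
  rfl

lemma map_infDist_sub (n d : ℕ) (hd : 1 ≤ d) (W : Submodule ℝ (EuclideanSpace ℝ (Fin n)))
    (hW : Module.finrank ℝ W + d = n) :
    (stdGaussian n).map (fun y => Metric.infDist y (W : Set (EuclideanSpace ℝ (Fin n))) ^ 2)
      = chiSq d := by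
  have hK : Module.finrank ℝ Wᗮ = d := by
    have := W.finrank_add_finrank_orthogonal
    simp at this
    omega
  let e := ((stdOrthonormalBasis ℝ Wᗮ).reindex (finCongr hK)).repr
  simp_rw [infDist_sub]
  have h1 : (fun y => ‖Wᗮ.orthogonalProjectionOnto y‖ ^ 2) =
      (fun x : EuclideanSpace ℝ (Fin d) => ‖x‖ ^ 2) ∘ e ∘ Wᗮ.orthogonalProjectionOnto := by
    ext y
    simp
  rw [h1, ← Measure.map_map (by fun_prop) (by fun_prop),
    ← Measure.map_map (by fun_prop) (by fun_prop), stdGaussian_eq, gauss_proj,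
    ProbabilityTheory.stdGaussian_map, ← stdGaussian_eq, stdGaussian_sq d hd]

instance (n : ℕ) : IsProbabilityMeasure (stdGaussian n) := by
  rw [stdGaussian_eq]; infer_instance

open Matrix in
lemma rot (n m : ℕ) (M : Matrix (Fin m) (Fin m) ℝ) (hM : M * Mᵀ = 1) :
    (Measure.pi fun _ : Fin m => stdGaussian n).map
      (fun X i => ∑ j, M i j • X j) = Measure.pi fun _ : Fin m => stdGaussian n := by
  have hmeas : Measurable (fun (X : Fin m → EuclideanSpace ℝ (Fin n)) (i : Fin m) =>
      ∑ j, M i j • X j) := by fun_prop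
  have : IsProbabilityMeasure ((Measure.pi fun _ : Fin m => stdGaussian n).map
      (fun X i => ∑ j, M i j • X j)) := Measure.isProbabilityMeasure_map hmeas.aemeasurable
  have hchar : ∀ t : PiLp 2 (fun _ : Fin m => EuclideanSpace ℝ (Fin n)),
      charFun ((Measure.pi fun _ : Fin m => stdGaussian n).map (WithLp.toLp 2)) t
        = Complex.exp (((-∑ i, ‖t i‖ ^ 2 / 2 : ℝ)) : ℂ) := by
    intro t
    rw [charFun_pi]
    simp_rw [stdGaussian_eq, ProbabilityTheory.charFun_stdGaussian]
    rw [← Complex.exp_sum]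
    congr 1
    push_cast
    rw [← Finset.sum_neg_distrib]
    simp [neg_div]
  apply (MeasurableEquiv.toLp 2 (Fin m → EuclideanSpace ℝ (Fin n))).map_measurableEquiv_injective
  rw [MeasurableEquiv.coe_toLp]
  have := Measure.isProbabilityMeasure_map (μ := ((Measure.pi fun _ : Fin m => stdGaussian n).map
      (fun X i => ∑ j, M i j • X j))) (f := WithLp.toLp 2) (by fun_prop)
  have := Measure.isProbabilityMeasure_map (μ := (Measure.pi fun _ : Fin m => stdGaussian n))
     (f := WithLp.toLp 2) (by fun_prop)
  apply Measure.ext_of_charFun (E := PiLp 2 (fun _ : Fin m => EuclideanSpace ℝ (Fin n)))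
  ext t
  let t' : PiLp 2 (fun _ : Fin m => EuclideanSpace ℝ (Fin n)) :=
    WithLp.toLp 2 (fun j => ∑ i, M i j • t i)
  have h1 : charFun (((Measure.pi fun _ : Fin m => stdGaussian n).map
      (fun X i => ∑ j, M i j • X j)).map (WithLp.toLp 2)) t =
      charFun ((Measure.pi fun _ : Fin m => stdGaussian n).map (WithLp.toLp 2)) t' := by
    rw [charFun_apply, charFun_apply, integral_map (by fun_prop) (by fun_prop),
      integral_map hmeas.aemeasurable (by fun_prop), integral_map (by fun_prop) (by fun_prop)]
    congr 1; ext x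
    congr 3
    have ha : (inner ℝ (WithLp.toLp 2 (fun i => ∑ j, M i j • x j)) t : ℝ)
      = ∑ i, inner ℝ (∑ j, M i j • x j) (t i) := PiLp.inner_apply _ _
    have hb : (inner ℝ (WithLp.toLp 2 x) t' : ℝ)
      = ∑ i, inner ℝ (x i) (t' i) := PiLp.inner_apply _ _
    rw [ha, hb]
    simp only [t', sum_inner, inner_sum, real_inner_smul_left,
      real_inner_smul_right]
    rw [Finset.sum_comm]
  rw [h1, hchar, hchar]
  congr 3
  rw [← Finset.sum_div, ← Finset.sum_div]
  congr 1
  simp only [← real_inner_self_eq_norm_sq, t', sum_inner, inner_sum, real_inner_smul_left,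
      real_inner_smul_right]
  rw [Finset.sum_comm]
  apply Finset.sum_congr rfl
  intro i _
  rw [Finset.sum_comm]
  have h2 : ∀ k, ∑ j, M i j * M k j = if i = k then 1 else 0 := by
    intro k
    have := congrFun (congrFun hM i) k
    rw [Matrix.mul_apply, Matrix.one_apply] at this
    simpa using this
  have h3 : ∀ k, ∑ j, M i j * (M k j * (inner ℝ (t k) (t i) : ℝ))
      = if i = k then (inner ℝ (t k) (t i) : ℝ) else 0 := by
    intro k
    simp_rw [← mul_assoc]
    rw [← Finset.sum_mul]
    rw [h2]
    simp
  simp_rw [h3]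
  simp

lemma ae_linInd (n r : ℕ) (hrn : r ≤ n) :
    ∀ᵐ V ∂(Measure.pi fun _ : Fin r => stdGaussian n), LinearIndependent ℝ V := by
  induction r with
  | zero => exact ae_of_all _ fun V => linearIndependent_empty_type
  | succ r ih =>
    have hms : MeasurableSet {V : Fin (r+1) → EuclideanSpace ℝ (Fin n) | LinearIndependent ℝ V} :=
      isOpen_setOfPred_linearIndependent.measurableSet
    have hmp := measurePreserving_piFinSuccAbove (fun _ : Fin (r+1) => stdGaussian n) 0
    have hmp' := hmp.symm
    rw [← hmp'.map_eq, ae_map_iff (by fun_prop) hms]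
    have hms2 : MeasurableSet {p : EuclideanSpace ℝ (Fin n) × (Fin r → EuclideanSpace ℝ (Fin n)) |
        LinearIndependent ℝ ((MeasurableEquiv.piFinSuccAbove (fun _ => EuclideanSpace ℝ (Fin n)) 0).symm p)} :=
      measurableSet_preimage (MeasurableEquiv.measurable _) hms
    rw [← Measure.prod_swap, ae_map_iff (by fun_prop) hms2]
    apply (Measure.ae_prod_iff_ae_ae (hms2.preimage measurable_swap)).2
    filter_upwards [ih (by omega)] with V hV
    have hne : Submodule.span ℝ (Set.range V) ≠ ⊤ := by
      intro h
      have := finrank_span_eq_card hV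
      rw [h] at this
      simp at this
      omega
    have h0 : ∀ᵐ y ∂(stdGaussian n), y ∉ Submodule.span ℝ (Set.range V) := by
      apply (withDensity_absolutelyContinuous _ _).ae_le
      have := Measure.addHaar_submodule (volume : Measure (EuclideanSpace ℝ (Fin n))) _ hne
      exact measure_eq_zero_iff_ae_notMem.1 this
    filter_upwards [h0] with y hy
    have hlin : LinearIndependent ℝ (Fin.cons y V : Fin (r+1) → EuclideanSpace ℝ (Fin n)) :=
      linearIndependent_finCons.2 ⟨hV, hy⟩
    convert hlin using 1
    ext i : 1
    refine Fin.cases ?_ (fun j => ?_) i <;> simp [MeasurableEquiv.piFinSuccAbove_symm_apply, Fin.consEquiv]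

open Matrix in
lemma dist_formula (n r : ℕ) (M : Matrix (Fin (r+1)) (Fin (r+1)) ℝ) (hM : M * Mᵀ = 1)
    (s : ℝ) (hs : 0 < s) (hs2 : s ^ 2 = r + 1) (h0 : ∀ j, M 0 j = s⁻¹)
    (X : Fin (r+1) → EuclideanSpace ℝ (Fin n)) :
    distToAffSpan X = s⁻¹ * Metric.infDist (∑ j, M 0 j • X j)
      (Submodule.span ℝ (Set.range fun i : Fin r => ∑ j, M i.succ j • X j) : Set (EuclideanSpace ℝ (Fin n))) := by
  set Y : Fin (r+1) → EuclideanSpace ℝ (Fin n) := fun i => ∑ j, M i j • X j with hY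
  change distToAffSpan X = s⁻¹ * Metric.infDist (Y 0)
    (Submodule.span ℝ (Set.range fun i : Fin r => Y i.succ) : Set (EuclideanSpace ℝ (Fin n)))
  set W := Submodule.span ℝ (Set.range fun i : Fin r => Y i.succ) with hW
  have hMt : Mᵀ * M = 1 := mul_eq_one_comm.1 hM
  have hX : ∀ j, X j = ∑ i, M i j • Y i := by
    intro j
    simp only [hY, Finset.smul_sum, smul_smul]
    rw [Finset.sum_comm]
    simp_rw [← Finset.sum_smul]
    have : ∀ k, ∑ i, M i j * M i k = if j = k then 1 else 0 := by
      intro k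
      have := congrFun (congrFun hMt j) k
      rw [Matrix.mul_apply, Matrix.one_apply] at this
      simpa using this
    simp_rw [this]
    simp
  have hrow : ∀ i : Fin r, ∑ j, M i.succ j = 0 := by
    intro i
    have := congrFun (congrFun hM i.succ) 0
    rw [Matrix.mul_apply, Matrix.one_apply, if_neg (Fin.succ_ne_zero i)] at this
    simp only [Matrix.transpose_apply, h0] at this
    rw [← Finset.sum_mul] at this
    exact (mul_eq_zero.1 this).resolve_right (by positivity)
  have hmemV : ∀ j, X j - X 0 ∈ vectorSpan ℝ (Set.range X) := fun j =>
    vsub_mem_vectorSpan ℝ ⟨j, rfl⟩ ⟨0, rfl⟩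
  have hWV : W = vectorSpan ℝ (Set.range X) := by
    apply le_antisymm
    · rw [hW, Submodule.span_le]
      rintro _ ⟨i, rfl⟩
      have : Y i.succ = ∑ j, M i.succ j • (X j - X 0) := by
        simp only [smul_sub, Finset.sum_sub_distrib, ← Finset.sum_smul, hrow, zero_smul, sub_zero,
          hY]
      change Y i.succ ∈ vectorSpan ℝ (Set.range X)
      rw [this]
      exact Submodule.sum_mem _ fun j _ => Submodule.smul_mem _ _ (hmemV j)
    · rw [vectorSpan_def, Submodule.span_le]
      rintro _ ⟨_, ⟨j, rfl⟩, _, ⟨k, rfl⟩, rfl⟩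
      change X j - X k ∈ W
      rw [hX j, hX k, Fin.sum_univ_succ, Fin.sum_univ_succ, h0, h0, add_sub_add_left_eq_sub]
      have hm : ∀ j, ∑ i : Fin r, M i.succ j • Y i.succ ∈ W := fun j =>
        Submodule.sum_mem _ fun i _ => Submodule.smul_mem _ _ (Submodule.subset_span ⟨i, rfl⟩)
      exact Submodule.sub_mem _ (hm j) (hm k)
  have hmean : s⁻¹ • Y 0 - X 0 ∈ W := by
    have : s⁻¹ • Y 0 - X 0 = ∑ j, (s⁻¹ * s⁻¹) • (X j - X 0) := by
      simp only [smul_sub, Finset.sum_sub_distrib, hY, h0, Finset.smul_sum, smul_smul]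
      congr 1
      simp only [Finset.sum_const, Finset.card_univ, Fintype.card_fin, ← Nat.cast_smul_eq_nsmul ℝ,
        smul_smul]
      push_cast
      rw [← hs2]
      field_simp
      simp
    rw [this, hWV]
    exact Submodule.sum_mem _ fun j _ => Submodule.smul_mem _ _ (hmemV j)
  have hX0 : X 0 ∈ affineSpan ℝ (Set.range X) := subset_affineSpan ℝ _ ⟨0, rfl⟩
  have hA : ∀ x, x ∈ affineSpan ℝ (Set.range X) ↔ s⁻¹ • Y 0 - x ∈ W := by
    intro x
    have h1 : x ∈ affineSpan ℝ (Set.range X) ↔ x - X 0 ∈ W := by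
      rw [hWV, ← direction_affineSpan]
      exact (AffineSubspace.vsub_right_mem_direction_iff_mem hX0 x).symm
    rw [h1, ← Submodule.sub_mem_iff_right W hmean]
    simp
  have hscale : ∀ w, dist 0 (s⁻¹ • Y 0 - s⁻¹ • w) = s⁻¹ * dist (Y 0) w := by
    intro w
    rw [dist_zero_left, ← smul_sub, norm_smul, dist_eq_norm, Real.norm_of_nonneg (by positivity)]
  unfold distToAffSpan
  apply le_antisymm
  · rw [← inv_mul_le_iff₀ (by positivity)]
    apply (Metric.le_infDist ⟨0, W.zero_mem⟩).2
    intro w hw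
    rw [inv_mul_le_iff₀ (by positivity), ← hscale]
    apply Metric.infDist_le_dist_of_mem
    apply (hA _).2
    simpa using W.smul_mem s⁻¹ hw
  · apply (Metric.le_infDist ⟨X 0, hX0⟩).2
    intro x hx
    have h1 := (hA x).1 hx
    have h2 := W.smul_mem s h1
    have h3 := hscale (s • (s⁻¹ • Y 0 - x))
    rw [smul_smul, inv_mul_cancel₀ hs.ne', one_smul, sub_sub_cancel] at h3
    rw [h3]
    gcongr
    exact Metric.infDist_le_dist_of_mem h2

lemma exists_M (r : ℕ) (s : ℝ) (hs : 0 < s) (hs2 : s ^ 2 = r + 1) :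
    ∃ M : Matrix (Fin (r+1)) (Fin (r+1)) ℝ, M * M.transpose = 1 ∧ ∀ j, M 0 j = s⁻¹ := by
  let u : EuclideanSpace ℝ (Fin (r+1)) := WithLp.toLp 2 (fun _ => s⁻¹)
  have hu : ‖u‖ = 1 := by
    rw [EuclideanSpace.norm_eq]
    simp [u, hs2]
    field_simp
  have ho : Orthonormal ℝ (({0} : Set (Fin (r+1))).domRestrict (fun _ => u)) := by
    rw [orthonormal_iff_ite]
    rintro ⟨i, hi⟩ ⟨j, hj⟩
    have hi : i = 0 := hi
    have hj : j = 0 := hj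
    subst hi hj
    simp [Set.domRestrict, hu]
  obtain ⟨b, hb⟩ := ho.exists_orthonormalBasis_extension_of_card_eq (by simp)
  refine ⟨Matrix.of fun i j => b i j, ?_, ?_⟩
  · ext i k
    have := orthonormal_iff_ite.1 b.orthonormal k i
    rw [PiLp.inner_apply] at this
    rw [Matrix.mul_apply, Matrix.one_apply]
    simp at this ⊢
    rw [this]
    simp [eq_comm]
  · intro j
    simp [hb 0 rfl, u]

lemma meas_infDist (n r : ℕ) : Measurable
    (fun p : EuclideanSpace ℝ (Fin n) × (Fin r → EuclideanSpace ℝ (Fin n)) =>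
      Metric.infDist p.1 (Submodule.span ℝ (Set.range p.2) : Set (EuclideanSpace ℝ (Fin n)))) := by
  apply measurable_of_Iio
  intro a
  have : (fun p : EuclideanSpace ℝ (Fin n) × (Fin r → EuclideanSpace ℝ (Fin n)) =>
      Metric.infDist p.1 (Submodule.span ℝ (Set.range p.2) : Set (EuclideanSpace ℝ (Fin n)))) ⁻¹'
      Set.Iio a = ⋃ c : Fin r → ℝ, {p | dist p.1 (∑ i, c i • p.2 i) < a} := by
    ext p
    simp only [Set.mem_preimage, Set.mem_Iio, Set.mem_iUnion, Set.mem_ofPred_eq]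
    rw [Metric.infDist_lt_iff ⟨0, Submodule.zero_mem _⟩]
    constructor
    · rintro ⟨y, hy, h⟩
      obtain ⟨c, rfl⟩ := (Submodule.mem_span_range_iff_exists_fun ℝ).1 hy
      exact ⟨c, h⟩
    · rintro ⟨c, h⟩
      exact ⟨_, (Submodule.mem_span_range_iff_exists_fun ℝ).2 ⟨c, rfl⟩, h⟩
  rw [this]
  apply IsOpen.measurableSet
  apply isOpen_iUnion
  intro c
  exact isOpen_lt (by fun_prop) continuous_const

theorem stmt5 (n r : ℕ) (hr : 1 ≤ r) (hrn : r ≤ n - 1) (hn : 1 ≤ n) :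
    Measure.map
        (fun X : Fin (r + 1) → EuclideanSpace ℝ (Fin n) => distToAffSpan X ^ 2)
        (Measure.pi fun _ => stdGaussian n)
      = Measure.map (fun z : ℝ => z / ((r : ℝ) + 1)) (chiSq (n - r)) := by
  set s : ℝ := √((r:ℝ)+1) with hsdef
  have hs : 0 < s := by positivity
  have hs2 : s ^ 2 = r + 1 := Real.sq_sqrt (by positivity)
  obtain ⟨M, hM, h0⟩ := exists_M r s hs hs2
  let g : EuclideanSpace ℝ (Fin n) × (Fin r → EuclideanSpace ℝ (Fin n)) → ℝ := fun p =>
    Metric.infDist p.1 (Submodule.span ℝ (Set.range p.2) : Set (EuclideanSpace ℝ (Fin n))) ^ 2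
  have hg : Measurable g := (meas_infDist n r).pow_const 2
  let e := MeasurableEquiv.piFinSuccAbove (fun _ : Fin (r+1) => EuclideanSpace ℝ (Fin n)) 0
  let T : (Fin (r + 1) → EuclideanSpace ℝ (Fin n)) → (Fin (r + 1) → EuclideanSpace ℝ (Fin n)) :=
    fun X i => ∑ j, M i j • X j
  have hT : Measurable T := by fun_prop
  have hfun : (fun X : Fin (r + 1) → EuclideanSpace ℝ (Fin n) => distToAffSpan X ^ 2)
      = (fun z : ℝ => z / ((r : ℝ) + 1)) ∘ g ∘ e ∘ T := by
    ext X
    rw [dist_formula n r M hM s hs hs2 h0 X, mul_pow, inv_pow, hs2]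
    simp only [Function.comp, g, e, T, MeasurableEquiv.piFinSuccAbove_apply]
    rw [div_eq_inv_mul]
    rfl
  rw [hfun, ← Measure.map_map (by fun_prop) (by fun_prop),
    ← Measure.map_map (by fun_prop) (by fun_prop), ← Measure.map_map (by fun_prop) (by fun_prop),
    rot n (r+1) M hM, (measurePreserving_piFinSuccAbove (fun _ : Fin (r+1) => stdGaussian n) 0).map_eq]
  congr 1
  ext S hS
  rw [Measure.map_apply hg hS, Measure.prod_apply_symm (hg hS)]
  have : ∀ᵐ V ∂(Measure.pi fun _ : Fin r => stdGaussian n),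
      stdGaussian n ((fun x => (x, V)) ⁻¹' (g ⁻¹' S)) = chiSq (n - r) S := by
    filter_upwards [ae_linInd n r (by omega)] with V hV
    have hd := finrank_span_eq_card hV
    rw [← map_infDist_sub n (n - r) (by omega) (Submodule.span ℝ (Set.range V)) (by simp at hd; omega),
      Measure.map_apply (by fun_prop) hS]
    rfl
  rw [lintegral_congr_ae this]
  simp
end

section
/- Let n, r ∈ ℕ with n ≥ 2 and 1 ≤ r ≤ n−1, and let X_1, …, X_{r+1} be independent random points distributed uniformly on the unit sphere S^{n−1} ⊂ ℝ^n. Let 𝒟_{n,r} denote the Euclidean distance from the origin to the affine subspace spanned by X_1, …, X_{r+1}. Then 𝒟_{n,r}² has the Beta distribution with parameters (n−r)/2 and r(n−1)/2. -/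
open MeasureTheory Real Filter Finset

/-- The uniform (normalized surface) probability measure on the unit sphere `S^{n-1} ⊂ ℝ^n`,
realized as the normalized `(n-1)`-dimensional Hausdorff measure on the sphere. -/
noncomputable def sphereUniform (n : ℕ) : Measure (EuclideanSpace ℝ (Fin n)) :=
  (μH[(n : ℝ) - 1] (Metric.sphere (0 : EuclideanSpace ℝ (Fin n)) 1))⁻¹ •
    (μH[(n : ℝ) - 1]).restrict (Metric.sphere (0 : EuclideanSpace ℝ (Fin n)) 1)

/-- The Beta distribution with parameters `a, b > 0`: the measure on `ℝ` with density
`t ↦ Γ(a+b)/(Γ(a)Γ(b)) t^(a-1) (1-t)^(b-1)` on `(0,1)`. -/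
noncomputable def betaDist (a b : ℝ) : Measure ℝ :=
  volume.withDensity fun t =>
    if 0 < t ∧ t < 1 then
      ENNReal.ofReal (Real.Gamma (a + b) / (Real.Gamma a * Real.Gamma b)
        * t ^ (a - 1) * (1 - t) ^ (b - 1))
    else 0

open scoped RealInnerProductSpace ENNReal

lemma finrank_orth_sphere {n : ℕ} {v : EuclideanSpace ℝ (Fin (n + 1))} (hv : ‖v‖ = 1) :
    Module.finrank ℝ (ℝ ∙ v)ᗮ = n := by
  have : Fact (Module.finrank ℝ (EuclideanSpace ℝ (Fin (n + 1))) = n + 1) := ⟨by simp⟩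
  exact Submodule.finrank_orthogonal_span_singleton (by rintro rfl; simp at hv)

lemma haus_half_sphere {n : ℕ} {v : EuclideanSpace ℝ (Fin (n + 1))} (hv : ‖v‖ = 1) :
    μH[(n : ℝ)] (Metric.sphere (0 : EuclideanSpace ℝ (Fin (n + 1))) 1 ∩ {x | ⟪v, x⟫ ≤ 0}) < ∞ := by
  have hfr := finrank_orth_sphere hv
  set f : (ℝ ∙ v)ᗮ → EuclideanSpace ℝ (Fin (n + 1)) := fun w => stereoInvFunAux v (w : _) with hf
  have hcd : ContDiff ℝ 1 f := contDiff_stereoInvFunAux.comp (ℝ ∙ v)ᗮ.subtypeL.contDiff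
  obtain ⟨C, hC⟩ := LocallyLipschitzOn.exists_lipschitzOnWith_of_compact
    (isCompact_closedBall (0 : (ℝ ∙ v)ᗮ) 2) (hcd.locallyLipschitz.locallyLipschitzOn)
  have hsub : (Metric.sphere (0 : EuclideanSpace ℝ (Fin (n + 1))) 1 ∩ {x | ⟪v, x⟫ ≤ 0}) ⊆
      f '' Metric.closedBall 0 2 := by
    rintro x ⟨hx, hx0⟩
    have hxn : ‖x‖ = 1 := by simpa using hx
    have hxv : x ≠ v := by
      rintro rfl
      simp only [Set.mem_ofPred_eq, real_inner_self_eq_norm_sq, hv] at hx0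
      norm_num at hx0
    refine ⟨stereoToFun v x, ?_, ?_⟩
    · rw [mem_closedBall_zero_iff, stereoToFun_apply, norm_smul]
      have h1 : ‖(ℝ ∙ v)ᗮ.orthogonalProjectionOnto x‖ ≤ 1 := by
        rw [← hxn]; exact Submodule.norm_orthogonalProjectionOnto_apply_le _ _
      have h2 : ‖(2 / (1 - innerSL ℝ v x) : ℝ)‖ ≤ 2 := by
        have h0 : ⟪v, x⟫ ≤ 0 := hx0
        simp only [innerSL_apply_apply]
        rw [Real.norm_of_nonneg (by apply div_nonneg <;> linarith), div_le_iff₀ (by linarith)]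
        linarith
      calc _ ≤ (2 : ℝ) * 1 := by gcongr
        _ = 2 := by norm_num
    · have := stereo_left_inv hv (x := ⟨x, hx⟩) hxv
      exact congrArg Subtype.val this
  have hfin : μH[(n : ℝ)] (Metric.closedBall (0 : (ℝ ∙ v)ᗮ) 2) < ∞ := by
    have := MeasureTheory.isAddHaarMeasure_hausdorffMeasure (E := (ℝ ∙ v)ᗮ)
    rw [hfr] at this
    exact measure_closedBall_lt_top
  refine (measure_mono hsub).trans_lt ?_
  refine (hC.hausdorffMeasure_image_le (by positivity)).trans_lt ?_
  exact ENNReal.mul_lt_top (ENNReal.rpow_lt_top_of_nonneg (by positivity) (by simp)) hfin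

lemma haus_sphere_lt_top (n : ℕ) :
    μH[(n : ℝ)] (Metric.sphere (0 : EuclideanSpace ℝ (Fin (n + 1))) 1) < ∞ := by
  have hv : ‖EuclideanSpace.single (0 : Fin (n + 1)) (1 : ℝ)‖ = 1 := by simp
  set v := EuclideanSpace.single (0 : Fin (n + 1)) (1 : ℝ)
  have hv' : ‖-v‖ = 1 := by simpa using hv
  refine (measure_mono ?_).trans_lt ((measure_union_le _ _).trans_lt
    (ENNReal.add_lt_top.2 ⟨haus_half_sphere hv, haus_half_sphere hv'⟩))
  intro x hx
  rcases le_total ⟪v, x⟫ 0 with h | h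
  · exact Or.inl ⟨hx, h⟩
  · exact Or.inr ⟨hx, by simpa using h⟩

lemma haus_sphere_pos (n : ℕ) :
    0 < μH[(n : ℝ)] (Metric.sphere (0 : EuclideanSpace ℝ (Fin (n + 1))) 1) := by
  have hv : ‖EuclideanSpace.single (0 : Fin (n + 1)) (1 : ℝ)‖ = 1 := by simp
  set v := EuclideanSpace.single (0 : Fin (n + 1)) (1 : ℝ)
  have hfr := finrank_orth_sphere hv
  have hpos : 0 < μH[(n : ℝ)] (Metric.ball (0 : (ℝ ∙ v)ᗮ) 1) := by
    have := MeasureTheory.isAddHaarMeasure_hausdorffMeasure (E := (ℝ ∙ v)ᗮ)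
    rw [hfr] at this
    exact Metric.measure_ball_pos _ _ one_pos
  refine hpos.trans_le ((measure_mono ?_).trans
    (hausdorffMeasure_orthogonalProjectionOnto_le (ℝ ∙ v)ᗮ (n : ℝ) _ (by positivity)))
  intro w hw
  have hw1 : ‖(w : EuclideanSpace ℝ (Fin (n + 1)))‖ < 1 := by simpa using hw
  have hwv : ⟪(w : EuclideanSpace ℝ (Fin (n + 1))), v⟫ = 0 :=
    Submodule.mem_orthogonal_singleton_iff_inner_left.1 w.2
  refine ⟨w + √(1 - ‖(w : EuclideanSpace ℝ (Fin (n + 1)))‖ ^ 2) • v, ?_, ?_⟩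
  · rw [mem_sphere_zero_iff_norm]
    have : ‖(w : EuclideanSpace ℝ (Fin (n + 1))) +
        √(1 - ‖(w : EuclideanSpace ℝ (Fin (n + 1)))‖ ^ 2) • v‖ ^ 2 = 1 := by
      rw [norm_add_sq_real, inner_smul_right, hwv, norm_smul, hv, mul_one, Real.norm_eq_abs, sq_abs,
        Real.sq_sqrt]
      · ring
      · have := norm_nonneg (w : EuclideanSpace ℝ (Fin (n + 1)))
        nlinarith
    exact (pow_eq_one_iff_of_nonneg (norm_nonneg _) two_ne_zero).1 this
  · rw [map_add, map_smul, Submodule.orthogonalProjectionOnto_mem_subspace_eq_self]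
    have : (ℝ ∙ v)ᗮ.orthogonalProjectionOnto v = 0 :=
      Submodule.orthogonalProjectionOnto_orthogonalComplement_singleton_eq_zero v
    rw [this, smul_zero, add_zero]

/-- Rotation invariant probability measures on the unit sphere. -/
structure IsUnif {E : Type*} [NormedAddCommGroup E] [InnerProductSpace ℝ E] [MeasurableSpace E]
    (μ : Measure E) : Prop where
  prob : IsProbabilityMeasure μ
  sph : ∀ᵐ x ∂μ, ‖x‖ = 1
  inv : ∀ T : E ≃ₗᵢ[ℝ] E, μ.map T = μ

lemma isUnif_sphereUniform (n : ℕ) : IsUnif (sphereUniform (n + 1)) := by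
  have hd : ((n + 1 : ℕ) : ℝ) - 1 = n := by push_cast; ring
  unfold sphereUniform
  rw [hd]
  refine ⟨⟨?_⟩, ?_, ?_⟩
  · rw [Measure.smul_apply, Measure.restrict_apply_univ, smul_eq_mul]
    exact ENNReal.inv_mul_cancel (haus_sphere_pos n).ne' (haus_sphere_lt_top n).ne
  · refine Measure.ae_smul_measure ?_ _
    filter_upwards [ae_restrict_mem Metric.isClosed_sphere.measurableSet] with x hx
    simpa using hx
  · intro T
    rw [Measure.map_smul]
    congr 1
    have h := (T.toIsometryEquiv.measurePreserving_hausdorffMeasure (n : ℝ)).restrict_preimage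
      (s := Metric.sphere 0 1) Metric.isClosed_sphere.measurableSet
    have h2 : T.toIsometryEquiv ⁻¹' (Metric.sphere 0 1) = Metric.sphere 0 1 := by
      ext x; simp
    rw [h2] at h
    exact h.map_eq

set_option linter.unusedSectionVars false
section Uniq
variable {E : Type*} [NormedAddCommGroup E] [InnerProductSpace ℝ E] [MeasurableSpace E]
  [BorelSpace E]

lemma exists_isometry_of_norm_eq [CompleteSpace E] {x y : E} (h : ‖x‖ = ‖y‖) :
    ∃ T : E ≃ₗᵢ[ℝ] E, T x = y :=
  ⟨(ℝ ∙ (x - y))ᗮ.reflection, Submodule.reflection_sub h⟩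

lemma charFun_map_isom {F : Type*} [NormedAddCommGroup F] [InnerProductSpace ℝ F]
    [MeasurableSpace F] [BorelSpace F] (μ : Measure E) (T : E ≃ₗᵢ[ℝ] F) (t : F) :
    charFun (μ.map T) t = charFun μ (T.symm t) := by
  rw [charFun_apply, charFun_apply]
  rw [show (⇑T : E → F) = T.toHomeomorph.toMeasurableEquiv from rfl, integral_map_equiv]
  congr 1; ext x
  congr 3
  simpa using (T.inner_map_map x (T.symm t))

lemma IsUnif.charFun_eq [CompleteSpace E] {μ : Measure E} (h : IsUnif μ) {s t : E}
    (hst : ‖s‖ = ‖t‖) : charFun μ s = charFun μ t := by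
  obtain ⟨T, rfl⟩ := exists_isometry_of_norm_eq hst
  conv_lhs => rw [← h.inv T.symm, charFun_map_isom]
  simp

lemma IsUnif.unique [CompleteSpace E] [SecondCountableTopology E] {μ ν : Measure E}
    (hμ : IsUnif μ) (hν : IsUnif ν) : μ = ν := by
  have := hμ.prob
  have := hν.prob
  apply Measure.ext_of_charFun
  ext t
  have key : ∀ {μ ν : Measure E}, IsUnif μ → IsUnif ν →
      ∫ y, ∫ x, Complex.exp ((‖t‖ * ⟪x, y⟫ : ℝ) * Complex.I) ∂μ ∂ν = charFun μ t := by
    intro μ ν hμ hν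
    have := hν.prob
    have : ∀ᵐ y ∂ν, ∫ x, Complex.exp ((‖t‖ * ⟪x, y⟫ : ℝ) * Complex.I) ∂μ = charFun μ t := by
      filter_upwards [hν.sph] with y hy
      rw [← hμ.charFun_eq (s := ‖t‖ • y) (by simp [norm_smul, hy]), charFun_apply]
      simp [inner_smul_right]
    rw [integral_congr_ae this]
    simp
  rw [← key hμ hν, ← key hν hμ, integral_integral_swap]
  · congr 1; ext x; congr 1; ext y; rw [real_inner_comm]
  · refine Integrable.of_bound (C := 1) ?_ ?_
    · refine Measurable.aestronglyMeasurable ?_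
      refine Continuous.measurable ?_
      simp only [Function.uncurry_def]
      fun_prop
    · refine Eventually.of_forall fun p => ?_
      simp only [Function.uncurry_def]
      rw [Complex.norm_exp_ofReal_mul_I]

end Uniq

section Gauss

/-- Gaussian probability measures, characterized by their characteristic function. -/
structure IsG {E : Type*} [NormedAddCommGroup E] [InnerProductSpace ℝ E] [MeasurableSpace E]
    (μ : Measure E) : Prop where
  prob : IsProbabilityMeasure μ
  cf : ∀ t, charFun μ t = Complex.exp ((-(‖t‖ ^ 2 / (4 * π)) : ℝ))

variable {E F : Type*} [NormedAddCommGroup E] [InnerProductSpace ℝ E] [MeasurableSpace E]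
  [BorelSpace E] [FiniteDimensional ℝ E] [NormedAddCommGroup F] [InnerProductSpace ℝ F]
  [MeasurableSpace F] [BorelSpace F] [FiniteDimensional ℝ F]

lemma IsG.unique {μ ν : Measure E} (hμ : IsG μ) (hν : IsG ν) : μ = ν := by
  have := hμ.prob
  have := hν.prob
  apply Measure.ext_of_charFun
  ext t
  rw [hμ.cf, hν.cf]

lemma IsG.map {μ : Measure E} (hμ : IsG μ) (T : E →L[ℝ] F)
    (hT : ∀ t, ‖ContinuousLinearMap.adjoint T t‖ = ‖t‖) : IsG (μ.map T) := by
  have := hμ.prob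
  refine ⟨Measure.isProbabilityMeasure_map T.continuous.aemeasurable, fun t => ?_⟩
  rw [← hT t, ← hμ.cf, charFun_apply, charFun_apply, integral_map T.continuous.aemeasurable]
  · congr 1; ext x; rw [ContinuousLinearMap.adjoint_inner_right]
  · refine Continuous.aestronglyMeasurable ?_
    fun_prop

lemma IsG.map_isom {μ : Measure E} (hμ : IsG μ) (T : E ≃ₗᵢ[ℝ] F) : IsG (μ.map T) := by
  have := hμ.prob
  refine ⟨Measure.isProbabilityMeasure_map T.continuous.aemeasurable, fun t => ?_⟩
  rw [charFun_map_isom, hμ.cf]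
  simp

lemma IsG.prod {μ : Measure E} {ν : Measure F} (hμ : IsG μ) (hν : IsG ν) :
    IsG ((μ.prod ν).map (WithLp.toLp 2)) := by
  have := hμ.prob
  have := hν.prob
  refine ⟨Measure.isProbabilityMeasure_map (by fun_prop), fun t => ?_⟩
  rw [charFun_prod, hμ.cf, hν.cf, ← Complex.exp_add, WithLp.prod_norm_sq_eq_of_L2]
  congr 1
  push_cast
  simp only [WithLp.ofLp_fst, WithLp.ofLp_snd]
  ring

lemma IsG.pi {ι : Type*} [Fintype ι] {μ : ι → Measure E} (hμ : ∀ i, IsG (μ i)) :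
    IsG ((Measure.pi μ).map (WithLp.toLp 2) : Measure (PiLp 2 (fun _ : ι => E))) := by
  have := fun i => (hμ i).prob
  refine ⟨Measure.isProbabilityMeasure_map (by fun_prop), fun t => ?_⟩
  rw [charFun_pi, Finset.prod_congr rfl (fun i _ => (hμ i).cf _), ← Complex.exp_sum,
    PiLp.norm_sq_eq_of_L2]
  congr 1
  push_cast
  rw [Finset.sum_div, Finset.sum_neg_distrib]

/-- The Gaussian measure with density `exp (-π‖x‖²)`. -/
noncomputable def gam (E : Type*) [NormedAddCommGroup E] [InnerProductSpace ℝ E] [MeasurableSpace E]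
    [BorelSpace E] [FiniteDimensional ℝ E] : Measure E :=
  (volume : Measure E).withDensity fun x => ENNReal.ofReal (rexp (-π * ‖x‖ ^ 2))

lemma withDensity_isG (m : Measure E)
    (h : ∀ t : E, ∫ x, Complex.exp (-π * ‖x‖ ^ 2 + Complex.I * ⟪t, x⟫) ∂m
      = Complex.exp ((-(‖t‖ ^ 2 / (4 * π)) : ℝ))) :
    IsG (m.withDensity fun x => ENNReal.ofReal (rexp (-π * ‖x‖ ^ 2))) := by
  have hcf : ∀ t, charFun (m.withDensity fun x => ENNReal.ofReal (rexp (-π * ‖x‖ ^ 2))) t =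
      Complex.exp ((-(‖t‖ ^ 2 / (4 * π)) : ℝ)) := by
    intro t
    rw [← h t, charFun_apply, integral_withDensity_eq_integral_toReal_smul (by fun_prop)
      (by simp)]
    congr 1; ext x
    rw [ENNReal.toReal_ofReal (by positivity), Complex.exp_add, real_inner_comm, Complex.real_smul]
    push_cast
    rw [mul_comm Complex.I]
  refine ⟨?_, hcf⟩
  have h0 := hcf 0
  rw [charFun_zero] at h0
  simp only [norm_zero] at h0
  norm_num at h0
  rw [← isProbabilityMeasure_iff_real] at h0
  convert h0 using 5
  ring

variable (E) in
lemma isG_gam : IsG (gam E) := by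
  apply withDensity_isG
  intro t
  have h := GaussianFourier.integral_cexp_neg_mul_sq_norm_add (V := E) (b := (π : ℂ))
    (by simpa using pi_pos) Complex.I t
  rw [h, div_self (by exact_mod_cast pi_ne_zero), Complex.one_cpow, one_mul]
  congr 1
  push_cast
  rw [Complex.I_sq]
  ring

/-- The one-dimensional version, with the usual Lebesgue measure. -/
noncomputable def gamR : Measure ℝ :=
  (volume : Measure ℝ).withDensity fun x => ENNReal.ofReal (rexp (-π * ‖x‖ ^ 2))

lemma isG_gamR : IsG gamR := by
  apply withDensity_isG
  intro t
  have h := fourierIntegral_gaussian (b := (π : ℂ)) (by simpa using pi_pos) (t : ℂ)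
  rw [div_self (by exact_mod_cast pi_ne_zero), Complex.one_cpow, one_mul] at h
  convert! h using 1
  · congr 1; ext x
    rw [← Complex.exp_add]
    congr 1
    simp only [Real.norm_eq_abs, ← Complex.ofReal_pow, sq_abs]
    simp
    ring
  · congr 1
    simp only [Real.norm_eq_abs, sq_abs]
    push_cast; ring

instance : IsProbabilityMeasure (gam E) := (isG_gam E).prob
instance : IsProbabilityMeasure gamR := isG_gamR.prob

lemma exists_isom_of_finrank {E F : Type*} [NormedAddCommGroup E] [InnerProductSpace ℝ E]
    [FiniteDimensional ℝ E] [NormedAddCommGroup F] [InnerProductSpace ℝ F] [FiniteDimensional ℝ F]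
    (h : Module.finrank ℝ E = Module.finrank ℝ F) : Nonempty (E ≃ₗᵢ[ℝ] F) :=
  ⟨(stdOrthonormalBasis ℝ E).equiv (stdOrthonormalBasis ℝ F) (finCongr h)⟩

/-- The law of the norm of a Gaussian vector depends only on the dimension. -/
lemma IsG.lintegral_norm {μ : Measure E} {ν : Measure F} (hμ : IsG μ) (hν : IsG ν)
    (h : Module.finrank ℝ E = Module.finrank ℝ F) (f : ℝ → ℝ≥0∞) (hf : Measurable f) :
    ∫⁻ x, f ‖x‖ ∂μ = ∫⁻ y, f ‖y‖ ∂ν := by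
  obtain ⟨T⟩ := exists_isom_of_finrank h
  rw [← (hμ.map_isom T).unique hν, lintegral_map (by fun_prop) T.continuous.measurable]
  simp

end Gauss

section Polar

lemma lintegral_gam_polar (E : Type*) [NormedAddCommGroup E] [InnerProductSpace ℝ E]
    [MeasurableSpace E] [BorelSpace E] [FiniteDimensional ℝ E] [Nontrivial E]
    (f : E → ℝ≥0∞) (hf : Measurable f) :
    ∫⁻ x, f x ∂(gam E) = ∫⁻ ω : Metric.sphere (0 : E) 1, ∫⁻ ρ in Set.Ioi (0 : ℝ),
      f (ρ • (ω : E)) * ENNReal.ofReal (ρ ^ (Module.finrank ℝ E - 1) * rexp (-π * ρ ^ 2))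
        ∂volume ∂(volume : Measure E).toSphere := by
  rw [gam, lintegral_withDensity_eq_lintegral_mul _ (by fun_prop) hf]
  set F : E → ℝ≥0∞ := fun x => ENNReal.ofReal (rexp (-π * ‖x‖ ^ 2)) * f x with hF
  have hFm : Measurable F := by fun_prop
  have h1 : ∫⁻ x, F x = ∫⁻ x in ({0}ᶜ : Set E), F x := by
    rw [restrict_compl_singleton]
  change ∫⁻ x, F x = _
  rw [h1, ← lintegral_subtype_comap (measurableSet_singleton (0 : E)).compl F]
  have h2 := (Measure.measurePreserving_homeomorphUnitSphereProd (volume : Measure E)).lintegral_comp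
    (f := fun p => F ((p.2 : ℝ) • (p.1 : E))) (by fun_prop)
  have h3 : ∀ x : ({0}ᶜ : Set E), F ((((homeomorphUnitSphereProd E) x).2 : ℝ) •
      (((homeomorphUnitSphereProd E) x).1 : E)) = F x := by
    intro x
    congr 1
    have hx : ‖(x : E)‖ ≠ 0 := norm_ne_zero_iff.2 x.2
    simp [homeomorphUnitSphereProd, smul_smul, hx]
  simp only [h3] at h2
  rw [h2, lintegral_prod _ (by fun_prop)]
  congr 1; ext ω
  rw [Measure.volumeIoiPow, lintegral_withDensity_eq_lintegral_mul _ (by fun_prop) (by fun_prop),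
    ← lintegral_subtype_comap measurableSet_Ioi]
  refine lintegral_congr fun ρ => ?_
  have hρ : (0 : ℝ) < ρ := ρ.2
  have hω : ‖(ω : E)‖ = 1 := by simp
  simp only [Pi.mul_apply, hF, norm_smul, hω, Real.norm_of_nonneg hρ.le, mul_one]
  rw [ENNReal.ofReal_mul (by positivity)]
  ring

lemma lintegral_half_polar (k : ℝ × ℝ → ℝ≥0∞) (hk : Measurable k) :
    ∫⁻ z : ℝ, ∫⁻ ρ in Set.Ioi (0 : ℝ), k (z, ρ) =
      ∫⁻ R in Set.Ioi (0 : ℝ), ∫⁻ θ in Set.Ioo 0 π, ENNReal.ofReal R * k (R * cos θ, R * sin θ) := by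
  have hs : MeasurableSet {p : ℝ × ℝ | 0 < p.2} := measurableSet_lt measurable_const measurable_snd
  have h := lintegral_comp_polarCoord_symm (Set.indicator {p : ℝ × ℝ | 0 < p.2} k)
  rw [polarCoord_target, Measure.volume_eq_prod, ← Measure.prod_restrict,
    lintegral_prod _ (by
      refine Measurable.aemeasurable ?_
      refine (ENNReal.measurable_ofReal.comp measurable_fst).smul ?_
      exact (hk.indicator hs).comp continuous_polarCoord_symm.measurable),
    lintegral_prod _ (hk.indicator hs).aemeasurable] at h
  have e1 : ∀ z : ℝ, ∫⁻ ρ in Set.Ioi (0 : ℝ), k (z, ρ) =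
      ∫⁻ ρ, Set.indicator {p : ℝ × ℝ | 0 < p.2} k (z, ρ) := by
    intro z
    rw [← lintegral_indicator measurableSet_Ioi]
    rfl
  simp only [e1]
  rw [← h]
  refine setLIntegral_congr_fun measurableSet_Ioi fun R hR => ?_
  have hR : 0 < R := hR
  rw [← lintegral_indicator measurableSet_Ioo, ← lintegral_indicator measurableSet_Ioo]
  refine lintegral_congr fun θ => ?_
  simp only [Set.indicator, polarCoord_symm_apply, Set.mem_Ioo, smul_eq_mul, Set.mem_ofPred_eq]
  by_cases h1 : 0 < θ ∧ θ < π
  · have h2 : -π < θ ∧ θ < π := ⟨by linarith [pi_pos], h1.2⟩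
    have h3 : 0 < R * sin θ := mul_pos hR (sin_pos_of_pos_of_lt_pi h1.1 h1.2)
    simp [h1, h2, h3]
  · by_cases h2 : -π < θ ∧ θ < π
    · have h0 : θ ≤ 0 := by
        by_contra hc; exact h1 ⟨not_le.1 hc, h2.2⟩
      have h3 : ¬ 0 < R * sin θ := by
        have := sin_nonpos_of_nonpos_of_neg_pi_le h0 h2.1.le
        simp only [not_lt]; exact mul_nonpos_of_nonneg_of_nonpos hR.le this
      simp [h1, h3]
    · simp [h1, h2]

lemma lintegral_quad_polar (k : ℝ × ℝ → ℝ≥0∞) (hk : Measurable k) :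
    ∫⁻ x in Set.Ioi (0 : ℝ), ∫⁻ y in Set.Ioi (0 : ℝ), k (x, y) =
      ∫⁻ R in Set.Ioi (0 : ℝ), ∫⁻ θ in Set.Ioo 0 (π / 2),
        ENNReal.ofReal R * k (R * cos θ, R * sin θ) := by
  have hs : MeasurableSet {p : ℝ × ℝ | 0 < p.1} := measurableSet_lt measurable_const measurable_fst
  have h := lintegral_half_polar (Set.indicator {p : ℝ × ℝ | 0 < p.1} k) (hk.indicator hs)
  rw [← lintegral_indicator measurableSet_Ioi]
  have e1 : ∀ x : ℝ, (Set.Ioi (0 : ℝ)).indicator (fun x => ∫⁻ y in Set.Ioi (0 : ℝ), k (x, y)) x =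
      ∫⁻ ρ in Set.Ioi (0 : ℝ), Set.indicator {p : ℝ × ℝ | 0 < p.1} k (x, ρ) := by
    intro x
    by_cases hx : 0 < x <;> simp [Set.indicator, hx]
  simp only [e1]
  rw [h]
  refine setLIntegral_congr_fun measurableSet_Ioi fun R hR => ?_
  have hR : 0 < R := hR
  rw [← lintegral_indicator measurableSet_Ioo, ← lintegral_indicator measurableSet_Ioo]
  refine lintegral_congr fun θ => ?_
  simp only [Set.indicator, Set.mem_Ioo, Set.mem_ofPred_eq]
  by_cases h1 : 0 < θ ∧ θ < π / 2
  · have h2 : 0 < θ ∧ θ < π := ⟨h1.1, by linarith [pi_pos]⟩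
    have h3 : 0 < cos θ := cos_pos_of_mem_Ioo ⟨by linarith, h1.2⟩
    simp [h1, h2, h3, hR]
  · by_cases h2 : 0 < θ ∧ θ < π
    · have h0 : π / 2 ≤ θ := by
        by_contra hc; exact h1 ⟨h2.1, not_le.1 hc⟩
      have h3 : ¬ 0 < cos θ := by
        have := cos_nonpos_of_pi_div_two_le_of_le h0 (by linarith)
        simpa using this
      simp [h1, h3, hR]
    · simp [h1, h2]
end Polar

section Circle

lemma sqrt_polar {R : ℝ} (hR : 0 < R) (θ : ℝ) : √((R * cos θ) ^ 2 + (R * sin θ) ^ 2) = R := by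
  have : (R * cos θ) ^ 2 + (R * sin θ) ^ 2 = R ^ 2 := by
    have := sin_sq_add_cos_sq θ
    linear_combination R ^ 2 * this
  rw [this, Real.sqrt_sq hR.le]

lemma circleA (M : ℕ) : ∃ c : ℝ≥0∞, ∀ h : ℝ × ℝ → ℝ≥0∞, Measurable h →
    ∫⁻ z : ℝ, ∫⁻ ρ in Set.Ioi (0 : ℝ), h (z / √(z ^ 2 + ρ ^ 2), ρ / √(z ^ 2 + ρ ^ 2)) *
      ENNReal.ofReal (ρ ^ M * rexp (-π * ρ ^ 2)) * ENNReal.ofReal (rexp (-π * z ^ 2)) =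
    c * ∫⁻ θ in Set.Ioo 0 π, h (cos θ, sin θ) * ENNReal.ofReal (sin θ ^ M) := by
  refine ⟨∫⁻ R in Set.Ioi (0 : ℝ), ENNReal.ofReal (R ^ (M + 1) * rexp (-π * R ^ 2)), fun h hh => ?_⟩
  rw [lintegral_half_polar (fun p => h (p.1 / √(p.1 ^ 2 + p.2 ^ 2), p.2 / √(p.1 ^ 2 + p.2 ^ 2)) *
      ENNReal.ofReal (p.2 ^ M * rexp (-π * p.2 ^ 2)) * ENNReal.ofReal (rexp (-π * p.1 ^ 2)))
      (by fun_prop)]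
  rw [← lintegral_mul_const _ (by fun_prop)]
  refine setLIntegral_congr_fun measurableSet_Ioi fun R hR => ?_
  have hR : 0 < R := hR
  rw [← lintegral_const_mul _ (by fun_prop)]
  refine setLIntegral_congr_fun measurableSet_Ioo fun θ hθ => ?_
  have hs : 0 < sin θ := sin_pos_of_pos_of_lt_pi hθ.1 hθ.2
  simp only [sqrt_polar hR]
  rw [mul_div_cancel_left₀ _ hR.ne', mul_div_cancel_left₀ _ hR.ne']
  have e : ENNReal.ofReal R * (ENNReal.ofReal ((R * sin θ) ^ M * rexp (-π * (R * sin θ) ^ 2)) *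
      ENNReal.ofReal (rexp (-π * (R * cos θ) ^ 2))) =
      ENNReal.ofReal (R ^ (M + 1) * rexp (-π * R ^ 2)) * ENNReal.ofReal (sin θ ^ M) := by
    rw [← ENNReal.ofReal_mul (by positivity), ← ENNReal.ofReal_mul (by positivity),
      ← ENNReal.ofReal_mul (by positivity), mul_assoc, ← Real.exp_add]
    have := sin_sq_add_cos_sq θ
    have e2 : -π * (R * sin θ) ^ 2 + -π * (R * cos θ) ^ 2 = -π * R ^ 2 := by
      linear_combination (-π * R ^ 2) * this
    rw [e2]; congr 1; ring
  calc _ = h (cos θ, sin θ) * (ENNReal.ofReal R *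
      (ENNReal.ofReal ((R * sin θ) ^ M * rexp (-π * (R * sin θ) ^ 2)) *
      ENNReal.ofReal (rexp (-π * (R * cos θ) ^ 2)))) := by ring
    _ = _ := by rw [e]; ring

lemma circleB (M : ℕ) : ∃ c : ℝ≥0∞, ∀ h : ℝ × ℝ → ℝ≥0∞, Measurable h →
    ∫⁻ ρ in Set.Ioi (0 : ℝ), ∫⁻ g in Set.Ioi (0 : ℝ),
      h ((ρ ^ 2 - g ^ 2) / (ρ ^ 2 + g ^ 2), 2 * g * ρ / (ρ ^ 2 + g ^ 2)) *
      ENNReal.ofReal (ρ ^ M * rexp (-π * ρ ^ 2)) * ENNReal.ofReal (g ^ M * rexp (-π * g ^ 2)) =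
    c * ∫⁻ θ in Set.Ioo 0 π, h (cos θ, sin θ) * ENNReal.ofReal (sin θ ^ M) := by
  refine ⟨(∫⁻ R in Set.Ioi (0 : ℝ), ENNReal.ofReal (R ^ (2 * M + 1) * rexp (-π * R ^ 2) / 2 ^ (M + 1))),
    fun h hh => ?_⟩
  rw [lintegral_quad_polar (fun p => h ((p.1 ^ 2 - p.2 ^ 2) / (p.1 ^ 2 + p.2 ^ 2),
      2 * p.2 * p.1 / (p.1 ^ 2 + p.2 ^ 2)) *
      ENNReal.ofReal (p.1 ^ M * rexp (-π * p.1 ^ 2)) *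
      ENNReal.ofReal (p.2 ^ M * rexp (-π * p.2 ^ 2))) (by fun_prop)]
  have himg : (fun φ : ℝ => 2 * φ) '' Set.Ioo 0 (π / 2) = Set.Ioo 0 π := by
    rw [Set.image_mul_left_Ioo two_pos]; simp [mul_div_cancel₀]
  rw [← himg, lintegral_image_eq_lintegral_abs_deriv_mul (f' := fun _ => 2) measurableSet_Ioo
    (fun x _ => by simpa using ((hasDerivAt_id x).const_mul (2 : ℝ)).hasDerivWithinAt)
    (fun x _ y _ hxy => by simpa using hxy)]
  rw [← lintegral_mul_const _ (by fun_prop)]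
  refine setLIntegral_congr_fun measurableSet_Ioi fun R hR => ?_
  have hR : 0 < R := hR
  rw [← lintegral_const_mul _ (by fun_prop)]
  refine setLIntegral_congr_fun measurableSet_Ioo fun θ hθ => ?_
  have hs : 0 < sin θ := sin_pos_of_pos_of_lt_pi hθ.1 (by linarith [hθ.2, pi_pos])
  have hc : 0 < cos θ := cos_pos_of_mem_Ioo ⟨by linarith [hθ.1, pi_pos], hθ.2⟩
  have h1 := sin_sq_add_cos_sq θ
  have hR2 : (R * cos θ) ^ 2 + (R * sin θ) ^ 2 = R ^ 2 := by linear_combination R ^ 2 * h1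
  have e0 : ((R * cos θ) ^ 2 - (R * sin θ) ^ 2) / R ^ 2 = cos (2 * θ) := by
    rw [cos_two_mul]; field_simp; linear_combination -h1
  have e1 : 2 * (R * sin θ) * (R * cos θ) / R ^ 2 = sin (2 * θ) := by
    rw [sin_two_mul]; field_simp
  simp only [hR2, e0, e1]
  have e : ENNReal.ofReal R * (ENNReal.ofReal ((R * cos θ) ^ M * rexp (-π * (R * cos θ) ^ 2)) *
      ENNReal.ofReal ((R * sin θ) ^ M * rexp (-π * (R * sin θ) ^ 2))) =
      ENNReal.ofReal (R ^ (2 * M + 1) * rexp (-π * R ^ 2) / 2 ^ (M + 1)) *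
        (ENNReal.ofReal |2| * ENNReal.ofReal (sin (2 * θ) ^ M)) := by
    rw [sin_two_mul]
    rw [← ENNReal.ofReal_mul (by positivity), ← ENNReal.ofReal_mul (by positivity),
      ← ENNReal.ofReal_mul (by positivity), ← ENNReal.ofReal_mul (by positivity)]
    have e2 : rexp (-π * (R * cos θ) ^ 2) * rexp (-π * (R * sin θ) ^ 2) = rexp (-π * R ^ 2) := by
      rw [← Real.exp_add]; congr 1; linear_combination (-π) * hR2
    rw [← e2, abs_of_pos two_pos]; congr 1; field_simp; ring
  calc _ = h (cos (2 * θ), sin (2 * θ)) * (ENNReal.ofReal R *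
      (ENNReal.ofReal ((R * cos θ) ^ M * rexp (-π * (R * cos θ) ^ 2)) *
      ENNReal.ofReal ((R * sin θ) ^ M * rexp (-π * (R * sin θ) ^ 2)))) := by ring
    _ = _ := by rw [e]; ring

lemma circleC (A B : ℕ) : ∃ c : ℝ≥0∞, ∀ h : ℝ → ℝ≥0∞, Measurable h →
    ∫⁻ x in Set.Ioi (0 : ℝ), ∫⁻ y in Set.Ioi (0 : ℝ),
      h (x ^ 2 / (x ^ 2 + y ^ 2)) *
      ENNReal.ofReal (x ^ A * rexp (-π * x ^ 2)) * ENNReal.ofReal (y ^ B * rexp (-π * y ^ 2)) =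
    c * ∫⁻ θ in Set.Ioo 0 (π / 2), h (cos θ ^ 2) * ENNReal.ofReal (cos θ ^ A * sin θ ^ B) := by
  refine ⟨(∫⁻ R in Set.Ioi (0 : ℝ), ENNReal.ofReal (R ^ (A + B + 1) * rexp (-π * R ^ 2))),
    fun h hh => ?_⟩
  rw [lintegral_quad_polar (fun p => h (p.1 ^ 2 / (p.1 ^ 2 + p.2 ^ 2)) *
      ENNReal.ofReal (p.1 ^ A * rexp (-π * p.1 ^ 2)) *
      ENNReal.ofReal (p.2 ^ B * rexp (-π * p.2 ^ 2))) (by fun_prop)]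
  rw [← lintegral_mul_const _ (by fun_prop)]
  refine setLIntegral_congr_fun measurableSet_Ioi fun R hR => ?_
  have hR : 0 < R := hR
  rw [← lintegral_const_mul _ (by fun_prop)]
  refine setLIntegral_congr_fun measurableSet_Ioo fun θ hθ => ?_
  have hs : 0 < sin θ := sin_pos_of_pos_of_lt_pi hθ.1 (by linarith [hθ.2, pi_pos])
  have hc : 0 < cos θ := cos_pos_of_mem_Ioo ⟨by linarith [hθ.1, pi_pos], hθ.2⟩
  have h1 := sin_sq_add_cos_sq θ
  have hR2 : (R * cos θ) ^ 2 + (R * sin θ) ^ 2 = R ^ 2 := by linear_combination R ^ 2 * h1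
  have e0 : ((R * cos θ) ^ 2) / R ^ 2 = cos θ ^ 2 := by
    field_simp
  simp only [hR2, e0]
  have e : ENNReal.ofReal R * (ENNReal.ofReal ((R * cos θ) ^ A * rexp (-π * (R * cos θ) ^ 2)) *
      ENNReal.ofReal ((R * sin θ) ^ B * rexp (-π * (R * sin θ) ^ 2))) =
      ENNReal.ofReal (R ^ (A + B + 1) * rexp (-π * R ^ 2)) *
        (ENNReal.ofReal (cos θ ^ A * sin θ ^ B)) := by
    rw [← ENNReal.ofReal_mul (by positivity), ← ENNReal.ofReal_mul (by positivity),
      ← ENNReal.ofReal_mul (by positivity)]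
    have e2 : rexp (-π * (R * cos θ) ^ 2) * rexp (-π * (R * sin θ) ^ 2) = rexp (-π * R ^ 2) := by
      rw [← Real.exp_add]; congr 1; linear_combination (-π) * hR2
    rw [← e2]; congr 1; ring
  calc _ = h (cos θ ^ 2) * (ENNReal.ofReal R *
      (ENNReal.ofReal ((R * cos θ) ^ A * rexp (-π * (R * cos θ) ^ 2)) *
      ENNReal.ofReal ((R * sin θ) ^ B * rexp (-π * (R * sin θ) ^ 2)))) := by ring
    _ = _ := by rw [e]; ring

lemma isProb_betaDist {a b : ℝ} (ha : 0 < a) (hb : 0 < b) : IsProbabilityMeasure (betaDist a b) := by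
  have h := ProbabilityTheory.isProbabilityMeasureBeta ha hb
  have : betaDist a b = ProbabilityTheory.betaMeasure a b := by
    unfold betaDist ProbabilityTheory.betaMeasure
    congr 1; ext t
    rw [ProbabilityTheory.betaPDF_eq, ProbabilityTheory.beta]
    split_ifs <;> simp
  rwa [this]

lemma betaDist_angle (A B : ℕ) : ∃ c : ℝ≥0∞, ∀ h : ℝ → ℝ≥0∞, Measurable h →
    ∫⁻ t, h t ∂(betaDist (((A + 1 : ℕ) : ℝ) / 2) (((B + 1 : ℕ) : ℝ) / 2)) =
    c * ∫⁻ θ in Set.Ioo 0 (π / 2), h (cos θ ^ 2) * ENNReal.ofReal (cos θ ^ A * sin θ ^ B) := by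
  set a : ℝ := ((A + 1 : ℕ) : ℝ) / 2 with ha
  set b : ℝ := ((B + 1 : ℕ) : ℝ) / 2 with hb
  have ha0 : 0 < a := by positivity
  have hb0 : 0 < b := by positivity
  have hG : 0 < Real.Gamma (a + b) / (Real.Gamma a * Real.Gamma b) :=
    div_pos (Real.Gamma_pos_of_pos (by positivity))
      (mul_pos (Real.Gamma_pos_of_pos ha0) (Real.Gamma_pos_of_pos hb0))
  set K := Real.Gamma (a + b) / (Real.Gamma a * Real.Gamma b)
  refine ⟨ENNReal.ofReal (2 * K), fun h hh => ?_⟩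
  have hd : Measurable fun t : ℝ => if 0 < t ∧ t < 1 then
      ENNReal.ofReal (K * t ^ (a - 1) * (1 - t) ^ (b - 1)) else 0 :=
    Measurable.ite (measurableSet_Ioo) (by fun_prop) measurable_const
  rw [betaDist, lintegral_withDensity_eq_lintegral_mul _ hd hh]
  have e1 : ∫⁻ t, ((fun t : ℝ => if 0 < t ∧ t < 1 then
      ENNReal.ofReal (K * t ^ (a - 1) * (1 - t) ^ (b - 1)) else 0) * h) t =
      ∫⁻ t in Set.Ioo 0 1, ENNReal.ofReal (K * t ^ (a - 1) * (1 - t) ^ (b - 1)) * h t := by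
    rw [← lintegral_indicator measurableSet_Ioo]
    refine lintegral_congr fun t => ?_
    by_cases ht : 0 < t ∧ t < 1 <;> simp [Set.indicator, ht]
  rw [e1]
  have hpos : ∀ θ ∈ Set.Ioo 0 (π / 2), 0 < sin θ ∧ 0 < cos θ := fun θ hθ =>
    ⟨sin_pos_of_pos_of_lt_pi hθ.1 (by linarith [hθ.2, pi_pos]),
     cos_pos_of_mem_Ioo ⟨by linarith [hθ.1, pi_pos], hθ.2⟩⟩
  have himg : (fun φ : ℝ => cos φ ^ 2) '' Set.Ioo 0 (π / 2) = Set.Ioo 0 1 := by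
    ext t
    constructor
    · rintro ⟨θ, hθ, rfl⟩
      obtain ⟨h1, h2⟩ := hpos θ hθ
      have := sin_sq_add_cos_sq θ
      exact ⟨by positivity, by dsimp only; nlinarith⟩
    · rintro ⟨h0, h1⟩
      have hs0 : 0 < √t := Real.sqrt_pos.2 h0
      have hs1 : √t < 1 := by rw [Real.sqrt_lt' one_pos]; simpa using h1
      refine ⟨arccos √t, ⟨Real.arccos_pos.2 hs1, Real.arccos_lt_pi_div_two.2 hs0⟩, ?_⟩
      simp only
      rw [Real.cos_arccos (by linarith) hs1.le, Real.sq_sqrt h0.le]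
  rw [← himg, lintegral_image_eq_lintegral_abs_deriv_mul (f' := fun θ => 2 * cos θ * (-sin θ))
    measurableSet_Ioo
    (fun x _ => by simpa using ((hasDerivAt_cos x).fun_pow 2).hasDerivWithinAt)
    ?_]
  · rw [← lintegral_const_mul _ (by fun_prop)]
    refine setLIntegral_congr_fun measurableSet_Ioo fun θ hθ => ?_
    obtain ⟨hs, hc⟩ := hpos θ hθ
    have e3 : 1 - cos θ ^ 2 = sin θ ^ 2 := by linear_combination -sin_sq_add_cos_sq θ
    have e4 : ∀ (C : ℕ) (x : ℝ), 0 < x → x * (x ^ 2) ^ (((C + 1 : ℕ) : ℝ) / 2 - 1) = x ^ C := by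
      intro C x hx
      rw [← Real.rpow_natCast x 2, ← Real.rpow_mul hx.le, ← Real.rpow_natCast x C]
      conv_lhs => rw [← Real.rpow_one x, Real.rpow_one x]
      nth_rewrite 1 [← Real.rpow_one x]
      rw [← Real.rpow_add hx]
      congr 1; push_cast; ring
    have e5 : ENNReal.ofReal |2 * cos θ * -sin θ| *
        ENNReal.ofReal (K * (cos θ ^ 2) ^ (a - 1) * (1 - cos θ ^ 2) ^ (b - 1)) =
        ENNReal.ofReal (2 * K) * ENNReal.ofReal (cos θ ^ A * sin θ ^ B) := by
      rw [e3, ← ENNReal.ofReal_mul (by positivity), ← ENNReal.ofReal_mul (by positivity),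
        ← e4 A _ hc, ← e4 B _ hs]
      congr 1
      rw [show 2 * cos θ * -sin θ = -(2 * cos θ * sin θ) by ring, abs_neg,
        abs_of_pos (by positivity)]
      ring
    rw [← mul_assoc, e5]; ring
  · intro x hx y hy hxy
    have h1 := (hpos x hx).2
    have h2 := (hpos y hy).2
    have h3 : cos x = cos y := (pow_left_inj₀ h1.le h2.le two_ne_zero).1 hxy
    exact Real.injOn_cos ⟨hx.1.le, by linarith [hx.2, pi_pos]⟩ ⟨hy.1.le, by linarith [hy.2, pi_pos]⟩ h3

end Circle

section BetaLemma
variable {E F : Type*} [NormedAddCommGroup E] [InnerProductSpace ℝ E] [MeasurableSpace E]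
  [BorelSpace E] [FiniteDimensional ℝ E] [NormedAddCommGroup F] [InnerProductSpace ℝ F]
  [MeasurableSpace F] [BorelSpace F] [FiniteDimensional ℝ F]

lemma gam_radial [Nontrivial E] (f : ℝ → ℝ≥0∞) (hf : Measurable f) :
    ∫⁻ x, f ‖x‖ ∂(gam E) = (volume : Measure E).toSphere Set.univ *
      ∫⁻ ρ in Set.Ioi (0 : ℝ), f ρ *
        ENNReal.ofReal (ρ ^ (Module.finrank ℝ E - 1) * rexp (-π * ρ ^ 2)) := by
  rw [lintegral_gam_polar E (fun x => f ‖x‖) (by fun_prop)]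
  rw [mul_comm, ← lintegral_const]
  refine lintegral_congr fun ω => ?_
  refine setLIntegral_congr_fun measurableSet_Ioi fun ρ hρ => ?_
  have hρ : 0 < ρ := hρ
  have : ‖ρ • (ω : E)‖ = ρ := by
    rw [norm_smul, norm_eq_of_mem_sphere ω, mul_one, Real.norm_of_nonneg hρ.le]
  simp only [this]

lemma const_eq_of_prob {c d : ℝ≥0∞} {J : ℝ≥0∞} (h1 : c * J = 1) (h2 : d * J = 1) : c = d := by
  have hJ0 : J ≠ 0 := by rintro rfl; simp at h1
  have hJt : J ≠ ∞ := by
    rintro rfl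
    rcases eq_or_ne c 0 with rfl | hc
    · simp at h1
    · rw [ENNReal.mul_top hc] at h1; simp at h1
  exact (ENNReal.mul_left_inj hJ0 hJt).1 (h1.trans h2.symm)

lemma beta_gauss (A B : ℕ) {μ : Measure E} {ν : Measure F} (hμ : IsG μ) (hν : IsG ν)
    (hA : Module.finrank ℝ E = A + 1) (hB : Module.finrank ℝ F = B + 1)
    (h : ℝ → ℝ≥0∞) (hh : Measurable h) :
    ∫⁻ x, ∫⁻ y, h (‖x‖ ^ 2 / (‖x‖ ^ 2 + ‖y‖ ^ 2)) ∂ν ∂μ =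
      ∫⁻ t, h t ∂(betaDist ((A + 1 : ℕ) / 2) ((B + 1 : ℕ) / 2)) := by
  have : Nontrivial E := Module.nontrivial_of_finrank_pos (R := ℝ) (by omega)
  have : Nontrivial F := Module.nontrivial_of_finrank_pos (R := ℝ) (by omega)
  rw [hμ.unique (isG_gam E), hν.unique (isG_gam F)]
  obtain ⟨c, hc⟩ := circleC A B
  obtain ⟨d, hd⟩ := betaDist_angle A B
  set J : (ℝ → ℝ≥0∞) → ℝ≥0∞ := fun h => ∫⁻ θ in Set.Ioo 0 (π / 2), h (cos θ ^ 2) *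
      ENNReal.ofReal (cos θ ^ A * sin θ ^ B)
  set k := (volume : Measure E).toSphere Set.univ * (volume : Measure F).toSphere Set.univ
  have key : ∀ h : ℝ → ℝ≥0∞, Measurable h →
      ∫⁻ x, ∫⁻ y, h (‖x‖ ^ 2 / (‖x‖ ^ 2 + ‖y‖ ^ 2)) ∂(gam F) ∂(gam E) = (k * c) * J h := by
    intro h hh
    have e1 : ∀ r : ℝ, ∫⁻ y, h (r ^ 2 / (r ^ 2 + ‖y‖ ^ 2)) ∂(gam F) =
        (volume : Measure F).toSphere Set.univ * ∫⁻ ρ in Set.Ioi (0 : ℝ), h (r ^ 2 / (r ^ 2 + ρ ^ 2)) *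
        ENNReal.ofReal (ρ ^ B * rexp (-π * ρ ^ 2)) := fun r => by
      rw [gam_radial (fun s => h (r ^ 2 / (r ^ 2 + s ^ 2))) (by fun_prop), hB]
      rfl
    simp only [e1]
    rw [gam_radial (fun r => (volume : Measure F).toSphere Set.univ *
      ∫⁻ ρ in Set.Ioi (0 : ℝ), h (r ^ 2 / (r ^ 2 + ρ ^ 2)) *
        ENNReal.ofReal (ρ ^ B * rexp (-π * ρ ^ 2)))]
    · rw [mul_assoc, mul_assoc, ← hc h hh]
      congr 1
      rw [← lintegral_const_mul]
      · refine lintegral_congr fun r => ?_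
        rw [hA, mul_assoc, ← lintegral_mul_const _ (by fun_prop)]
        congr 1
        refine lintegral_congr fun s => ?_
        simp only [Nat.add_sub_cancel]
        ring
      · exact Measurable.lintegral_prod_right' (f := fun p : ℝ × ℝ =>
          h (p.1 ^ 2 / (p.1 ^ 2 + p.2 ^ 2)) * ENNReal.ofReal (p.1 ^ A * rexp (-π * p.1 ^ 2)) *
            ENNReal.ofReal (p.2 ^ B * rexp (-π * p.2 ^ 2))) (by fun_prop)
    · exact (Measurable.lintegral_prod_right' (f := fun p : ℝ × ℝ =>
          h (p.1 ^ 2 / (p.1 ^ 2 + p.2 ^ 2)) *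
            ENNReal.ofReal (p.2 ^ B * rexp (-π * p.2 ^ 2))) (by fun_prop)).const_mul _
  have hp := isProb_betaDist (a := ((A + 1 : ℕ) : ℝ) / 2) (b := ((B + 1 : ℕ) : ℝ) / 2)
    (by positivity) (by positivity)
  have h1 := key 1 measurable_one
  have h2 := hd 1 measurable_one
  simp only [Pi.one_apply, lintegral_one, measure_univ] at h1 h2
  rw [key h hh, hd h hh, const_eq_of_prob h1.symm (by simpa [J] using h2.symm)]
end BetaLemma

section LemmaH
variable {F : Type*} [NormedAddCommGroup F] [InnerProductSpace ℝ F]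
  [MeasurableSpace F] [BorelSpace F] [FiniteDimensional ℝ F]

/-- Gaussian parametrization of the uniform measure on the sphere of `ℝ × F`. -/
noncomputable def PsiMap (p : F × F) : WithLp 2 (ℝ × F) :=
  WithLp.toLp 2 ((‖p.2‖ ^ 2 - ‖p.1‖ ^ 2) / (‖p.2‖ ^ 2 + ‖p.1‖ ^ 2),
    (2 * ‖p.1‖ / (‖p.2‖ ^ 2 + ‖p.1‖ ^ 2)) • p.2)

lemma measurable_PsiMap : Measurable (PsiMap (F := F)) := by
  unfold PsiMap
  fun_prop

lemma lemmaH [Nontrivial F] :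
    (gam (WithLp 2 (ℝ × F))).map (fun z => ‖z‖⁻¹ • z) = ((gam F).prod (gam F)).map PsiMap := by
  set M := Module.finrank ℝ F - 1 with hM
  obtain ⟨c, hc⟩ := circleA M
  obtain ⟨d, hd⟩ := circleB M
  set k := (volume : Measure F).toSphere Set.univ
  set J : (WithLp 2 (ℝ × F) → ℝ≥0∞) → ℝ≥0∞ := fun f =>
    ∫⁻ ω : Metric.sphere (0 : F) 1, ∫⁻ θ in Set.Ioo 0 π,
      f (WithLp.toLp 2 (cos θ, sin θ • (ω : F))) * ENNReal.ofReal (sin θ ^ M)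
        ∂volume ∂(volume : Measure F).toSphere with hJ
  have hJm : ∀ f : WithLp 2 (ℝ × F) → ℝ≥0∞, Measurable f →
      Measurable fun ω : Metric.sphere (0 : F) 1 => ∫⁻ θ in Set.Ioo 0 π,
      f (WithLp.toLp 2 (cos θ, sin θ • (ω : F))) * ENNReal.ofReal (sin θ ^ M) := fun f hf =>
    Measurable.lintegral_prod_right' (f := fun p : Metric.sphere (0 : F) 1 × ℝ =>
      f (WithLp.toLp 2 (cos p.2, sin p.2 • (p.1 : F))) * ENNReal.ofReal (sin p.2 ^ M))
      (by fun_prop)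
  have hL : ∀ f : WithLp 2 (ℝ × F) → ℝ≥0∞, Measurable f →
      ∫⁻ z, f z ∂((gam (WithLp 2 (ℝ × F))).map (fun z => ‖z‖⁻¹ • z)) = c * J f := by
    intro f hf
    rw [lintegral_map hf (by fun_prop), ← (isG_gamR.prod (isG_gam F)).unique (isG_gam _),
      lintegral_map (by fun_prop) (by fun_prop), lintegral_prod_symm _ (by fun_prop),
      lintegral_gam_polar F _ (Measurable.lintegral_prod_left'
        (f := fun p : ℝ × F => f (‖WithLp.toLp 2 p‖⁻¹ • WithLp.toLp 2 p)) (by fun_prop)), hJ]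
    dsimp only
    rw [← lintegral_const_mul _ (hJm f hf)]
    refine lintegral_congr fun ω => ?_
    have := hc (fun p => f (WithLp.toLp 2 (p.1, p.2 • (ω : F)))) (by fun_prop)
    dsimp only at this
    rw [← this, lintegral_lintegral_swap (by fun_prop)]
    refine setLIntegral_congr_fun measurableSet_Ioi fun ρ hρ => ?_
    rw [← hM, gamR, lintegral_withDensity_eq_lintegral_mul _ (by fun_prop) (by fun_prop),
      ← lintegral_mul_const _ (by fun_prop)]
    refine lintegral_congr fun z => ?_
    have e : ‖WithLp.toLp 2 (z, ρ • (ω : F))‖ = √(z ^ 2 + ρ ^ 2) := by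
      rw [WithLp.prod_norm_eq_of_L2]
      simp [norm_smul]
    have e2 : (√(z ^ 2 + ρ ^ 2))⁻¹ • WithLp.toLp 2 (z, ρ • (ω : F)) =
        WithLp.toLp 2 (z / √(z ^ 2 + ρ ^ 2), (ρ / √(z ^ 2 + ρ ^ 2)) • (ω : F)) := by
      rw [← WithLp.toLp_smul, Prod.smul_mk, smul_smul, smul_eq_mul, div_eq_inv_mul, div_eq_inv_mul]
    simp only [Pi.mul_apply, e, e2, Real.norm_eq_abs, sq_abs]
    ring
  have hR : ∀ f : WithLp 2 (ℝ × F) → ℝ≥0∞, Measurable f →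
      ∫⁻ z, f z ∂(((gam F).prod (gam F)).map PsiMap) = (k * d) * J f := by
    intro f hf
    have hm := measurable_PsiMap (F := F)
    rw [lintegral_map hf hm, lintegral_prod_symm _ (by fun_prop),
      lintegral_gam_polar F _ (Measurable.lintegral_prod_left'
        (f := fun p : F × F => f (PsiMap p)) (by fun_prop)), hJ]
    dsimp only
    rw [← lintegral_const_mul _ (hJm f hf)]
    refine lintegral_congr fun ω => ?_
    have := hd (fun p => f (WithLp.toLp 2 (p.1, p.2 • (ω : F)))) (by fun_prop)
    dsimp only at this
    rw [mul_assoc, ← this, ← lintegral_const_mul]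
    · refine setLIntegral_congr_fun measurableSet_Ioi fun ρ hρ => ?_
      have hρ : 0 < ρ := hρ
      have en : ‖ρ • (ω : F)‖ = ρ := by
        rw [norm_smul, norm_eq_of_mem_sphere ω, mul_one, Real.norm_of_nonneg hρ.le]
      have e : ∀ x : F, PsiMap (x, ρ • (ω : F)) = WithLp.toLp 2
        ((ρ ^ 2 - ‖x‖ ^ 2) / (ρ ^ 2 + ‖x‖ ^ 2), (2 * ‖x‖ * ρ / (ρ ^ 2 + ‖x‖ ^ 2)) • (ω : F)) := by
        intro x
        simp only [PsiMap, en, smul_smul]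
        congr 3
        ring
      simp only [e]
      rw [gam_radial (fun g => f (WithLp.toLp 2
        ((ρ ^ 2 - g ^ 2) / (ρ ^ 2 + g ^ 2), (2 * g * ρ / (ρ ^ 2 + g ^ 2)) • (ω : F))))
        (by fun_prop), mul_assoc, ← hM, ← lintegral_mul_const _ (by fun_prop)]
      congr 1
      refine lintegral_congr fun g => ?_
      ring
    · exact Measurable.lintegral_prod_right' (f := fun p : ℝ × ℝ =>
        f (WithLp.toLp 2 ((p.1 ^ 2 - p.2 ^ 2) / (p.1 ^ 2 + p.2 ^ 2),
          (2 * p.2 * p.1 / (p.1 ^ 2 + p.2 ^ 2)) • (ω : F))) *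
        ENNReal.ofReal (p.1 ^ M * rexp (-π * p.1 ^ 2)) *
        ENNReal.ofReal (p.2 ^ M * rexp (-π * p.2 ^ 2))) (by fun_prop)
  have p1 : IsProbabilityMeasure ((gam (WithLp 2 (ℝ × F))).map (fun z => ‖z‖⁻¹ • z)) :=
    Measure.isProbabilityMeasure_map (by fun_prop)
  have p2 : IsProbabilityMeasure (((gam F).prod (gam F)).map PsiMap) :=
    Measure.isProbabilityMeasure_map measurable_PsiMap.aemeasurable
  have h1 := hL 1 measurable_one
  have h2 := hR 1 measurable_one
  simp only [Pi.one_apply, lintegral_one, measure_univ] at h1 h2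
  refine Measure.ext_of_lintegral _ fun f hf => ?_
  rw [hL f hf, hR f hf, const_eq_of_prob h1.symm h2.symm]

lemma gam_noAtom (E : Type*) [NormedAddCommGroup E] [InnerProductSpace ℝ E]
    [MeasurableSpace E] [BorelSpace E] [FiniteDimensional ℝ E] (s : Set E)
    (hs : (volume : Measure E) s = 0) : gam E s = 0 :=
  withDensity_absolutelyContinuous _ _ hs

lemma isUnif_normalize (E : Type*) [NormedAddCommGroup E] [InnerProductSpace ℝ E]
    [MeasurableSpace E] [BorelSpace E] [FiniteDimensional ℝ E] [Nontrivial E] :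
    IsUnif ((gam E).map (fun z => ‖z‖⁻¹ • z)) := by
  refine ⟨Measure.isProbabilityMeasure_map (by fun_prop), ?_, fun T => ?_⟩
  · rw [ae_map_iff (by fun_prop) (measurableSet_eq_fun (by fun_prop) (by fun_prop))]
    have : gam E {0} = 0 := gam_noAtom E _ (by simp)
    filter_upwards [compl_mem_ae_iff.2 this] with z hz
    have hz : z ≠ 0 := hz
    rw [norm_smul, norm_inv, norm_norm, inv_mul_cancel₀ (norm_ne_zero_iff.2 hz)]
  · have hT : Measurable T := T.continuous.measurable
    rw [Measure.map_map hT (by fun_prop)]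
    conv_rhs => rw [← ((isG_gam E).map_isom T).unique (isG_gam E), Measure.map_map (by fun_prop) hT]
    congr 1; ext z; simp

lemma IsUnif.map_isom {E : Type*} [NormedAddCommGroup E] [InnerProductSpace ℝ E] [MeasurableSpace E]
    [BorelSpace E] {μ : Measure E} (hμ : IsUnif μ)
    (T : E ≃ₗᵢ[ℝ] F) : IsUnif (μ.map T) := by
  have hT : Measurable T := T.continuous.measurable
  have := hμ.prob
  refine ⟨Measure.isProbabilityMeasure_map hT.aemeasurable, ?_, fun S => ?_⟩
  · rw [ae_map_iff hT.aemeasurable (measurableSet_eq_fun (by fun_prop) (by fun_prop))]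
    simpa using hμ.sph
  · have hS : Measurable S := S.continuous.measurable
    rw [Measure.map_map hS hT]
    conv_rhs => rw [← hμ.inv ((T.trans S).trans T.symm),
      Measure.map_map hT (LinearIsometryEquiv.continuous _).measurable]
    congr 1; ext z; simp

lemma IsUnif.eq_Psi [Nontrivial F] {μ : Measure (WithLp 2 (ℝ × F))} (hμ : IsUnif μ) :
    μ = ((gam F).prod (gam F)).map PsiMap := by
  have : Nontrivial (WithLp 2 (ℝ × F)) := (WithLp.equiv 2 (ℝ × F)).nontrivial
  rw [← lemmaH]
  exact hμ.unique (isUnif_normalize _)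
end LemmaH

section Geom

/-- Distance from `e` to the linear span of the family `v`. -/
noncomputable def dSpan {E ι : Type*} [NormedAddCommGroup E] [InnerProductSpace ℝ E] (e : E)
    (v : ι → E) : ℝ :=
  Metric.infDist e (Submodule.span ℝ (Set.range v) : Set E)

variable {E F ι : Type*} [NormedAddCommGroup E] [InnerProductSpace ℝ E]
  [NormedAddCommGroup F] [InnerProductSpace ℝ F]

lemma distToAffSpan_eq {n r : ℕ} (X : Fin (r + 1) → EuclideanSpace ℝ (Fin n)) :
    distToAffSpan X = dSpan (X 0) (fun i : Fin r => X i.succ - X 0) := by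
  unfold distToAffSpan dSpan
  have h1 : Submodule.span ℝ (Set.range fun i : Fin r => X i.succ - X 0) =
      vectorSpan ℝ (Set.range X) := by
    rw [vectorSpan_range_eq_span_range_vsub_right ℝ X 0]
    apply le_antisymm
    · rw [Submodule.span_le]
      rintro _ ⟨i, rfl⟩
      exact Submodule.subset_span ⟨i.succ, rfl⟩
    · rw [Submodule.span_le]
      rintro _ ⟨i, rfl⟩
      refine Fin.cases ?_ (fun i => ?_) i
      · simp
      · exact Submodule.subset_span ⟨i, rfl⟩
  rw [h1]
  have h2 : ((vectorSpan ℝ (Set.range X) : Submodule ℝ _) : Set (EuclideanSpace ℝ (Fin n))) =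
      (IsometryEquiv.subLeft (X 0)) ''
        (affineSpan ℝ (Set.range X) : Set (EuclideanSpace ℝ (Fin n))) := by
    have h0 : X 0 ∈ affineSpan ℝ (Set.range X) := mem_affineSpan ℝ ⟨0, rfl⟩
    ext y
    simp only [SetLike.mem_coe, Set.mem_image, IsometryEquiv.subLeft_apply]
    constructor
    · intro hy
      refine ⟨X 0 - y, ?_, by simp⟩
      have : -y +ᵥ X 0 ∈ affineSpan ℝ (Set.range X) := by
        rw [AffineSubspace.vadd_mem_iff_mem_direction _ h0, direction_affineSpan]
        exact neg_mem hy
      simpa [sub_eq_neg_add] using this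
    · rintro ⟨z, hz, rfl⟩
      rw [← direction_affineSpan]
      exact AffineSubspace.vsub_mem_direction h0 hz
  rw [h2]
  have h3 : X 0 = IsometryEquiv.subLeft (X 0) 0 := by simp
  conv_rhs => lhs; rw [h3]
  rw [Metric.infDist_image (IsometryEquiv.isometry _)]

lemma dSpan_isom (T : E ≃ₗᵢ[ℝ] F) (e : E) (v : ι → E) :
    dSpan (T e) (fun i => T (v i)) = dSpan e v := by
  unfold dSpan
  have : (Submodule.span ℝ (Set.range fun i => T (v i)) : Set F) =
      T '' (Submodule.span ℝ (Set.range v)) := by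
    have := Submodule.map_span (T.toLinearEquiv : E →ₗ[ℝ] F) (Set.range v)
    rw [← Set.range_comp] at this
    exact (congrArg SetLike.coe this).symm
  rw [this, Metric.infDist_image T.isometry]

lemma dSpan_smul (e : E) (v : ι → E) (c : ι → ℝ) (hc : ∀ i, c i ≠ 0) :
    dSpan e (fun i => c i • v i) = dSpan e v := by
  unfold dSpan
  have : Submodule.span ℝ (Set.range fun i => c i • v i) = Submodule.span ℝ (Set.range v) := by
    apply le_antisymm <;> rw [Submodule.span_le]
    · rintro _ ⟨i, rfl⟩
      exact Submodule.smul_mem _ _ (Submodule.subset_span ⟨i, rfl⟩)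
    · rintro _ ⟨i, rfl⟩
      have := Submodule.smul_mem (Submodule.span ℝ (Set.range fun i => c i • v i)) (c i)⁻¹
        (Submodule.subset_span ⟨i, rfl⟩)
      simpa [smul_smul, inv_mul_cancel₀ (hc i)] using this
  rw [this]

lemma dSpan_orth [Fintype ι] [DecidableEq ι] (e : E) (v : ι → E) (O : ι → ι → ℝ)
    (hO : ∀ j k, ∑ i, O i j * O i k = if j = k then 1 else 0) :
    dSpan e (fun i => ∑ j, O i j • v j) = dSpan e v := by
  unfold dSpan
  have : Submodule.span ℝ (Set.range fun i => ∑ j, O i j • v j) =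
      Submodule.span ℝ (Set.range v) := by
    apply le_antisymm <;> rw [Submodule.span_le]
    · rintro _ ⟨i, rfl⟩
      exact Submodule.sum_mem _ fun j _ =>
        Submodule.smul_mem _ _ (Submodule.subset_span ⟨j, rfl⟩)
    · rintro _ ⟨k, rfl⟩
      have e1 : v k = ∑ i, O i k • ∑ j, O i j • v j := by
        simp only [Finset.smul_sum, smul_smul]
        rw [Finset.sum_comm]
        simp only [← Finset.sum_smul, hO]
        simp
      rw [e1]
      exact Submodule.sum_mem _ fun j _ =>
        Submodule.smul_mem _ _ (Submodule.subset_span ⟨j, rfl⟩)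
  rw [this]

lemma dSpan_eq_of_orth (e y : E) (v : ι → E) (hy : y ∈ Submodule.span ℝ (Set.range v))
    (ho : ∀ i, ⟪e - y, v i⟫ = 0) : dSpan e v = ‖e - y‖ := by
  have ho' : ∀ z ∈ Submodule.span ℝ (Set.range v), ⟪e - y, z⟫ = 0 := by
    intro z hz
    induction hz using Submodule.span_induction with
    | mem x hx => obtain ⟨i, rfl⟩ := hx; exact ho i
    | zero => simp
    | add x y _ _ hx hy => rw [inner_add_right, hx, hy, add_zero]
    | smul a x _ hx => rw [inner_smul_right, hx, mul_zero]
  apply le_antisymm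
  · rw [← dist_eq_norm]; exact Metric.infDist_le_dist_of_mem hy
  · refine (Metric.le_infDist ⟨y, hy⟩).2 fun z hz => ?_
    have h1 := ho' _ (sub_mem hy hz)
    have h2 := norm_add_sq_eq_norm_sq_add_norm_sq_real h1
    rw [dist_eq_norm]
    have h3 : e - y + (y - z) = e - z := by abel
    rw [h3] at h2
    nlinarith [norm_nonneg (e - z), norm_nonneg (e - y), mul_self_nonneg ‖y - z‖]

lemma measurable_dSpan [Fintype ι] [MeasurableSpace E] [BorelSpace E] [FiniteDimensional ℝ E] :
    Measurable fun p : E × (ι → E) => dSpan p.1 p.2 := by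
  refine measurable_of_Iio fun c => IsOpen.measurableSet ?_
  have : (fun p : E × (ι → E) => dSpan p.1 p.2) ⁻¹' Set.Iio c =
      ⋃ a : ι → ℝ, {p | dist p.1 (∑ i, a i • p.2 i) < c} := by
    ext p
    simp only [Set.mem_preimage, Set.mem_Iio, Set.mem_iUnion, Set.mem_ofPred_eq, dSpan]
    rw [Metric.infDist_lt_iff ⟨0, Submodule.zero_mem _⟩]
    constructor
    · rintro ⟨y, hy, hlt⟩
      obtain ⟨a, rfl⟩ := (Submodule.mem_span_range_iff_exists_fun ℝ).1 hy
      exact ⟨a, hlt⟩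
    · rintro ⟨a, ha⟩
      exact ⟨_, (Submodule.mem_span_range_iff_exists_fun ℝ).2 ⟨a, rfl⟩, ha⟩
  rw [this]
  exact isOpen_iUnion fun a => isOpen_lt (by fun_prop) continuous_const

/-- The base vector `(1, 0)`. -/
noncomputable def e0 (F : Type*) [NormedAddCommGroup F] : WithLp 2 (ℝ × F) := WithLp.toLp 2 (1, 0)

lemma dSpan_cons [FiniteDimensional ℝ F] {s : ℕ} (q : ℝ) (hq : 0 < q) (x : F) (Y : Fin s → F) :
    dSpan (e0 F) (fun i : Fin (s + 1) => WithLp.toLp 2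
      (-(if i = 0 then q else 0), (Fin.cons x Y : Fin (s + 1) → F) i)) ^ 2 =
    ‖(Submodule.span ℝ (Set.range Y))ᗮ.orthogonalProjectionOnto x‖ ^ 2 /
      (‖(Submodule.span ℝ (Set.range Y))ᗮ.orthogonalProjectionOnto x‖ ^ 2 + q ^ 2) := by
  set L := Submodule.span ℝ (Set.range Y)
  set v : Fin (s + 1) → WithLp 2 (ℝ × F) := fun i => WithLp.toLp 2
      (-(if i = 0 then q else 0), (Fin.cons x Y : Fin (s + 1) → F) i) with hv
  set p : F := (Lᗮ.orthogonalProjectionOnto x : F) with hp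
  have hpn : ‖Lᗮ.orthogonalProjectionOnto x‖ = ‖p‖ := rfl
  rw [hpn]
  set S := ‖p‖ ^ 2 + q ^ 2 with hS
  have hS0 : 0 < S := by positivity
  have hpL : p ∈ Lᗮ := (Lᗮ.orthogonalProjectionOnto x).2
  have hxp : x - p ∈ L := by
    have := Submodule.sub_starProjection_mem_orthogonal (K := Lᗮ) x
    rwa [Submodule.orthogonal_orthogonal] at this
  have hin : ⟪p, x⟫ = ‖p‖ ^ 2 := by
    have : ⟪p, x - p⟫ = 0 := Submodule.inner_left_of_mem_orthogonal hxp hpL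
    rw [inner_sub_right, real_inner_self_eq_norm_sq] at this
    linarith
  have hL : ∀ z ∈ L, WithLp.toLp 2 ((0 : ℝ), z) ∈ Submodule.span ℝ (Set.range v) := by
    intro z hz
    obtain ⟨a, rfl⟩ := (Submodule.mem_span_range_iff_exists_fun ℝ).1 hz
    have : WithLp.toLp 2 ((0 : ℝ), ∑ i, a i • Y i) = ∑ i, a i • v i.succ := by
      rw [← WithLp.ofLp_injective 2 |>.eq_iff]
      simp only [hv, Fin.succ_ne_zero, Fin.cons_succ, if_false, neg_zero, WithLp.ofLp_sum,
        WithLp.ofLp_smul]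
      ext <;> simp [Prod.fst_sum, Prod.snd_sum]
    rw [this]
    exact Submodule.sum_mem _ fun i _ => Submodule.smul_mem _ _ (Submodule.subset_span ⟨_, rfl⟩)
  have hmem : WithLp.toLp 2 (-q, p) ∈ Submodule.span ℝ (Set.range v) := by
    have : WithLp.toLp 2 (-q, p) = v 0 - WithLp.toLp 2 ((0 : ℝ), x - p) := by
      simp [hv, ← WithLp.toLp_sub]
    rw [this]
    exact Submodule.sub_mem _ (Submodule.subset_span ⟨0, rfl⟩) (hL _ hxp)
  have hdiff : e0 F - (-q / S) • WithLp.toLp 2 (-q, p) =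
      WithLp.toLp 2 (‖p‖ ^ 2 / S, (q / S) • p) := by
    rw [e0, ← WithLp.toLp_smul, ← WithLp.toLp_sub]
    congr 1
    ext
    · simp only [Prod.fst_sub, Prod.smul_fst, smul_eq_mul]
      field_simp
      rw [hS]; ring
    · simp [neg_div]
  rw [dSpan_eq_of_orth (e0 F) ((-q / S) • WithLp.toLp 2 (-q, p)) v (Submodule.smul_mem _ _ hmem),
    hdiff, WithLp.prod_norm_sq_eq_of_L2]
  · rw [show (WithLp.toLp 2 (‖p‖ ^ 2 / S, (q / S) • p)).fst = ‖p‖ ^ 2 / S from rfl,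
      show (WithLp.toLp 2 (‖p‖ ^ 2 / S, (q / S) • p)).snd = (q / S) • p from rfl]
    simp only [norm_smul, mul_pow, Real.norm_eq_abs, sq_abs]
    field_simp
    rw [hS]
  · intro i
    rw [hdiff, WithLp.prod_inner_apply]
    refine Fin.cases ?_ (fun i => ?_) i
    · simp only [hv, Fin.cons_zero, if_true, inner_smul_left, hin]
      simp
      ring
    · have : ⟪p, Y i⟫ = 0 :=
        Submodule.inner_left_of_mem_orthogonal (K := L)
          (Submodule.subset_span (Set.mem_range_self i)) hpL
      simp [hv, inner_smul_left, this]

lemma Psi_sub (p : F × F) (hp : p.1 ≠ 0) :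
    PsiMap p - e0 F = (2 * ‖p.1‖ / (‖p.2‖ ^ 2 + ‖p.1‖ ^ 2)) • WithLp.toLp 2 (-‖p.1‖, p.2) := by
  have h1 : 0 < ‖p.1‖ := norm_pos_iff.2 hp
  rw [e0, PsiMap, ← WithLp.toLp_smul, ← WithLp.toLp_sub]
  congr 1
  ext
  · simp only [Prod.fst_sub, Prod.smul_fst, smul_eq_mul]
    field_simp
    ring
  · simp
end Geom

section Prob
variable {E F : Type*} [NormedAddCommGroup E] [InnerProductSpace ℝ E] [MeasurableSpace E]
  [BorelSpace E] [FiniteDimensional ℝ E] [NormedAddCommGroup F] [InnerProductSpace ℝ F]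
  [MeasurableSpace F] [BorelSpace F] [FiniteDimensional ℝ F]

lemma mp_cons {X : Type*} [MeasurableSpace X] (μ : Measure X) [IsProbabilityMeasure μ] (s : ℕ) :
    MeasurePreserving (fun p : X × (Fin s → X) => (Fin.cons p.1 p.2 : Fin (s + 1) → X))
      (μ.prod (Measure.pi fun _ : Fin s => μ)) (Measure.pi fun _ : Fin (s + 1) => μ) := by
  have h := (measurePreserving_piFinSuccAbove (fun _ : Fin (s + 1) => μ) 0).symm
  have e : ((MeasurableEquiv.piFinSuccAbove (fun _ : Fin (s + 1) => X) 0).symm :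
      X × (Fin s → X) → _) = (fun p : X × (Fin s → X) => (Fin.cons p.1 p.2 : Fin (s + 1) → X)) := by
    ext p : 1
    exact Fin.insertNth_zero' p.1 p.2
  rw [e] at h
  exact h

lemma lintegral_pi_cons {X : Type*} [MeasurableSpace X] (μ : Measure X) [IsProbabilityMeasure μ]
    {s : ℕ} (f : (Fin (s + 1) → X) → ℝ≥0∞) (hf : Measurable f) :
    ∫⁻ x, f x ∂(Measure.pi fun _ : Fin (s + 1) => μ) =
      ∫⁻ p, f (Fin.cons p.1 p.2) ∂(μ.prod (Measure.pi fun _ : Fin s => μ)) :=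
  ((mp_cons μ s).lintegral_comp hf).symm

lemma ae_linearIndependent (s : ℕ) (hs : s ≤ Module.finrank ℝ F) :
    ∀ᵐ Y ∂(Measure.pi fun _ : Fin s => gam F), LinearIndependent ℝ Y := by
  induction s with
  | zero => exact ae_of_all _ fun Y => linearIndependent_empty_type
  | succ s ih =>
    have h := mp_cons (gam F) s
    have hmeas : ∀ k, MeasurableSet {Y : Fin k → F | LinearIndependent ℝ Y} := fun k =>
      isOpen_setOfPred_linearIndependent.measurableSet
    rw [← h.map_eq, ae_map_iff h.measurable.aemeasurable (hmeas _)]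
    have hm2 := h.measurable (hmeas (s + 1))
    have hm3 := (measurable_swap (α := Fin s → F) (β := F)) hm2
    rw [← Measure.prod_swap]
    refine (ae_map_iff measurable_swap.aemeasurable hm2).2 ?_
    refine (Measure.ae_prod_iff_ae_ae hm3).2 ?_
    filter_upwards [ih (by omega)] with Y hY
    have hsub : Submodule.span ℝ (Set.range Y) ≠ ⊤ := by
      intro htop
      have := finrank_span_eq_card hY
      rw [htop, finrank_top] at this
      simp at this
      omega
    have hz : gam F (Submodule.span ℝ (Set.range Y)) = 0 :=
      gam_noAtom F _ (Measure.addHaar_submodule _ _ hsub)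
    filter_upwards [compl_mem_ae_iff.2 hz] with x hx
    exact linearIndependent_finCons.2 ⟨hY, hx⟩

lemma isG_proj (L : Submodule ℝ F) : IsG ((gam F).map L.orthogonalProjectionOnto) := by
  refine (isG_gam F).map _ fun t => ?_
  rw [Submodule.adjoint_orthogonalProjectionOnto]
  rfl

lemma exists_orth {r : ℕ} (g : EuclideanSpace ℝ (Fin (r + 1))) :
    ∃ O : Fin (r + 1) → Fin (r + 1) → ℝ,
      (∀ j k, ∑ i, O i j * O i k = if j = k then 1 else 0) ∧
      ∀ i, ∑ j, O i j * g j = if i = 0 then ‖g‖ else 0 := by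
  obtain ⟨T, hT⟩ := exists_isometry_of_norm_eq (x := g)
    (y := EuclideanSpace.single (0 : Fin (r + 1)) ‖g‖) (by simp)
  refine ⟨fun i j => T (EuclideanSpace.single j 1) i, fun j k => ?_, fun i => ?_⟩
  · have := T.inner_map_map (EuclideanSpace.single j 1) (EuclideanSpace.single k 1)
    rw [EuclideanSpace.inner_single_left, PiLp.inner_apply] at this
    simp only [RCLike.inner_apply, conj_trivial, one_mul] at this
    rw [Finset.sum_congr rfl fun i _ => mul_comm _ _, this]
    simp [Pi.single_apply]
  · have h1 : g = ∑ j, g j • EuclideanSpace.single j (1 : ℝ) := by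
      ext k; simp [Pi.single_apply]
    have h2 : T g i = ∑ j, T (EuclideanSpace.single j 1) i * g j := by
      conv_lhs => rw [h1]
      simp [mul_comm]
    rw [← h2, hT]
    simp [Pi.single_apply]

lemma pi_gam_orth {r : ℕ} (O : Fin r → Fin r → ℝ)
    (hO : ∀ j k, ∑ i, O i j * O i k = if j = k then 1 else 0) :
    (Measure.pi fun _ : Fin r => gam F).map (fun G i => ∑ j, O i j • G j) =
      Measure.pi fun _ : Fin r => gam F := by
  let T0 : PiLp 2 (fun _ : Fin r => F) →ₗ[ℝ] PiLp 2 (fun _ : Fin r => F) :=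
    { toFun := fun G => WithLp.toLp 2 fun i => ∑ j, O i j • G j
      map_add' := fun x y => by
        ext i; simp [Finset.sum_add_distrib]
      map_smul' := fun c x => by
        ext i; simp [Finset.smul_sum, smul_smul, mul_comm] }
  have hn : ∀ G : PiLp 2 (fun _ : Fin r => F), ‖T0 G‖ = ‖G‖ := by
    intro G
    have : ‖T0 G‖ ^ 2 = ‖G‖ ^ 2 := by
      rw [PiLp.norm_sq_eq_of_L2, PiLp.norm_sq_eq_of_L2]
      have e1 : ∀ i, ‖(T0 G) i‖ ^ 2 = ∑ j, ∑ k, (O i j * O i k) * ⟪G j, G k⟫ := by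
        intro i
        change ‖∑ j, O i j • G j‖ ^ 2 = _
        rw [← real_inner_self_eq_norm_sq, sum_inner]
        refine Finset.sum_congr rfl fun j _ => ?_
        rw [inner_sum]
        refine Finset.sum_congr rfl fun k _ => ?_
        rw [real_inner_smul_left, real_inner_smul_right, mul_assoc]
      simp only [e1]
      rw [Finset.sum_comm]
      refine Finset.sum_congr rfl fun j _ => ?_
      rw [Finset.sum_comm]
      simp only [← Finset.sum_mul, hO]
      simp
    exact (pow_left_inj₀ (norm_nonneg _) (norm_nonneg _) two_ne_zero).1 this
  let T : PiLp 2 (fun _ : Fin r => F) ≃ₗᵢ[ℝ] PiLp 2 (fun _ : Fin r => F) := LinearIsometry.toLinearIsometryEquiv ⟨T0, hn⟩ rfl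
  have hpi := IsG.pi (fun _ : Fin r => isG_gam F)
  have h := (hpi.map_isom T).unique hpi
  have h2 := congrArg (Measure.map (WithLp.ofLp : PiLp 2 (fun _ : Fin r => F) → _)) h
  have hT : Measurable T := T.continuous.measurable
  rw [Measure.map_map (by fun_prop) (by fun_prop), Measure.map_map (by fun_prop) (by fun_prop),
    Measure.map_map (by fun_prop) (by fun_prop)] at h2
  have h3 : (Measure.pi fun _ : Fin r => gam F).map
    ((WithLp.ofLp : PiLp 2 (fun _ : Fin r => F) → _) ∘ (WithLp.toLp 2)) = Measure.pi fun _ : Fin r => gam F := Measure.map_id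
  rw [h3] at h2
  exact h2

lemma lemmaR {s : ℕ} (hs : s ≤ Module.finrank ℝ F) (g : Fin (s + 1) → ℝ)
    (hg : g ≠ 0) (f : ℝ → ℝ≥0∞) (hf : Measurable f) :
    ∫⁻ G : Fin (s + 1) → F, f (dSpan (e0 F) (fun i => WithLp.toLp 2 (-g i, G i)) ^ 2)
      ∂(Measure.pi fun _ => gam F) =
    ∫⁻ a, f (‖a‖ ^ 2 / (‖a‖ ^ 2 + ∑ i, g i ^ 2))
      ∂(gam (EuclideanSpace ℝ (Fin (Module.finrank ℝ F - s)))) := by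
  set g' : EuclideanSpace ℝ (Fin (s + 1)) := WithLp.toLp 2 g with hg'
  obtain ⟨O, hO, hOg⟩ := exists_orth g'
  have hq : 0 < ‖g'‖ := by
    rw [norm_pos_iff]
    intro h
    exact hg (by simpa [hg'] using h)
  have hq2 : ‖g'‖ ^ 2 = ∑ i, g i ^ 2 := by
    rw [EuclideanSpace.norm_sq_eq]; simp [hg']
  have hD := measurable_dSpan (ι := Fin (s + 1)) (E := WithLp 2 (ℝ × F))
  have e1 : ∀ G : Fin (s + 1) → F, dSpan (e0 F) (fun i => WithLp.toLp 2 (-g i, G i)) =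
      dSpan (e0 F) (fun i => WithLp.toLp 2 (-(if i = 0 then ‖g'‖ else 0), ∑ j, O i j • G j)) := by
    intro G
    rw [← dSpan_orth (e0 F) _ O hO]
    congr 1
    ext i : 1
    rw [← hOg i, ← WithLp.ofLp_injective 2 |>.eq_iff]
    simp only [WithLp.ofLp_sum, WithLp.ofLp_smul]
    ext <;> simp [Prod.fst_sum, Prod.snd_sum, hg']
  have hm : Measurable fun G : Fin (s + 1) → F => f (dSpan (e0 F)
      (fun i => WithLp.toLp 2 (-(if i = 0 then ‖g'‖ else 0), G i)) ^ 2) := by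
    refine hf.comp (Measurable.pow_const ?_ 2)
    exact hD.comp (f := fun G : Fin (s + 1) → F => (e0 F, fun i : Fin (s + 1) =>
      (WithLp.toLp 2 (-(if i = 0 then ‖g'‖ else 0), G i) : WithLp 2 (ℝ × F)))) (by fun_prop)
  simp only [e1]
  have e2 := lintegral_map (μ := Measure.pi fun _ : Fin (s + 1) => gam F) hm
    (g := fun G i => ∑ j, O i j • G j) (by fun_prop)
  rw [← e2, pi_gam_orth O hO, lintegral_pi_cons _ _ hm]
  refine (lintegral_prod_symm _ (hm.comp (mp_cons (gam F) s).measurable).aemeasurable).trans ?_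
  have hae : ∀ᵐ Y ∂(Measure.pi fun _ : Fin s => gam F),
      ∫⁻ x, f (dSpan (e0 F) (fun i => WithLp.toLp 2 (-(if i = 0 then ‖g'‖ else 0),
        (Fin.cons x Y : Fin (s + 1) → F) i)) ^ 2) ∂(gam F) =
      ∫⁻ a, f (‖a‖ ^ 2 / (‖a‖ ^ 2 + ∑ i, g i ^ 2))
      ∂(gam (EuclideanSpace ℝ (Fin (Module.finrank ℝ F - s)))) := by
    filter_upwards [ae_linearIndependent s hs] with Y hY
    simp only [dSpan_cons _ hq, hq2]
    set L := Submodule.span ℝ (Set.range Y) with hL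
    have hdim : Module.finrank ℝ Lᗮ = Module.finrank ℝ F - s := by
      have h1 := L.finrank_add_finrank_orthogonal
      have h2 : Module.finrank ℝ L = s := by simpa using finrank_span_eq_card hY
      omega
    rw [← (isG_proj Lᗮ).lintegral_norm (isG_gam _) (by simpa using hdim)
      (fun t => f (t ^ 2 / (t ^ 2 + ∑ i, g i ^ 2))) (by fun_prop),
      lintegral_map (by fun_prop) (by fun_prop)]
  refine (lintegral_congr_ae hae).trans ?_
  simp
end Prob

section Final

/-- Reduction of the first point to a fixed unit vector. -/
lemma reduce_first {E : Type*} [NormedAddCommGroup E] [InnerProductSpace ℝ E] [MeasurableSpace E]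
    [BorelSpace E] [FiniteDimensional ℝ E] {μ : Measure E} (hμ : IsUnif μ) (e : E) (he : ‖e‖ = 1)
    (r : ℕ) (f : ℝ → ℝ≥0∞) (hf : Measurable f) :
    ∫⁻ X, f (dSpan (X 0) (fun i : Fin r => X i.succ - X 0) ^ 2)
      ∂(Measure.pi fun _ : Fin (r + 1) => μ) =
    ∫⁻ X, f (dSpan e (fun i : Fin r => X i - e) ^ 2) ∂(Measure.pi fun _ : Fin r => μ) := by
  have := hμ.prob
  have hD := measurable_dSpan (ι := Fin r) (E := E)
  have hm : Measurable fun X : Fin (r + 1) → E =>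
      f (dSpan (X 0) (fun i : Fin r => X i.succ - X 0) ^ 2) := by
    refine hf.comp (Measurable.pow_const ?_ 2)
    exact hD.comp (f := fun X : Fin (r + 1) → E => (X 0, fun i : Fin r => X i.succ - X 0))
      (by fun_prop)
  have hm2 : ∀ x : E, Measurable fun X : Fin r → E =>
      f (dSpan x (fun i : Fin r => X i - x) ^ 2) := by
    intro x
    refine hf.comp (Measurable.pow_const ?_ 2)
    exact hD.comp (f := fun X : Fin r → E => (x, fun i : Fin r => X i - x)) (by fun_prop)
  rw [lintegral_pi_cons μ _ hm]
  refine (lintegral_prod _ (hm.comp (mp_cons μ r).measurable).aemeasurable).trans ?_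
  have hae : ∀ᵐ x ∂μ, ∫⁻ X, f (dSpan x (fun i : Fin r => X i - x) ^ 2)
      ∂(Measure.pi fun _ : Fin r => μ) =
      ∫⁻ X, f (dSpan e (fun i : Fin r => X i - e) ^ 2) ∂(Measure.pi fun _ : Fin r => μ) := by
    filter_upwards [hμ.sph] with x hx
    obtain ⟨T, rfl⟩ := exists_isometry_of_norm_eq (he.trans hx.symm)
    have hT : Measurable T := T.continuous.measurable
    have hprob : ∀ i : Fin r, IsProbabilityMeasure (μ.map T) := fun i => by
      rw [hμ.inv T]; infer_instance
    have h := Measure.pi_map_pi (μ := fun _ : Fin r => μ) (f := fun _ => T)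
      (fun _ => hT.aemeasurable)
    simp only [hμ.inv T] at h
    conv_lhs => rw [← h]
    rw [lintegral_map (hm2 _) (by fun_prop)]
    refine lintegral_congr fun X => ?_
    simp only [← map_sub]
    rw [dSpan_isom T e]
  refine (lintegral_congr_ae hae).trans ?_
  simp

lemma gauss_main {F : Type*} [NormedAddCommGroup F] [InnerProductSpace ℝ F]
    [MeasurableSpace F] [BorelSpace F] [FiniteDimensional ℝ F] [Nontrivial F] (s A B : ℕ)
    (hA : Module.finrank ℝ F = s + (A + 1)) (hB : (s + 1) * Module.finrank ℝ F = B + 1)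
    (f : ℝ → ℝ≥0∞) (hf : Measurable f) :
    ∫⁻ p : Fin (s + 1) → F × F, f (dSpan (e0 F) (fun i => PsiMap (p i) - e0 F) ^ 2)
      ∂(Measure.pi fun _ => (gam F).prod (gam F)) =
    ∫⁻ t, f t ∂(betaDist ((A + 1 : ℕ) / 2) ((B + 1 : ℕ) / 2)) := by
  have hD := measurable_dSpan (ι := Fin (s + 1)) (E := WithLp 2 (ℝ × F))
  have hmp := measurePreserving_arrowProdEquivProdArrow F F (Fin (s + 1))
    (fun _ => gam F) (fun _ => gam F)
  have h0 : gam F {0} = 0 := gam_noAtom F _ (by simp)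
  have hne : ∀ᵐ p ∂(Measure.pi fun _ : Fin (s + 1) => (gam F).prod (gam F)),
      ∀ i, (p i).1 ≠ 0 := by
    rw [ae_all_iff]
    intro i
    have h1 : ∀ᵐ q ∂((gam F).prod (gam F)), q.1 ≠ 0 :=
      Measure.quasiMeasurePreserving_fst.ae (compl_mem_ae_iff.2 h0)
    exact (Measure.quasiMeasurePreserving_eval
      (fun _ : Fin (s + 1) => (gam F).prod (gam F)) i).ae h1
  have hm : Measurable fun P : (Fin (s + 1) → F) × (Fin (s + 1) → F) =>
      f (dSpan (e0 F) (fun i => WithLp.toLp 2 (-‖P.1 i‖, P.2 i)) ^ 2) := by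
    refine hf.comp (Measurable.pow_const ?_ 2)
    exact hD.comp (f := fun P : (Fin (s + 1) → F) × (Fin (s + 1) → F) =>
      (e0 F, fun i : Fin (s + 1) => (WithLp.toLp 2 (-‖P.1 i‖, P.2 i) : WithLp 2 (ℝ × F))))
      (by fun_prop)
  have e1 : ∫⁻ p : Fin (s + 1) → F × F, f (dSpan (e0 F) (fun i => PsiMap (p i) - e0 F) ^ 2)
      ∂(Measure.pi fun _ => (gam F).prod (gam F)) =
      ∫⁻ p : Fin (s + 1) → F × F, f (dSpan (e0 F)
        (fun i => WithLp.toLp 2 (-‖(p i).1‖, (p i).2)) ^ 2)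
      ∂(Measure.pi fun _ => (gam F).prod (gam F)) := by
    refine lintegral_congr_ae ?_
    filter_upwards [hne] with p hp
    simp only [Psi_sub _ (hp _)]
    rw [dSpan_smul]
    intro i
    have := norm_pos_iff.2 (hp i)
    positivity
  rw [e1]
  have e2 := hmp.lintegral_comp hm
  refine Eq.trans e2 ?_
  rw [lintegral_prod _ hm.aemeasurable]
  have hne2 : ∀ᵐ G ∂(Measure.pi fun _ : Fin (s + 1) => gam F), G 0 ≠ 0 :=
    (Measure.quasiMeasurePreserving_eval (fun _ : Fin (s + 1) => gam F) 0).ae (compl_mem_ae_iff.2 h0)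
  have e3 : ∀ᵐ G ∂(Measure.pi fun _ : Fin (s + 1) => gam F),
      ∫⁻ Y : Fin (s + 1) → F, f (dSpan (e0 F) (fun i => WithLp.toLp 2 (-‖G i‖, Y i)) ^ 2)
        ∂(Measure.pi fun _ => gam F) =
      ∫⁻ a, f (‖a‖ ^ 2 / (‖a‖ ^ 2 + ‖(WithLp.toLp 2 G : PiLp 2 fun _ : Fin (s + 1) => F)‖ ^ 2))
      ∂(gam (EuclideanSpace ℝ (Fin (Module.finrank ℝ F - s)))) := by
    filter_upwards [hne2] with G hG
    rw [lemmaR (by omega) (fun i => ‖G i‖) (fun h => hG (by simpa using congrFun h 0)) f hf,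
      PiLp.norm_sq_eq_of_L2]
  rw [lintegral_congr_ae e3]
  have hpi := IsG.pi (fun _ : Fin (s + 1) => isG_gam F)
  have := hpi.prob
  have hm4 : Measurable fun q : (PiLp 2 fun _ : Fin (s + 1) => F) ×
      EuclideanSpace ℝ (Fin (Module.finrank ℝ F - s)) =>
      f (‖q.2‖ ^ 2 / (‖q.2‖ ^ 2 + ‖q.1‖ ^ 2)) := by fun_prop
  have e4 := lintegral_map (μ := Measure.pi fun _ : Fin (s + 1) => gam F)
    (Measurable.lintegral_prod_right' (ν := gam (EuclideanSpace ℝ (Fin (Module.finrank ℝ F - s))))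
      hm4) (g := WithLp.toLp 2) (by fun_prop)
  rw [← e4, lintegral_lintegral_swap hm4.aemeasurable]
  refine beta_gauss A B (isG_gam _) hpi ?_ ?_ f hf
  · simp; omega
  · rw [(WithLp.linearEquiv 2 ℝ (Fin (s + 1) → F)).finrank_eq, Module.finrank_pi_fintype]
    simpa using hB

end Final

theorem stmt6 (n r : ℕ) (hn : 2 ≤ n) (hr : 1 ≤ r) (hrn : r ≤ n - 1) :
    Measure.map
        (fun X : Fin (r + 1) → EuclideanSpace ℝ (Fin n) => distToAffSpan X ^ 2)
        (Measure.pi fun _ => sphereUniform n)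
      = betaDist (((n : ℝ) - r) / 2) ((r : ℝ) * ((n : ℝ) - 1) / 2) := by
  obtain ⟨N, rfl⟩ : ∃ N, n = N + 1 := ⟨n - 1, by omega⟩
  obtain ⟨s, rfl⟩ : ∃ s, r = s + 1 := ⟨r - 1, by omega⟩
  obtain ⟨A, hA⟩ : ∃ A, N = s + (A + 1) := ⟨N - s - 1, by omega⟩
  obtain ⟨B, hB⟩ : ∃ B, (s + 1) * N = B + 1 :=
    ⟨(s + 1) * N - 1, by have : 0 < (s + 1) * N := Nat.mul_pos (by omega) (by omega)
                         omega⟩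
  have hF : Module.finrank ℝ (EuclideanSpace ℝ (Fin N)) = N := by simp
  have : Nontrivial (EuclideanSpace ℝ (Fin N)) :=
    Module.nontrivial_of_finrank_pos (R := ℝ) (by omega)
  have hσ := isUnif_sphereUniform N
  have hpr := hσ.prob
  have hdim : Module.finrank ℝ (WithLp 2 (ℝ × EuclideanSpace ℝ (Fin N))) =
      Module.finrank ℝ (EuclideanSpace ℝ (Fin (N + 1))) := by
    rw [(WithLp.linearEquiv 2 ℝ (ℝ × EuclideanSpace ℝ (Fin N))).finrank_eq]
    simp [add_comm]
  obtain ⟨J⟩ := exists_isom_of_finrank hdim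
  have hJ : Measurable J := J.continuous.measurable
  have hJs : Measurable J.symm := J.symm.continuous.measurable
  have hPsi := measurable_PsiMap (F := EuclideanSpace ℝ (Fin N))
  have hσ2 : sphereUniform (N + 1) = ((gam (EuclideanSpace ℝ (Fin N))).prod
      (gam (EuclideanSpace ℝ (Fin N)))).map (fun p => J (PsiMap p)) := by
    have h1 := (hσ.map_isom J.symm).eq_Psi
    have h2 := congrArg (Measure.map J) h1
    rw [Measure.map_map hJ hJs, Measure.map_map hJ hPsi] at h2
    have h3 : (⇑J ∘ ⇑J.symm) = id := by ext x : 1; simp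
    rw [h3, Measure.map_id] at h2
    exact h2
  have hb1 : (((N + 1 : ℕ) : ℝ) - ((s + 1 : ℕ) : ℝ)) / 2 = ((A + 1 : ℕ) : ℝ) / 2 := by
    rw [hA]; push_cast; ring
  have hb2 : ((s + 1 : ℕ) : ℝ) * (((N + 1 : ℕ) : ℝ) - 1) / 2 = ((B + 1 : ℕ) : ℝ) / 2 := by
    rw [← hB]; push_cast; ring
  rw [hb1, hb2]
  have hD := measurable_dSpan (ι := Fin (s + 1)) (E := EuclideanSpace ℝ (Fin (N + 1)))
  have hdm : Measurable fun X : Fin (s + 1 + 1) → EuclideanSpace ℝ (Fin (N + 1)) =>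
      distToAffSpan X ^ 2 := by
    simp only [distToAffSpan_eq]
    refine Measurable.pow_const ?_ 2
    exact hD.comp (f := fun X : Fin (s + 1 + 1) → EuclideanSpace ℝ (Fin (N + 1)) =>
      (X 0, fun i : Fin (s + 1) => X i.succ - X 0)) (by fun_prop)
  refine Measure.ext_of_lintegral _ fun f hf => ?_
  rw [lintegral_map hf hdm]
  simp only [distToAffSpan_eq]
  have he : ‖J (e0 (EuclideanSpace ℝ (Fin N)))‖ = 1 := by
    rw [J.norm_map, e0, WithLp.prod_norm_eq_of_L2]
    simp
  rw [reduce_first hσ _ he (s + 1) f hf, ← gauss_main (F := EuclideanSpace ℝ (Fin N)) s A B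
    (by rw [hF, hA]) (by rw [hF, hB]) f hf]
  have hpi := Measure.pi_map_pi (μ := fun _ : Fin (s + 1) =>
      (gam (EuclideanSpace ℝ (Fin N))).prod (gam (EuclideanSpace ℝ (Fin N))))
    (f := fun _ p => J (PsiMap p)) (hμ := fun _ => by rw [← hσ2]; infer_instance)
    (fun _ => (hJ.comp hPsi).aemeasurable)
  simp only [← hσ2] at hpi
  rw [← hpi, lintegral_map]
  · refine lintegral_congr fun p => ?_
    simp only [← map_sub]
    rw [dSpan_isom J]
  · refine hf.comp (Measurable.pow_const ?_ 2)
    exact hD.comp (f := fun X : Fin (s + 1) → EuclideanSpace ℝ (Fin (N + 1)) =>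
      (J (e0 _), fun i : Fin (s + 1) => X i - J (e0 _))) (by fun_prop)
  · exact measurable_pi_lambda _ fun i => (hJ.comp hPsi).comp (measurable_pi_apply i)
end

section
/- As n → ∞: (i) (1/2) · Σ_{j=1}^{n} ψ(j/2) ∼ (n/2) · log n, i.e., the ratio of the two sides tends to 1; and (ii) (1/4) · Σ_{j=1}^{n} ψ^{(1)}(j/2) − (1/2) log n converges to the constant c₁ = (1/2)(γ + 1 + π²/8), where γ is the Euler–Mascheroni constant. -/
open MeasureTheory Real Filter Finset

/-- `polyGamma m` is the `m`-th polygamma function `ψ^{(m)}`, i.e. the `(m+1)`-st derivative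
of `log Γ`; in particular `polyGamma 0` is the digamma function `ψ`. -/
noncomputable def polyGamma (m : ℕ) (z : ℝ) : ℝ :=
  iteratedDeriv (m + 1) (fun x => Real.log (Real.Gamma x)) z

/-- The digamma function `ψ = Γ'/Γ = (log Γ)'`. -/
noncomputable def digamma (z : ℝ) : ℝ := deriv (fun x => Real.log (Real.Gamma x)) z

theorem hG_diff {x : ℝ} (hx : 0 < x) :
    DifferentiableAt ℝ (fun x => Real.log (Real.Gamma x)) x := by
  refine ((differentiableAt_Gamma ?_).log (Gamma_ne_zero ?_)) <;>
    exact fun m ↦ ne_of_gt (by have : (0:ℝ) ≤ m := Nat.cast_nonneg m; linarith)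

theorem hG_rec (x : ℝ) (hx : 0 < x) :
    Real.log (Real.Gamma (x + 1)) = Real.log (Real.Gamma x) + Real.log x := by
  rw [Gamma_add_one hx.ne', log_mul hx.ne' (Gamma_pos_of_pos hx).ne', add_comm]

theorem digamma_rec (x : ℝ) (hx : 0 < x) : digamma (x + 1) = digamma x + 1 / x := by
  unfold digamma
  rw [← deriv_comp_add_const (f := fun x => Real.log (Real.Gamma x)), one_div, ← Real.deriv_log,
    ← deriv_add (hG_diff hx) (differentiableAt_log hx.ne')]
  apply EventuallyEq.deriv_eq
  filter_upwards [eventually_gt_nhds hx] using hG_rec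

theorem digamma_le (x : ℝ) (hx : 0 < x) : digamma x ≤ Real.log x := by
  have hc : ConvexOn ℝ (Set.Ioi 0) (fun x => Real.log (Real.Gamma x)) := convexOn_log_Gamma
  refine (hc.deriv_le_slope (Set.mem_Ioi.2 hx) (Set.mem_Ioi.2 (by linarith : 0 < x + 1))
    (by linarith) (hG_diff hx)).trans (le_of_eq ?_)
  rw [slope_def_field, hG_rec x hx]
  ring

theorem le_digamma (x : ℝ) (hx : 0 < x) : Real.log x ≤ digamma (x + 1) := by
  have hc : ConvexOn ℝ (Set.Ioi 0) (fun x => Real.log (Real.Gamma x)) := convexOn_log_Gamma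
  refine (le_of_eq ?_).trans (hc.slope_le_deriv (Set.mem_Ioi.2 hx)
    (Set.mem_Ioi.2 (by linarith : 0 < x + 1)) (by linarith) (hG_diff (by linarith)))
  rw [slope_def_field, hG_rec x hx]
  ring

theorem digamma_add_nat (x : ℝ) (hx : 0 < x) (N : ℕ) :
    digamma (x + N) = digamma x + ∑ k ∈ range N, 1 / (x + k) := by
  induction N with
  | zero => simp
  | succ N ih =>
    rw [sum_range_succ, Nat.cast_succ, ← add_assoc, digamma_rec _ (by positivity), ih]
    ring

theorem tendsto_digamma_sub (x : ℝ) (hx : 0 < x) :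
    Tendsto (fun N : ℕ => digamma (x + N) - Real.log (x + N)) atTop (nhds 0) := by
  have h1 : Tendsto (fun N : ℕ => -(1 / (x + (N:ℝ)))) atTop (nhds 0) := by
    rw [← neg_zero]
    refine Tendsto.neg ?_
    simp_rw [one_div]
    exact tendsto_inv_atTop_zero.comp (tendsto_atTop_add_const_left _ _ tendsto_natCast_atTop_atTop)
  refine tendsto_of_tendsto_of_tendsto_of_le_of_le h1 tendsto_const_nhds ?_ ?_
  · intro N
    have hp : 0 < x + (N:ℝ) := by positivity
    have := le_digamma _ hp
    rw [digamma_rec _ hp] at this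
    simp only
    linarith
  · intro N
    have hp : 0 < x + (N:ℝ) := by positivity
    have := digamma_le _ hp
    simp only
    linarith

theorem tendsto_log_sub (x : ℝ) (hx : 0 < x) :
    Tendsto (fun N : ℕ => Real.log (x + N) - Real.log N) atTop (nhds 0) := by
  have h : Tendsto (fun N : ℕ => Real.log (x / N + 1)) atTop (nhds 0) := by
    have h1 : Tendsto (fun N : ℕ => x / (N:ℝ) + 1) atTop (nhds (0 + 1)) :=
      (tendsto_const_div_atTop_nhds_zero_nat x).add_const 1
    have := h1.log (by norm_num)
    simpa using this
  refine h.congr' ?_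
  filter_upwards [eventually_gt_atTop 0] with N hN
  have hN' : (0:ℝ) < N := by exact_mod_cast hN
  rw [← Real.log_div (by positivity) (by positivity), add_div, div_self hN'.ne']

theorem tendsto_partial (x : ℝ) (hx : 0 < x) :
    Tendsto (fun N : ℕ => ∑ k ∈ range N, (1 / (1 + (k:ℝ)) - 1 / (x + k))) atTop
      (nhds (digamma x - digamma 1)) := by
  have h := (((tendsto_digamma_sub 1 one_pos).add (tendsto_log_sub 1 one_pos)).sub
    ((tendsto_digamma_sub x hx).add (tendsto_log_sub x hx))).add_const (digamma x - digamma 1)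
  simp only [add_zero, sub_zero, zero_add] at h
  refine h.congr fun N => ?_
  rw [digamma_add_nat 1 one_pos, digamma_add_nat x hx, sum_sub_distrib]
  ring

theorem summable_sq (a : ℝ) (ha : 0 < a) : Summable (fun k : ℕ => 1 / (a + k) ^ 2) := by
  have h := (Real.summable_one_div_nat_add_rpow a 2).2 (by norm_num)
  refine h.congr fun k => ?_
  have : 0 < (k:ℝ) + a := by positivity
  rw [abs_of_pos this, add_comm]
  norm_num

theorem hasDerivAt_digamma (x : ℝ) (hx : 0 < x) :
    HasDerivAt digamma (∑' k : ℕ, 1 / (x + k) ^ 2) x := by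
  have key : ∀ y ∈ Set.Ioi (x/2), 
      Summable (fun k : ℕ => 1 / (1 + (k:ℝ)) - 1 / (y + k)) := by
    intro y hy
    have hy' : 0 < y := by have := Set.mem_Ioi.1 hy; linarith
    refine Summable.of_norm_bounded
      (g := fun k : ℕ => |y - 1| * (1 / (min 1 y + k) ^ 2)) ((summable_sq _ (by positivity)).mul_left _) ?_
    intro k
    have h1 : 0 < 1 + (k:ℝ) := by positivity
    have h2 : 0 < y + (k:ℝ) := by positivity
    have h3 : 0 < min 1 y + (k:ℝ) := by positivity
    have : 1 / (1 + (k:ℝ)) - 1 / (y + k) = (y - 1) * (1 / ((1 + k) * (y + k))) := by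
      field_simp; ring
    rw [this, norm_mul, Real.norm_eq_abs, Real.norm_eq_abs, 
      abs_of_pos (by positivity : 0 < 1 / ((1 + (k:ℝ)) * (y + k)))]
    gcongr
    rw [sq]
    gcongr
    · exact min_le_left _ _
    · exact min_le_right _ _
  have h := hasDerivAt_tsum_of_isPreconnected (t := Set.Ioi (x/2)) (y₀ := x) (y := x)
    (g := fun (k : ℕ) (y : ℝ) => 1 / (1 + (k:ℝ)) - 1 / (y + k))
    (g' := fun (k : ℕ) (y : ℝ) => 1 / (y + k) ^ 2)
    (u := fun k : ℕ => 1 / (x/2 + k) ^ 2) (summable_sq (x/2) (by positivity)) isOpen_Ioi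
    isPreconnected_Ioi ?_ ?_ (by simp [hx]) (key x (by simp [hx])) (by simp [hx])
  · have h2 := h.add_const (digamma 1)
    refine h2.congr_of_eventuallyEq ?_
    filter_upwards [eventually_gt_nhds (show x/2 < x by linarith)] with y hy
    have := tendsto_nhds_unique (key y hy).hasSum.tendsto_sum_nat (tendsto_partial y (by linarith))
    rw [this]; ring
  · intro k y hy
    have hy' : 0 < y := by have := Set.mem_Ioi.1 hy; linarith
    have h2 : y + (k:ℝ) ≠ 0 := by positivity
    have := (((hasDerivAt_id y).add_const (k:ℝ)).inv h2).const_sub (1 / (1 + (k:ℝ)))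
    convert this using 1
    · funext z; simp [one_div]
    · simp only [id]; ring
  · intro k y hy
    have hy' := Set.mem_Ioi.1 hy
    have : 0 < y := by linarith
    rw [Real.norm_eq_abs, abs_of_pos (by positivity)]
    gcongr

theorem polyGamma_one_hasSum (x : ℝ) (hx : 0 < x) :
    HasSum (fun k : ℕ => 1 / (x + k) ^ 2) (polyGamma 1 x) := by
  have : polyGamma 1 x = ∑' k : ℕ, 1 / (x + k) ^ 2 := by
    unfold polyGamma
    rw [iteratedDeriv_succ, iteratedDeriv_one]
    exact (hasDerivAt_digamma x hx).deriv
  rw [this]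
  exact (summable_sq x hx).hasSum

theorem polyGamma_rec (x : ℝ) (hx : 0 < x) :
    polyGamma 1 (x + 1) = polyGamma 1 x - 1 / x ^ 2 := by
  have h := (hasSum_nat_add_iff' 1).2 (polyGamma_one_hasSum x hx)
  have h2 := polyGamma_one_hasSum (x+1) (by linarith)
  have := h2.unique (h.congr_fun ?_)
  · simpa using this
  · intro k; push_cast; congr 2; ring

theorem tendsto_inv_tail (x : ℝ) :
    Tendsto (fun N : ℕ => 1 / (x + (0:ℕ)) - 1 / (x + (N:ℝ))) atTop (nhds (1 / x)) := by
  have : Tendsto (fun N : ℕ => (1 / (x + (N:ℝ)))) atTop (nhds 0) := by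
    simp_rw [one_div]
    exact tendsto_inv_atTop_zero.comp (tendsto_atTop_add_const_left _ _ tendsto_natCast_atTop_atTop)
  simpa using this.const_sub (1 / x)

theorem le_polyGamma (x : ℝ) (hx : 0 < x) : 1 / x ≤ polyGamma 1 x := by
  refine le_of_tendsto_of_tendsto' (tendsto_inv_tail x)
    (polyGamma_one_hasSum x hx).tendsto_sum_nat fun N => ?_
  rw [← sum_range_sub' (fun k : ℕ => 1 / (x + (k:ℝ)))]
  refine sum_le_sum fun k _ => ?_
  have h : 0 < x + (k:ℝ) := by positivity
  push_cast
  rw [← add_assoc, div_sub_div _ _ h.ne' (by positivity), div_le_div_iff₀ (by positivity) (by positivity)]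
  nlinarith

theorem polyGamma_le (x : ℝ) (hx : 0 < x) : polyGamma 1 (x + 1) ≤ 1 / x := by
  refine le_of_tendsto_of_tendsto' 
    (polyGamma_one_hasSum (x+1) (by linarith)).tendsto_sum_nat (tendsto_inv_tail x) fun N => ?_
  rw [← sum_range_sub' (fun k : ℕ => 1 / (x + (k:ℝ)))]
  refine sum_le_sum fun k _ => ?_
  have h : 0 < x + (k:ℝ) := by positivity
  push_cast
  rw [← add_assoc, add_right_comm x 1, div_sub_div _ _ h.ne' (by positivity), div_le_div_iff₀ (by positivity) (by positivity)]
  nlinarith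

theorem sum_formula (n : ℕ) :
    (1 / 4 : ℝ) * ∑ j ∈ Finset.Icc 1 n, polyGamma 1 ((j : ℝ) / 2) =
      ∑ m ∈ range n, ((m / 2 + 1 : ℕ) : ℝ) / ((m:ℝ) + 1) ^ 2 +
      (((n / 2 : ℕ) : ℝ) * (polyGamma 1 (((n:ℝ) + 1) / 2) / 4) +
        (((n + 1) / 2 : ℕ) : ℝ) * (polyGamma 1 (((n:ℝ) + 2) / 2) / 4)) := by
  induction n with
  | zero => simp
  | succ n ih =>
    rw [sum_Icc_succ_top (by omega), mul_add, ih, sum_range_succ]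
    have h := polyGamma_rec (((n:ℝ) + 1) / 2) (by positivity)
    have e1 : ((n:ℝ) + 1) / 2 + 1 = (n + 1 + 2) / 2 := by ring
    rw [e1] at h
    have e2 : (n:ℝ) + 1 + 1 = n + 2 := by ring
    have e3 : (n + 1 + 1) / 2 = n / 2 + 1 := by omega
    push_cast
    rw [e2, h, e3]
    push_cast
    field_simp
    ring

theorem odd_hasSum : HasSum (fun m : ℕ => ((m % 2 : ℕ) : ℝ) / (m:ℝ) ^ 2) (π ^ 2 / 8) := by
  have hz := hasSum_zeta_two
  have he : HasSum (fun k : ℕ => 1 / (((2 * k : ℕ)) : ℝ) ^ 2) (1 / 4 * (π ^ 2 / 6)) := by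
    refine (hz.mul_left (1/4)).congr_fun ?_
    intro k
    push_cast
    rw [mul_pow, one_div_mul_one_div]
    norm_num
  have ho : Summable (fun k : ℕ => 1 / (((2 * k + 1 : ℕ)) : ℝ) ^ 2) :=
    hz.summable.comp_injective (i := fun k : ℕ => 2 * k + 1) (fun a b h => by simpa using h)
  have hu := (HasSum.even_add_odd (f := fun m : ℕ => 1 / (m:ℝ) ^ 2) he ho.hasSum).unique hz
  have hs : (∑' k : ℕ, 1 / (((2 * k + 1 : ℕ)) : ℝ) ^ 2) = π ^ 2 / 8 := by linarith
  have ho' := ho.hasSum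
  rw [hs] at ho'
  rw [← zero_add (π ^ 2 / 8)]
  refine HasSum.even_add_odd ?_ ?_
  · simpa using hasSum_zero
  · refine ho'.congr_fun fun k => ?_
    simp [Nat.add_mod]

theorem main_term : Tendsto (fun n : ℕ =>
    ∑ m ∈ range n, ((m / 2 + 1 : ℕ) : ℝ) / ((m:ℝ) + 1) ^ 2 - 1 / 2 * Real.log n) atTop
    (nhds (1 / 2 * (Real.eulerMascheroniConstant + π ^ 2 / 8))) := by
  have h1 := tendsto_harmonic_sub_log
  have h2 := ((hasSum_nat_add_iff' 1).2 odd_hasSum).tendsto_sum_nat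
  have h3 := (h1.add h2).const_mul (1 / 2 : ℝ)
  simp only [range_one, sum_singleton, Nat.zero_mod, Nat.cast_zero, zero_div, sub_zero] at h3
  refine h3.congr fun n => ?_
  rw [harmonic]
  push_cast
  rw [sub_add_eq_add_sub, ← sum_add_distrib, mul_sub, mul_sum]
  congr 1
  refine sum_congr rfl fun m _ => ?_
  have e : ((m / 2 + 1 : ℕ) : ℝ) * 2 = (m + 1) + ((m + 1) % 2 : ℕ) := by
    have : (m / 2 + 1) * 2 = (m + 1) + (m + 1) % 2 := by omega
    exact_mod_cast this
  have e' : ((m / 2 : ℕ) : ℝ) + 1 = ((m + 1) + ((m + 1) % 2 : ℕ)) / 2 := by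
    push_cast at e ⊢; linarith
  push_cast at e' ⊢
  rw [e']
  field_simp

theorem nat_mul_polyGamma (c : ℝ) (hc : 0 < c) (a : ℕ → ℕ) (ha1 : ∀ n : ℕ, (n:ℝ) - 1 ≤ 2 * a n)
    (ha2 : ∀ n : ℕ, 2 * (a n : ℝ) ≤ n + 1) :
    Tendsto (fun n : ℕ => (a n : ℝ) * (polyGamma 1 (((n:ℝ) + c) / 2) / 4)) atTop
      (nhds (1 / 4)) := by
  have hl : Tendsto (fun n : ℕ => (1 / 4 : ℝ) * (((n:ℝ) + (-1)) / (n + c))) atTop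
      (nhds (1 / 4 * 1)) := by
    refine Tendsto.const_mul _ ?_
    have := ((tendsto_inv_tail c).sub_const (1/c)).const_mul (c + 1) |>.const_add 1
    simp only [sub_self, mul_zero, add_zero] at this
    refine this.congr fun n => ?_
    have : 0 < (n:ℝ) + c := by positivity
    rw [add_comm c]
    field_simp
    simp
    field_simp
    ring
  have hu : Tendsto (fun n : ℕ => (1 / 4 : ℝ) * (((n:ℝ) + 1) / (n + (c - 2)))) atTop
      (nhds (1 / 4 * 1)) := by
    refine Tendsto.const_mul _ ?_
    have h0 : Tendsto (fun n : ℕ => 1 / ((n:ℝ) + (c - 2))) atTop (nhds 0) := by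
      simp_rw [one_div]
      exact tendsto_inv_atTop_zero.comp
        (tendsto_atTop_add_const_right _ _ tendsto_natCast_atTop_atTop)
    have := (h0.const_mul (3 - c)).const_add 1
    simp only [mul_zero, add_zero] at this
    refine this.congr' ?_
    filter_upwards [eventually_gt_atTop 2] with n hn
    have hn' : (2:ℝ) < n := by exact_mod_cast hn
    have : (n:ℝ) + (c - 2) ≠ 0 := by linarith
    field_simp
    ring
  rw [mul_one] at hl hu
  refine tendsto_of_tendsto_of_tendsto_of_le_of_le' hl hu ?_ ?_
  · filter_upwards [eventually_gt_atTop 2] with n hn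
    have hp := le_polyGamma (((n:ℝ) + c) / 2) (by positivity)
    have h1 : (0:ℝ) < n + c := by positivity
    calc (1 / 4 : ℝ) * (((n:ℝ) + (-1)) / (n + c)) ≤ 1 / 4 * ((2 * a n) / (n + c)) := by
          gcongr; have := ha1 n; linarith
      _ = (a n : ℝ) * ((1 / (((n:ℝ) + c) / 2)) / 4) := by field_simp
      _ ≤ _ := by gcongr
  · filter_upwards [eventually_gt_atTop 2] with n hn
    have hn' : (2:ℝ) < n := by exact_mod_cast hn
    have h1 : (0:ℝ) < n + (c - 2) := by linarith
    have hp := polyGamma_le (((n:ℝ) + (c - 2)) / 2) (by positivity)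
    have e : ((n:ℝ) + (c - 2)) / 2 + 1 = (n + c) / 2 := by ring
    rw [e] at hp
    calc _ ≤ (a n : ℝ) * ((1 / (((n:ℝ) + (c - 2)) / 2)) / 4) := by gcongr
      _ = 1 / 4 * ((2 * a n) / (n + (c - 2))) := by field_simp
      _ ≤ _ := by gcongr; exact ha2 n

theorem part_two : Tendsto
      (fun n : ℕ =>
        (1 / 4 : ℝ) * ∑ j ∈ Finset.Icc 1 n, polyGamma 1 ((j : ℝ) / 2)
          - (1 / 2 : ℝ) * Real.log n)
      atTop (nhds ((1 / 2 : ℝ) * (Real.eulerMascheroniConstant + 1 + π ^ 2 / 8))) := by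
  have ha := nat_mul_polyGamma 1 one_pos (fun n => n / 2)
    (fun n => by
      have : n ≤ 2 * (n / 2) + 1 := by omega
      have : (n:ℝ) ≤ 2 * (n / 2 : ℕ) + 1 := by exact_mod_cast this
      linarith)
    (fun n => by
      have : 2 * (n / 2) ≤ n + 1 := by omega
      exact_mod_cast this)
  have hb := nat_mul_polyGamma 2 two_pos (fun n => (n + 1) / 2)
    (fun n => by
      have : n ≤ 2 * ((n + 1) / 2) + 1 := by omega
      have : (n:ℝ) ≤ 2 * ((n + 1) / 2 : ℕ) + 1 := by exact_mod_cast this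
      linarith)
    (fun n => by
      have : 2 * ((n + 1) / 2) ≤ n + 1 := by omega
      exact_mod_cast this)
  have h := main_term.add (ha.add hb)
  have e : (1 / 2 : ℝ) * (Real.eulerMascheroniConstant + π ^ 2 / 8) + (1 / 4 + 1 / 4) =
    (1 / 2 : ℝ) * (Real.eulerMascheroniConstant + 1 + π ^ 2 / 8) := by ring
  rw [e] at h
  refine h.congr fun n => ?_
  rw [sum_formula]
  ring

theorem log_fact_lower (n : ℕ) :
    (n:ℝ) * Real.log n - n ≤ ∑ j ∈ Finset.Icc 1 n, Real.log (j:ℝ) := by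
  induction n with
  | zero => simp
  | succ n ih =>
    rw [sum_Icc_succ_top (by omega)]
    rcases Nat.eq_zero_or_pos n with rfl | hn
    · simp
    · have hn' : (0:ℝ) < n := by exact_mod_cast hn
      have h := Real.log_le_sub_one_of_pos (show 0 < ((n:ℝ) + 1) / n by positivity)
      rw [Real.log_div (by positivity) hn'.ne'] at h
      have h2 : ((n:ℝ) + 1) / n - 1 = 1 / n := by field_simp; ring
      rw [h2] at h
      have h3 := mul_le_mul_of_nonneg_left h hn'.le
      have h4 : (n:ℝ) * (1 / n) = 1 := by field_simp
      push_cast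
      nlinarith

theorem part_one : Tendsto
      (fun n : ℕ =>
        ((1 / 2 : ℝ) * ∑ j ∈ Finset.Icc 1 n, digamma ((j : ℝ) / 2))
          / (((n : ℝ) / 2) * Real.log n))
      atTop (nhds 1) := by
  have hinv : Tendsto (fun n : ℕ => 1 + (-4) * (Real.log n)⁻¹) atTop (nhds 1) := by
    have := ((tendsto_inv_atTop_zero.comp
      (Real.tendsto_log_atTop.comp tendsto_natCast_atTop_atTop)).const_mul (-4 : ℝ)).const_add 1
    simpa using this
  have hlow : ∀ n : ℕ, (n:ℝ) * Real.log n - 4 * n ≤ ∑ j ∈ Finset.Icc 1 n, digamma ((j:ℝ) / 2) := by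
    intro n
    have h1 : ∑ j ∈ Finset.Icc 1 n, (Real.log (j:ℝ) - 3) ≤
        ∑ j ∈ Finset.Icc 1 n, digamma ((j:ℝ) / 2) := by
      refine sum_le_sum fun j hj => ?_
      have hj1 : (1:ℝ) ≤ j := by exact_mod_cast (Finset.mem_Icc.1 hj).1
      have hx : 0 < (j:ℝ) / 2 := by positivity
      have h := le_digamma _ hx
      rw [digamma_rec _ hx, Real.log_div (by positivity) (by norm_num)] at h
      have h2 : 1 / ((j:ℝ) / 2) ≤ 2 := by
        rw [div_le_iff₀ hx]; linarith
      have := Real.log_two_lt_d9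
      linarith
    rw [sum_sub_distrib] at h1
    simp at h1
    have := log_fact_lower n
    linarith
  have hup : ∀ n : ℕ, ∑ j ∈ Finset.Icc 1 n, digamma ((j:ℝ) / 2) ≤ (n:ℝ) * Real.log n := by
    intro n
    have h1 : ∑ j ∈ Finset.Icc 1 n, digamma ((j:ℝ) / 2) ≤ ∑ j ∈ Finset.Icc 1 n, Real.log n := by
      refine sum_le_sum fun j hj => ?_
      have hj1 : (1:ℝ) ≤ j := by exact_mod_cast (Finset.mem_Icc.1 hj).1
      have hj2 : (j:ℝ) ≤ n := by exact_mod_cast (Finset.mem_Icc.1 hj).2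
      refine (digamma_le _ (by positivity)).trans (Real.log_le_log (by positivity) (by linarith))
    simpa using h1
  refine tendsto_of_tendsto_of_tendsto_of_le_of_le' hinv tendsto_const_nhds ?_ ?_
  · filter_upwards [eventually_gt_atTop 1] with n hn
    have hn' : (1:ℝ) < n := by exact_mod_cast hn
    have hl := Real.log_pos hn'
    rw [le_div_iff₀ (by positivity)]
    have := hlow n
    have e : (1 + (-4) * (Real.log n)⁻¹) * ((n:ℝ) / 2 * Real.log n) =
      1 / 2 * ((n:ℝ) * Real.log n - 4 * n) := by field_simp; ring
    rw [e]
    linarith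
  · filter_upwards [eventually_gt_atTop 1] with n hn
    have hn' : (1:ℝ) < n := by exact_mod_cast hn
    have hl := Real.log_pos hn'
    rw [div_le_iff₀ (by positivity)]
    have := hup n
    linarith

theorem stmt8 :
    Tendsto
      (fun n : ℕ =>
        ((1 / 2 : ℝ) * ∑ j ∈ Finset.Icc 1 n, digamma ((j : ℝ) / 2))
          / (((n : ℝ) / 2) * Real.log n))
      atTop (nhds 1)
    ∧ Tendsto
      (fun n : ℕ =>
        (1 / 4 : ℝ) * ∑ j ∈ Finset.Icc 1 n, polyGamma 1 ((j : ℝ) / 2)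
          - (1 / 2 : ℝ) * Real.log n)
      atTop (nhds ((1 / 2 : ℝ) * (Real.eulerMascheroniConstant + 1 + π ^ 2 / 8))) := by
  exact ⟨part_one, part_two⟩
end

section
/- Let α ∈ (0,1) and let r = r(n) be a sequence of integers with 1 ≤ r(n) ≤ n and r(n)/n → α as n → ∞. Then, as n → ∞: for m = 1, (d/dz) S_{n,r}(z) |_{z=0} ∼ (α n/2) · log n; for m = 2, (d²/dz²) S_{n,r}(z) |_{z=0} converges to (1/2) · log(1/(1−α)); and for each fixed integer m ≥ 3, (d^m/dz^m) S_{n,r}(z) |_{z=0} ∼ (−1)^m · (m−3)! / (2 · n^{m−2}) · ( (1−α)^{−(m−2)} − 1 ), where ∼ denotes that the ratio of the two sides tends to 1. -/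
open MeasureTheory Real Filter Finset

/-- `S n r z = Σ_{j=1}^{r} [ log Γ((n−r+j+z)/2) − log Γ((n−r+j)/2) ]`. -/
noncomputable def S (n r : ℕ) (z : ℝ) : ℝ :=
  ∑ j ∈ Finset.Icc 1 r,
    (Real.log (Real.Gamma (((n : ℝ) - r + j + z) / 2))
      - Real.log (Real.Gamma (((n : ℝ) - r + j) / 2)))

/-- The `m`-th derivative of `z ↦ S n r z` evaluated at `z = 0`. -/
noncomputable def SderivAt0 (n r m : ℕ) : ℝ := iteratedDeriv m (S n r) 0

/-- The polygamma-type series `∑ 1/(x+k)^m`. -/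
noncomputable def PG (m : ℕ) (x : ℝ) : ℝ := ∑' k : ℕ, 1 / (x + k) ^ m

lemma PG_summable (m : ℕ) (hm : 2 ≤ m) (x : ℝ) (hx : 0 < x) :
    Summable (fun k : ℕ => 1 / (x + k) ^ m) := by
  have h := (Real.summable_one_div_nat_add_rpow x m).2 (by exact_mod_cast hm)
  refine h.congr (fun k => ?_)
  rw [Real.rpow_natCast, abs_of_pos (by positivity), add_comm]

lemma PG_hasDerivAt (m : ℕ) (hm : 2 ≤ m) (x : ℝ) (hx : 0 < x) :
    HasDerivAt (PG m) (-(m : ℝ) * PG (m + 1) x) x := by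
  have hs := PG_summable (m + 1) (by omega) (x / 2) (by positivity)
  have := hasDerivAt_tsum_of_isPreconnected (𝕜 := ℝ) (F := ℝ)
    (g := fun (k : ℕ) (y : ℝ) => 1 / (y + k) ^ m)
    (g' := fun (k : ℕ) (y : ℝ) => -(m : ℝ) * (1 / (y + k) ^ (m + 1)))
    (u := fun k : ℕ => (m : ℝ) * (1 / (x / 2 + k) ^ (m + 1))) (t := Set.Ioi (x / 2))
    (y₀ := x) (y := x) (hs.mul_left _) isOpen_Ioi isPreconnected_Ioi ?_ ?_ ?_ ?_ ?_
  · rw [tsum_mul_left] at this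
    exact this
  · intro k y hy
    have hy0 : 0 < y := lt_trans (by positivity) hy
    have hyk : 0 < y + k := by positivity
    have h1 : HasDerivAt (fun y : ℝ => (y + k) ^ m) ((m : ℝ) * (y + k) ^ (m - 1) * 1) y :=
      ((hasDerivAt_id y).add_const (k : ℝ)).pow m
    have h2 := h1.inv (by positivity)
    simp only [one_div]
    refine h2.congr_deriv ?_
    obtain ⟨p, rfl⟩ : ∃ p, m = p + 1 := ⟨m - 1, by omega⟩
    simp only [Nat.add_sub_cancel]
    field_simp
    ring
  · intro k y hy
    have hy' : x / 2 < y := hy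
    have hy0 : 0 < y := lt_trans (by positivity) hy
    rw [norm_mul, norm_neg, Real.norm_of_nonneg (by positivity),
      Real.norm_of_nonneg (by positivity)]
    gcongr
  · simp [hx]
  · exact PG_summable m hm x hx
  · simp [hx]

/-- Terms of the Weierstrass/Gauss series of `log Γ`. -/
noncomputable def uT (k : ℕ) (x : ℝ) : ℝ :=
  x * (Real.log (k + 2) - Real.log (k + 1)) - Real.log (x + k + 1) + Real.log (k + 1)

noncomputable def uT' (k : ℕ) (x : ℝ) : ℝ :=
  (Real.log (k + 2) - Real.log (k + 1)) - 1 / (x + k + 1)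

lemma uT_sum (x : ℝ) (N : ℕ) : ∑ k ∈ Finset.range N, uT k x =
    Real.BohrMollerup.logGammaSeq x N + Real.log x
      + x * (Real.log (N + 1) - Real.log N) := by
  induction N with
  | zero => simp [Real.BohrMollerup.logGammaSeq]
  | succ N ih =>
    rw [Finset.sum_range_succ, ih]
    simp only [Real.BohrMollerup.logGammaSeq, uT]
    rw [Finset.sum_range_succ _ (N + 1), Nat.factorial_succ, Nat.cast_mul, Real.log_mul
      (by positivity) (by positivity)]
    push_cast
    rw [show (N : ℝ) + 1 + 1 = N + 2 by ring, show x + ((N : ℝ) + 1) = x + N + 1 by ring]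
    ring

lemma log_bd (k : ℕ) : 1 / ((k : ℝ) + 2) ≤ Real.log (k + 2) - Real.log (k + 1) ∧
    Real.log ((k : ℝ) + 2) - Real.log (k + 1) ≤ 1 / (k + 1) := by
  rw [← Real.log_div (by positivity) (by positivity)]
  constructor
  · have := Real.one_sub_inv_le_log_of_pos (x := ((k : ℝ) + 2) / (k + 1)) (by positivity)
    refine le_trans (le_of_eq ?_) this
    field_simp
    ring
  · have := Real.log_le_sub_one_of_pos (x := ((k : ℝ) + 2) / (k + 1)) (by positivity)
    refine le_trans this (le_of_eq ?_)
    field_simp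
    ring

lemma uT'_bd (k : ℕ) (x B : ℝ) (hx : 0 < x) (hB : x < B) :
    ‖uT' k x‖ ≤ (B + 1) * (1 / (1 + (k : ℝ)) ^ 2) := by
  obtain ⟨h1, h2⟩ := log_bd k
  have e1 : 1 / ((k : ℝ) + 1) - 1 / (x + k + 1) ≤ (B + 1) * (1 / (1 + (k : ℝ)) ^ 2) := by
    rw [div_sub_div _ _ (by positivity) (by positivity), mul_one_div,
      div_le_div_iff₀ (by positivity) (by positivity)]
    have hk : (0 : ℝ) ≤ k := by positivity
    have : (1 * (x + k + 1) - ((k : ℝ) + 1) * 1) * (1 + (k : ℝ)) ^ 2 =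
      x * ((k + 1) * (k + 1)) := by ring
    rw [this]
    gcongr <;> linarith
  have e2 : 1 / (x + k + 1) - 1 / ((k : ℝ) + 2) ≤ (B + 1) * (1 / (1 + (k : ℝ)) ^ 2) := by
    have : 1 / (x + k + 1) ≤ 1 / ((k : ℝ) + 1) := by gcongr; linarith
    have h3 : 1 / ((k : ℝ) + 1) - 1 / ((k : ℝ) + 2) ≤ 1 * (1 / (1 + (k : ℝ)) ^ 2) := by
      rw [div_sub_div _ _ (by positivity) (by positivity), one_mul (1 / (1 + (k : ℝ)) ^ 2),
        div_le_div_iff₀ (by positivity) (by positivity)]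
      have hk : (0 : ℝ) ≤ k := by positivity
      nlinarith
    have h4 : 1 * (1 / (1 + (k : ℝ)) ^ 2) ≤ (B + 1) * (1 / (1 + (k : ℝ)) ^ 2) := by
      gcongr; linarith
    linarith
  rw [Real.norm_eq_abs, abs_le, uT']
  constructor <;> linarith

lemma uT_hasDerivAt (k : ℕ) (x : ℝ) (hx : 0 < x) : HasDerivAt (uT k) (uT' k x) x := by
  have h1 : HasDerivAt (fun x : ℝ => x + k + 1) 1 x :=
    ((hasDerivAt_id x).add_const (k : ℝ)).add_const 1
  have h2 := h1.log (by positivity)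
  have h3 := (((hasDerivAt_id x).mul_const (Real.log (k + 2) - Real.log (k + 1))).sub
    h2).add_const (Real.log (k + 1))
  refine h3.congr_deriv ?_
  simp [uT']

lemma uT_deriv_all (x : ℝ) (hx : 0 < x) :
    HasDerivAt (fun y => ∑' k, uT k y) (∑' k, uT' k x) x ∧ Summable (fun k => uT k x) := by
  have hs := (PG_summable 2 le_rfl 1 one_pos).mul_left (x + 1 + 1 + 1)
  have h0 : Summable (fun k => uT k 1) := by
    refine summable_zero.congr (fun k => ?_)
    rw [uT, show (1 : ℝ) + k + 1 = k + 2 by ring]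
    ring
  constructor
  · exact hasDerivAt_tsum_of_isPreconnected (𝕜 := ℝ) (F := ℝ) (g := uT) (g' := uT')
      (t := Set.Ioo 0 (x + 1 + 1)) (y₀ := 1) hs isOpen_Ioo isPreconnected_Ioo
      (fun k y hy => uT_hasDerivAt k y hy.1) (fun k y hy => uT'_bd k y _ hy.1 hy.2)
      ⟨one_pos, by linarith⟩ h0 ⟨hx, by linarith⟩
  · exact summable_of_summable_hasDerivAt_of_isPreconnected (𝕜 := ℝ) (F := ℝ) (g := uT) (g' := uT')
      (t := Set.Ioo 0 (x + 1 + 1)) (y₀ := 1) hs isOpen_Ioo isPreconnected_Ioo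
      (fun k y hy => uT_hasDerivAt k y hy.1) (fun k y hy => uT'_bd k y _ hy.1 hy.2)
      ⟨one_pos, by linarith⟩ h0 ⟨hx, by linarith⟩

lemma logGamma_eq (x : ℝ) (hx : 0 < x) :
    Real.log (Real.Gamma x) = (∑' k, uT k x) - Real.log x := by
  have h1 := (uT_deriv_all x hx).2.hasSum.tendsto_sum_nat
  have h2 := Real.BohrMollerup.tendsto_log_gamma hx
  have h3 : Tendsto (fun N : ℕ => Real.log ((N : ℝ) + 1) - Real.log N) atTop (nhds 0) :=
    (Real.tendsto_log_comp_add_sub_log 1).comp tendsto_natCast_atTop_atTop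
  have h4 := (h2.add_const (Real.log x)).add (h3.const_mul x)
  simp_rw [uT_sum] at h1
  have := tendsto_nhds_unique h1 h4
  linarith

/-- digamma -/
noncomputable def dig (x : ℝ) : ℝ := (∑' k, uT' k x) - 1 / x

lemma logGamma_hasDerivAt (x : ℝ) (hx : 0 < x) :
    HasDerivAt (fun y => Real.log (Real.Gamma y)) (dig x) x := by
  have h := (uT_deriv_all x hx).1.sub (Real.hasDerivAt_log hx.ne')
  rw [← one_div] at h
  refine h.congr_of_eventuallyEq ?_
  filter_upwards [Ioi_mem_nhds hx] with y hy
  exact logGamma_eq y hy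

lemma dig_hasDerivAt (x : ℝ) (hx : 0 < x) : HasDerivAt dig (PG 2 x) x := by
  have hs := PG_summable 2 le_rfl 1 one_pos
  have h0 : Summable (fun k => uT' k x) :=
    Summable.of_norm_bounded (hs.mul_left (x + 1 + 1)) (fun k => uT'_bd k x _ hx (by linarith))
  have h1 := hasDerivAt_tsum_of_isPreconnected (𝕜 := ℝ) (F := ℝ) (g := uT')
      (g' := fun k y => 1 / (y + k + 1) ^ 2)
      (t := Set.Ioi 0) (y₀ := x) (y := x) hs isOpen_Ioi isPreconnected_Ioi ?_ ?_ hx h0 hx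
  · have h2 := h1.sub ((hasDerivAt_inv hx.ne'))
    have e : (fun z => ∑' n, uT' n z) - Inv.inv = dig := by
      funext z; simp [dig]
    rw [e] at h2
    refine h2.congr_deriv ?_
    rw [PG, (PG_summable 2 le_rfl x hx).tsum_eq_zero_add]
    simp [add_assoc]
    ring
  · intro k y hy
    have hy' : 0 < y := hy
    have h1 : HasDerivAt (fun x : ℝ => x + k + 1) 1 y :=
      ((hasDerivAt_id y).add_const (k : ℝ)).add_const 1
    have h2 := (h1.inv (by positivity)).const_sub (Real.log (k + 2) - Real.log (k + 1))
    have e : uT' k = fun x => (Real.log (k + 2) - Real.log (k + 1)) - (fun x : ℝ => x + k + 1)⁻¹ x := by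
      funext z; simp [uT']
    rw [e]
    refine h2.congr_deriv ?_
    ring
  · intro k y hy
    have hy' : 0 < y := hy
    rw [Real.norm_of_nonneg (by positivity)]
    gcongr 1 / ?_ ^ 2
    linarith

/-- Derivatives of `log Γ`. -/
noncomputable def DD : ℕ → ℝ → ℝ
  | 0 => dig
  | (m + 1) => fun x => (-1) ^ m * ((m + 1).factorial : ℝ) * PG (m + 2) x

lemma DD_hasDerivAt (m : ℕ) (x : ℝ) (hx : 0 < x) : HasDerivAt (DD m) (DD (m + 1) x) x := by
  cases m with
  | zero => simpa [DD] using dig_hasDerivAt x hx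
  | succ m =>
    have h := (PG_hasDerivAt (m + 2) (by omega) x hx).const_mul
      ((-1) ^ m * ((m + 1).factorial : ℝ))
    refine h.congr_deriv ?_
    simp only [DD]
    rw [Nat.factorial_succ (m + 1)]
    push_cast
    ring

lemma S_iter (n r m : ℕ) (hrn : r ≤ n) : ∀ z : ℝ, -1 < z →
    iteratedDeriv (m + 1) (S n r) z =
      ∑ j ∈ Finset.Icc 1 r, DD m (((n : ℝ) - r + j + z) / 2) / 2 ^ (m + 1) := by
  have hr' : (r : ℝ) ≤ n := by exact_mod_cast hrn
  have hpos : ∀ z : ℝ, -1 < z → ∀ j ∈ Finset.Icc 1 r, 0 < ((n : ℝ) - r + j + z) / 2 := by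
    intro z hz j hj
    have : (1 : ℝ) ≤ j := by exact_mod_cast (Finset.mem_Icc.1 hj).1
    linarith
  have hlin : ∀ (j : ℕ) (z : ℝ), HasDerivAt (fun z : ℝ => ((n : ℝ) - r + j + z) / 2) (1 / 2) z :=
    fun j z => ((hasDerivAt_id z).const_add _).div_const 2
  induction m with
  | zero =>
    intro z hz
    rw [zero_add, iteratedDeriv_one]
    refine HasDerivAt.deriv ?_
    unfold S
    refine HasDerivAt.fun_sum (fun j hj => ?_)
    have := ((logGamma_hasDerivAt _ (hpos z hz j hj)).comp z (hlin j z)).sub_const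
      (Real.log (Real.Gamma (((n : ℝ) - r + j) / 2)))
    refine this.congr_deriv ?_
    simp [DD]
    ring
  | succ m ih =>
    intro z hz
    rw [iteratedDeriv_succ]
    have hev : iteratedDeriv (m + 1) (S n r) =ᶠ[nhds z] fun z =>
        ∑ j ∈ Finset.Icc 1 r, DD m (((n : ℝ) - r + j + z) / 2) / 2 ^ (m + 1) := by
      filter_upwards [Ioi_mem_nhds hz] with y hy
      exact ih y hy
    rw [hev.deriv_eq]
    refine HasDerivAt.deriv ?_
    refine HasDerivAt.fun_sum (fun j hj => ?_)
    have := ((DD_hasDerivAt m _ (hpos z hz j hj)).comp z (hlin j z)).div_const (2 ^ (m + 1))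
    refine this.congr_deriv ?_
    ring

lemma tele (p : ℕ) (t : ℝ) (ht : 0 < t) :
    (p : ℝ) * (1 / (t + 1) ^ (p + 1)) ≤ 1 / t ^ p - 1 / (t + 1) ^ p ∧
      1 / t ^ p - 1 / (t + 1) ^ p ≤ (p : ℝ) * (1 / t ^ (p + 1)) := by
  constructor
  · have h := one_add_mul_le_pow (a := 1 / t) (by have : 0 < 1 / t := by positivity
                                                  linarith) p
    have e : 1 / t ^ p = (1 + 1 / t) ^ p * (1 / (t + 1) ^ p) := by
      rw [show 1 + 1 / t = (t + 1) / t by field_simp, div_pow]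
      field_simp
    have h2 : (1 + p * (1 / t)) * (1 / (t + 1) ^ p) ≤ 1 / t ^ p := by
      rw [e]; gcongr
    have h3 : (p : ℝ) * (1 / (t + 1) ^ (p + 1)) ≤ p * (1 / t) * (1 / (t + 1) ^ p) := by
      rw [mul_assoc, one_div_mul_one_div, pow_succ']
      gcongr
      linarith
    linarith
  · have h := one_add_mul_le_pow (a := -(1 / (t + 1))) (by
        have : 1 / (t + 1) ≤ 1 := by rw [div_le_one (by positivity)]; linarith
        linarith) p
    have e : 1 / (t + 1) ^ p = (1 + -(1 / (t + 1))) ^ p * (1 / t ^ p) := by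
      rw [show 1 + -(1 / (t + 1)) = t / (t + 1) by field_simp; ring, div_pow]
      field_simp
    have h2 : (1 + p * -(1 / (t + 1))) * (1 / t ^ p) ≤ 1 / (t + 1) ^ p := by
      rw [e]; gcongr
    have h3 : p * (1 / (t + 1)) * (1 / t ^ p) ≤ (p : ℝ) * (1 / t ^ (p + 1)) := by
      rw [mul_assoc, one_div_mul_one_div, pow_succ']
      gcongr
      linarith
    linarith

lemma PG_lower (p : ℕ) (hp : 1 ≤ p) (x : ℝ) (hx : 0 < x) :
    1 / x ^ p ≤ p * PG (p + 1) x := by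
  have hs := PG_summable (p + 1) (by omega) x hx
  have key : ∀ N : ℕ, 1 / x ^ p - 1 / (x + N) ^ p ≤ p * PG (p + 1) x := by
    intro N
    have h1 : 1 / x ^ p - 1 / (x + N) ^ p ≤
        p * ∑ k ∈ Finset.range N, 1 / (x + k) ^ (p + 1) := by
      induction N with
      | zero => simp
      | succ N ih =>
        rw [Finset.sum_range_succ, mul_add]
        have := (tele p (x + N) (by positivity)).2
        push_cast
        rw [← add_assoc]
        linarith
    refine h1.trans ?_
    gcongr
    exact hs.sum_le_tsum _ (fun k _ => by positivity)
  have hl : Tendsto (fun N : ℕ => 1 / x ^ p - 1 / (x + N) ^ p) atTop (nhds (1 / x ^ p - 0)) := by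
    refine tendsto_const_nhds.sub ?_
    have : Tendsto (fun N : ℕ => (x + N) ^ p) atTop atTop :=
      (tendsto_pow_atTop (by omega)).comp
        (tendsto_atTop_add_const_left _ x tendsto_natCast_atTop_atTop)
    simp only [one_div]
    exact this.inv_tendsto_atTop
  rw [sub_zero] at hl
  exact le_of_tendsto' hl key

lemma PG_upper (p : ℕ) (hp : 1 ≤ p) (x : ℝ) (hx : 0 < x) :
    p * PG (p + 1) x ≤ 1 / x ^ p + p * (1 / x ^ (p + 1)) := by
  have hs := PG_summable (p + 1) (by omega) x hx
  rw [PG, hs.tsum_eq_zero_add, mul_add]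
  have hp' : (0 : ℝ) < p := by exact_mod_cast hp
  have : ∑' k : ℕ, 1 / (x + ((k + 1 : ℕ) : ℝ)) ^ (p + 1) ≤ (1 / x ^ p) / p := by
    refine Real.tsum_le_of_sum_range_le (fun k => by positivity) (fun N => ?_)
    rw [le_div_iff₀ hp', mul_comm]
    have h1 : p * ∑ k ∈ Finset.range N, 1 / (x + ((k + 1 : ℕ) : ℝ)) ^ (p + 1) ≤
        1 / x ^ p - 1 / (x + N) ^ p := by
      induction N with
      | zero => simp
      | succ N ih =>
        rw [Finset.sum_range_succ, mul_add]
        have := (tele p (x + N) (by positivity)).1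
        push_cast at ih ⊢
        rw [← add_assoc]
        linarith
    have : 0 ≤ 1 / (x + N) ^ p := by positivity
    linarith
  rw [le_div_iff₀ hp'] at this
  simp only [Nat.cast_zero, add_zero]
  linarith

/-- Finite power sums. -/
noncomputable def AA (p : ℕ) (N : ℝ) (r : ℕ) : ℝ := ∑ j ∈ Finset.Icc 1 r, 1 / (N + j) ^ p

lemma AA_bd (p : ℕ) (N : ℝ) (hN : 0 < N) (r : ℕ) :
    p * AA (p + 1) N r ≤ 1 / N ^ p - 1 / (N + r) ^ p ∧
    1 / (N + 1) ^ p - 1 / (N + r + 1) ^ p ≤ p * AA (p + 1) N r := by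
  unfold AA
  induction r with
  | zero => simp
  | succ r ih =>
    rw [Finset.sum_Icc_succ_top (by omega), mul_add]
    have h1 := (tele p (N + r) (by positivity)).1
    have h2 := (tele p (N + r + 1) (by positivity)).2
    push_cast
    rw [← add_assoc]
    constructor <;> linarith [ih.1, ih.2]

lemma AA_log (N : ℝ) (hN : 0 < N) (r : ℕ) :
    AA 1 N r ≤ Real.log (N + r) - Real.log N ∧
    Real.log (N + r + 1) - Real.log (N + 1) ≤ AA 1 N r := by
  have key : ∀ t : ℝ, 0 < t → 1 / (t + 1) ≤ Real.log (t + 1) - Real.log t ∧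
      Real.log (t + 1) - Real.log t ≤ 1 / t := by
    intro t ht
    rw [← Real.log_div (by positivity) (by positivity)]
    constructor
    · have := Real.one_sub_inv_le_log_of_pos (x := (t + 1) / t) (by positivity)
      refine le_trans (le_of_eq ?_) this
      field_simp
      ring
    · have := Real.log_le_sub_one_of_pos (x := (t + 1) / t) (by positivity)
      refine le_trans this (le_of_eq ?_)
      field_simp
      ring
  unfold AA
  induction r with
  | zero => simp
  | succ r ih =>
    rw [Finset.sum_Icc_succ_top (by omega)]
    have h1 := (key (N + r) (by positivity)).1
    have h2 := (key (N + r + 1) (by positivity)).2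
    push_cast
    rw [← add_assoc]
    simp only [pow_one] at ih ⊢
    constructor <;> linarith [ih.1, ih.2]

/-- Normalised derivative sums. -/
noncomputable def QQ (p : ℕ) (N : ℝ) (r : ℕ) : ℝ :=
  ∑ j ∈ Finset.Icc 1 r, p * PG (p + 1) ((N + j) / 2) / 2 ^ (p + 1)

lemma Sder_eq (n r q : ℕ) (hrn : r ≤ n) :
    SderivAt0 n r (q + 2) = (-1) ^ q * (q.factorial : ℝ) * QQ (q + 1) ((n : ℝ) - r) r := by
  rw [SderivAt0, S_iter n r (q + 1) hrn 0 (by norm_num), QQ, Finset.mul_sum]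
  refine Finset.sum_congr rfl (fun j _ => ?_)
  simp only [DD, add_zero]
  rw [Nat.factorial_succ]
  push_cast
  ring

lemma QQ_bd (p : ℕ) (hp : 1 ≤ p) (N : ℝ) (hN : 0 < N) (r : ℕ) :
    AA p N r / 2 ≤ QQ p N r ∧ QQ p N r ≤ AA p N r / 2 + 1 / N ^ p := by
  constructor
  · rw [QQ, AA, Finset.sum_div]
    refine Finset.sum_le_sum (fun j _ => ?_)
    have h := PG_lower p hp ((N + j) / 2) (by positivity)
    rw [le_div_iff₀ (by positivity)]
    refine le_trans (le_of_eq ?_) h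
    rw [div_pow]
    field_simp
    ring
  · have h1 : QQ p N r ≤ AA p N r / 2 + p * AA (p + 1) N r := by
      rw [QQ, AA, AA, Finset.sum_div, Finset.mul_sum, ← Finset.sum_add_distrib]
      refine Finset.sum_le_sum (fun j _ => ?_)
      have h := PG_upper p hp ((N + j) / 2) (by positivity)
      rw [div_le_iff₀ (by positivity)]
      refine le_trans h (le_of_eq ?_)
      rw [div_pow, div_pow]
      field_simp
      ring
    have h2 := (AA_bd p N hN r).1
    have h3 : 0 ≤ 1 / (N + r) ^ p := by positivity
    linarith

lemma dig_bd (x : ℝ) (hx : 1 < x) : Real.log (x - 1) ≤ dig x ∧ dig x ≤ Real.log x := by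
  have hfe : ∀ y : ℝ, 0 < y → Real.log (Real.Gamma (y + 1)) = Real.log (Real.Gamma y) + Real.log y := by
    intro y hy
    rw [Real.Gamma_add_one hy.ne', Real.log_mul hy.ne' (Real.Gamma_pos_of_pos hy).ne', add_comm]
  have hx0 : 0 < x := by linarith
  have hd : HasDerivAt (Real.log ∘ Real.Gamma) (dig x) x := logGamma_hasDerivAt x hx0
  constructor
  · have h := Real.convexOn_log_Gamma.slope_le_of_hasDerivAt (x := x - 1) (y := x)
      (by simpa using hx) hx0 (by linarith) hd
    have h2 := hfe (x - 1) (by linarith)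
    rw [sub_add_cancel] at h2
    rw [slope_def_field] at h
    simp only [Function.comp_apply, sub_sub_cancel, div_one] at h
    linarith
  · have h := Real.convexOn_log_Gamma.le_slope_of_hasDerivAt (x := x) (y := x + 1)
      hx0 (by simp; linarith) (by linarith) hd
    have h2 := hfe x (by linarith)
    rw [slope_def_field] at h
    simp only [Function.comp_apply, add_sub_cancel_left, div_one] at h
    linarith

lemma S1_bd (n r : ℕ) (hrn : r ≤ n) (hN : 2 < (n : ℝ) - r) :
    r / 2 * Real.log (((n : ℝ) - r) / 2 - 1) ≤ SderivAt0 n r 1 ∧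
    SderivAt0 n r 1 ≤ r / 2 * Real.log n := by
  have e : SderivAt0 n r 1 = ∑ j ∈ Finset.Icc 1 r, dig (((n : ℝ) - r + j) / 2) / 2 := by
    rw [SderivAt0, S_iter n r 0 hrn 0 (by norm_num)]
    simp [DD]
  have hc : ∀ c : ℝ, r / 2 * c = ∑ j ∈ Finset.Icc 1 r, c / 2 := by
    intro c; simp; ring
  rw [e, hc, hc]
  constructor
  · refine Finset.sum_le_sum (fun j hj => ?_)
    have hj0 : (0 : ℝ) ≤ j := by positivity
    have := (dig_bd (((n : ℝ) - r + j) / 2) (by linarith)).1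
    have h2 : Real.log (((n : ℝ) - r) / 2 - 1) ≤ Real.log (((n : ℝ) - r + j) / 2 - 1) :=
      Real.log_le_log (by linarith) (by linarith)
    linarith
  · refine Finset.sum_le_sum (fun j hj => ?_)
    have hj0 : (0 : ℝ) ≤ j := by positivity
    have hjr : (j : ℝ) ≤ r := by exact_mod_cast (Finset.mem_Icc.1 hj).2
    have := (dig_bd (((n : ℝ) - r + j) / 2) (by linarith)).2
    have h2 : Real.log (((n : ℝ) - r + j) / 2) ≤ Real.log n :=
      Real.log_le_log (by linarith) (by linarith)
    linarith

lemma QQ_lim (p : ℕ) (hp : 1 ≤ p) (N : ℕ → ℝ) (r : ℕ → ℕ) (β c : ℝ) (hβ : 0 < β)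
    (hN : ∀ᶠ n in atTop, 0 < N n)
    (hx : Tendsto (fun n : ℕ => N n / n) atTop (nhds β))
    (hA : Tendsto (fun n : ℕ => (n : ℝ) ^ (p - 1) * AA p (N n) (r n)) atTop (nhds c)) :
    Tendsto (fun n : ℕ => (n : ℝ) ^ (p - 1) * QQ p (N n) (r n)) atTop (nhds (c / 2)) := by
  have h1 : Tendsto (fun n : ℕ => (n : ℝ) ^ (p - 1) * AA p (N n) (r n) / 2) atTop
    (nhds (c / 2)) := hA.div_const 2
  have h2 : Tendsto (fun n : ℕ => (n : ℝ) ^ (p - 1) * AA p (N n) (r n) / 2 +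
      ((N n / n)⁻¹) ^ p * (1 / (n : ℝ))) atTop (nhds (c / 2)) := by
    have := h1.add (((hx.inv₀ hβ.ne').pow p).mul tendsto_one_div_atTop_nhds_zero_nat)
    simpa using this
  refine tendsto_of_tendsto_of_tendsto_of_le_of_le' h1 h2 ?_ ?_
  · filter_upwards [hN] with n hn
    rw [mul_div_assoc]
    gcongr
    exact (QQ_bd p hp (N n) hn (r n)).1
  · filter_upwards [hN, eventually_ge_atTop 1] with n hn hn1
    have hn0 : (0 : ℝ) < n := by exact_mod_cast hn1
    have h := (QQ_bd p hp (N n) hn (r n)).2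
    have h3 : (n : ℝ) ^ (p - 1) * QQ p (N n) (r n) ≤
      (n : ℝ) ^ (p - 1) * (AA p (N n) (r n) / 2 + 1 / N n ^ p) := by gcongr
    refine h3.trans (le_of_eq ?_)
    obtain ⟨q, rfl⟩ : ∃ q, p = q + 1 := ⟨p - 1, by omega⟩
    rw [mul_add, Nat.add_sub_cancel, inv_div, div_pow, pow_succ (n : ℝ) q]
    field_simp

theorem stmt11 (α : ℝ) (hα : α ∈ Set.Ioo (0 : ℝ) 1)
    (r : ℕ → ℕ) (hr : ∀ n, 1 ≤ n → 1 ≤ r n ∧ r n ≤ n)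
    (hα' : Tendsto (fun n : ℕ => (r n : ℝ) / n) atTop (nhds α)) :
    Tendsto (fun n : ℕ => SderivAt0 n (r n) 1 / ((α * n / 2) * Real.log n))
      atTop (nhds 1)
    ∧ Tendsto (fun n : ℕ => SderivAt0 n (r n) 2)
        atTop (nhds ((1 / 2 : ℝ) * Real.log (1 / (1 - α))))
    ∧ ∀ m : ℕ, 3 ≤ m →
        Tendsto
          (fun n : ℕ => SderivAt0 n (r n) m
            / ((-1 : ℝ) ^ m * ((m - 3).factorial : ℝ) / (2 * (n : ℝ) ^ (m - 2))
                * ((1 - α) ^ (-((m : ℤ) - 2)) - 1)))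
          atTop (nhds 1) := by
  obtain ⟨hα0, hα1⟩ := hα
  have hβ : 0 < 1 - α := by linarith
  have hinv : Tendsto (fun n : ℕ => 1 / (n : ℝ)) atTop (nhds 0) :=
    tendsto_one_div_atTop_nhds_zero_nat
  have hx : Tendsto (fun n : ℕ => ((n : ℝ) - r n) / n) atTop (nhds (1 - α)) := by
    refine (tendsto_const_nhds.sub hα').congr' ?_
    filter_upwards [eventually_ge_atTop 1] with n hn
    have hn0 : (0 : ℝ) < n := by exact_mod_cast hn
    field_simp
  have hNtop : Tendsto (fun n : ℕ => (n : ℝ) - r n) atTop atTop := by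
    refine (hx.pos_mul_atTop hβ tendsto_natCast_atTop_atTop).congr' ?_
    filter_upwards [eventually_ge_atTop 1] with n hn
    have hn0 : (0 : ℝ) < n := by exact_mod_cast hn
    field_simp
  have hN : ∀ᶠ n : ℕ in atTop, 0 < (n : ℝ) - r n := hNtop.eventually_gt_atTop 0
  have hx1 : Tendsto (fun n : ℕ => ((n : ℝ) - r n + 1) / n) atTop (nhds (1 - α)) := by
    have := hx.add hinv
    rw [add_zero] at this
    exact this.congr (fun n => by rw [add_div])
  have hn1 : Tendsto (fun n : ℕ => ((n : ℝ) + 1) / n) atTop (nhds 1) := by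
    have := (tendsto_const_nhds (x := (1 : ℝ))).add hinv
    rw [add_zero] at this
    refine this.congr' ?_
    filter_upwards [eventually_ge_atTop 1] with n hn
    have hn0 : (0 : ℝ) < n := by exact_mod_cast hn
    field_simp
  refine ⟨?_, ?_, ?_⟩
  · -- first derivative
    have hlog : Tendsto (fun n : ℕ => Real.log n) atTop atTop :=
      Real.tendsto_log_atTop.comp tendsto_natCast_atTop_atTop
    have hup : Tendsto (fun n : ℕ => ((r n : ℝ) / n) / α) atTop (nhds 1) := by
      have := hα'.div_const α
      rwa [div_self hα0.ne'] at this
    have hy : Tendsto (fun n : ℕ => (((n : ℝ) - r n) / 2 - 1) / n) atTop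
        (nhds ((1 - α) / 2)) := by
      have := (hx.div_const 2).sub hinv
      rw [sub_zero] at this
      exact this.congr (fun n => by ring)
    have hly := ((Real.continuousAt_log (by positivity : (1 - α) / 2 ≠ 0)).tendsto.comp hy)
    have hq : Tendsto (fun n : ℕ => 1 + Real.log ((((n : ℝ) - r n) / 2 - 1) / n) / Real.log n)
        atTop (nhds 1) := by
      have := (tendsto_const_nhds (x := (1 : ℝ))).add (hly.div_atTop hlog)
      rw [add_zero] at this
      exact this
    have hlow := hup.mul hq
    rw [one_mul] at hlow
    refine tendsto_of_tendsto_of_tendsto_of_le_of_le' hlow hup ?_ ?_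
    · filter_upwards [hNtop.eventually_gt_atTop 2, eventually_ge_atTop 2] with n hn hn2
      have hn2' : (2 : ℝ) ≤ n := by exact_mod_cast hn2
      have hn0 : (0 : ℝ) < n := by linarith
      have hl : 0 < Real.log n := Real.log_pos (by linarith)
      have h := (S1_bd n (r n) (hr n (by omega)).2 hn).1
      rw [le_div_iff₀ (by positivity)]
      refine le_trans (le_of_eq ?_) h
      rw [Real.log_div (by linarith) (by linarith)]
      field_simp
      ring
    · filter_upwards [hNtop.eventually_gt_atTop 2, eventually_ge_atTop 2] with n hn hn2
      have hn2' : (2 : ℝ) ≤ n := by exact_mod_cast hn2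
      have hn0 : (0 : ℝ) < n := by linarith
      have hl : 0 < Real.log n := Real.log_pos (by linarith)
      have h := (S1_bd n (r n) (hr n (by omega)).2 hn).2
      rw [div_le_iff₀ (by positivity)]
      refine le_trans h (le_of_eq ?_)
      field_simp
  · -- second derivative
    have hA : Tendsto (fun n : ℕ => (n : ℝ) ^ (1 - 1) * AA 1 ((n : ℝ) - r n) (r n)) atTop
        (nhds (-Real.log (1 - α))) := by
      have hup := ((Real.continuousAt_log hβ.ne').tendsto.comp hx).neg
      have hlow := ((Real.continuousAt_log one_ne_zero).tendsto.comp hn1).sub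
        ((Real.continuousAt_log hβ.ne').tendsto.comp hx1)
      rw [Real.log_one, zero_sub] at hlow
      refine tendsto_of_tendsto_of_tendsto_of_le_of_le' hlow hup ?_ ?_
      · filter_upwards [hN, eventually_ge_atTop 1] with n hn hn1
        have hn0 : (0 : ℝ) < n := by exact_mod_cast hn1
        have h := (AA_log _ hn (r n)).2
        rw [sub_add_cancel] at h
        simp only [Function.comp_apply, Nat.sub_self, pow_zero, one_mul]
        rw [Real.log_div (by positivity) (by positivity),
          Real.log_div (by positivity) (by positivity)]
        linarith
      · filter_upwards [hN, eventually_ge_atTop 1] with n hn hn1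
        have hn0 : (0 : ℝ) < n := by exact_mod_cast hn1
        have h := (AA_log _ hn (r n)).1
        rw [sub_add_cancel] at h
        simp only [Function.comp_apply, Nat.sub_self, pow_zero, one_mul]
        rw [Real.log_div (by positivity) (by positivity)]
        linarith
    have hQ := QQ_lim 1 le_rfl _ r _ _ hβ hN hx hA
    rw [one_div (1 - α), Real.log_inv]
    rw [show (1 / 2 : ℝ) * -Real.log (1 - α) = -Real.log (1 - α) / 2 by ring]
    refine hQ.congr' ?_
    filter_upwards [eventually_ge_atTop 1] with n hn
    rw [Sder_eq n (r n) 0 (hr n hn).2]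
    simp
  · intro m hm
    obtain ⟨q, rfl⟩ : ∃ q, m = q + 3 := ⟨m - 3, by omega⟩
    have hA : Tendsto (fun n : ℕ => (n : ℝ) ^ (q + 2 - 1) * AA (q + 2) ((n : ℝ) - r n) (r n)) atTop
        (nhds ((((1 - α)⁻¹) ^ (q + 1) - 1) / ((q + 1 : ℕ) : ℝ))) := by
      have hup := ((((hx.inv₀ hβ.ne').pow (q + 1)).sub_const 1).div_const ((q + 1 : ℕ) : ℝ))
      have hlow := ((((hx1.inv₀ hβ.ne').pow (q + 1)).sub
        ((hn1.inv₀ one_ne_zero).pow (q + 1))).div_const ((q + 1 : ℕ) : ℝ))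
      rw [inv_one, one_pow] at hlow
      refine tendsto_of_tendsto_of_tendsto_of_le_of_le' hlow hup ?_ ?_
      · filter_upwards [hN, eventually_ge_atTop 1] with n hn hn1
        have hn0 : (0 : ℝ) < n := by exact_mod_cast hn1
        have h := (AA_bd (q + 1) _ hn (r n)).2
        rw [sub_add_cancel] at h
        rw [div_le_iff₀ (by positivity)]
        have h' := mul_le_mul_of_nonneg_left h (pow_nonneg hn0.le (q + 1))
        have e : (((n : ℝ) - r n + 1) / n)⁻¹ ^ (q + 1) - (((n : ℝ) + 1) / n)⁻¹ ^ (q + 1) =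
            (n : ℝ) ^ (q + 1) * (1 / ((n : ℝ) - r n + 1) ^ (q + 1) - 1 / ((n : ℝ) + 1) ^ (q + 1)) := by
          rw [inv_div, inv_div, div_pow, div_pow]
          ring
        rw [e]
        refine h'.trans (le_of_eq ?_)
        rw [show q + 2 - 1 = q + 1 by omega]
        ring
      · filter_upwards [hN, eventually_ge_atTop 1] with n hn hn1
        have hn0 : (0 : ℝ) < n := by exact_mod_cast hn1
        have h := (AA_bd (q + 1) _ hn (r n)).1
        rw [sub_add_cancel] at h
        rw [le_div_iff₀ (by positivity)]
        have h' := mul_le_mul_of_nonneg_left h (pow_nonneg hn0.le (q + 1))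
        have e : (((n : ℝ) - r n) / n)⁻¹ ^ (q + 1) - 1 =
            (n : ℝ) ^ (q + 1) * (1 / ((n : ℝ) - r n) ^ (q + 1) - 1 / (n : ℝ) ^ (q + 1)) := by
          rw [inv_div, div_pow]
          field_simp
        rw [e]
        refine le_trans (le_of_eq ?_) h'
        rw [show q + 2 - 1 = q + 1 by omega]
        ring
    have hQ := QQ_lim (q + 2) (by omega) _ r _ _ hβ hN hx hA
    have hC : 0 < ((1 - α)⁻¹) ^ (q + 1) - 1 := by
      have : 1 < (1 - α)⁻¹ := by rw [one_lt_inv₀ hβ]; linarith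
      have := one_lt_pow₀ this (n := q + 1) (by omega)
      linarith
    have ez : (1 - α) ^ (-(((q + 3 : ℕ) : ℤ) - 2)) = ((1 - α)⁻¹) ^ (q + 1) := by
      rw [show (-(((q + 3 : ℕ) : ℤ) - 2)) = -((q + 1 : ℕ) : ℤ) by push_cast; ring, zpow_neg,
        zpow_natCast, inv_pow]
    rw [ez]
    set C := ((1 - α)⁻¹) ^ (q + 1) - 1 with hCdef
    have hfin := hQ.mul_const (2 * ((q + 1 : ℕ) : ℝ) / C)
    have e1 : C / ((q + 1 : ℕ) : ℝ) / 2 * (2 * ((q + 1 : ℕ) : ℝ) / C) = 1 := by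
      have : (0 : ℝ) < ((q + 1 : ℕ) : ℝ) := by positivity
      field_simp
    rw [e1] at hfin
    refine hfin.congr' ?_
    filter_upwards [eventually_ge_atTop 1] with n hn
    have hn0 : (0 : ℝ) < n := by exact_mod_cast hn
    rw [Sder_eq n (r n) (q + 1) (hr n hn).2, Nat.factorial_succ]
    rw [show q + 2 - 1 = q + 1 by omega, show q + 3 - 3 = q by omega,
      show q + 3 - 2 = q + 1 by omega, show q + 1 + 1 = q + 2 by omega]
    have hs : ((-1 : ℝ)) ^ (q + 3) = (-1) ^ (q + 1) := by ring
    have hf : (0 : ℝ) < (q.factorial : ℝ) := by positivity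
    have hs0 : ((-1 : ℝ)) ^ (q + 1) ≠ 0 := pow_ne_zero _ (by norm_num)
    rw [hs]
    generalize ((-1 : ℝ)) ^ (q + 1) = s at hs0
    push_cast
    field_simp
end
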